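/- There is an absolute constant M such that for every squarefree integer r ≥ 1 and every real Y > 0, every finite set of pairwise GL₂(ℤ)-inequivalent forms f ∈ V_ℤ with 0 < |Disc(f)| < Y and r² | Disc(f) has cardinality at most M·6^{ω(r)}·Y/r². (Equivalently: the number of GL₂(ℤ)-equivalence classes of integral binary cubic forms of nonzero absolute discriminant less than Y whose discriminant is divisible by r² is finite and at most M·6^{ω(r)}·Y/r².) -/

import Mathlib

open scoped Classical

noncomputable section

/-- An integral binary cubic form `a u³ + b u²v + c uv² + d v³`, recorded by its
coefficient quadruple `(a, b, c, d)`. -/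
abbrev BCF := ℤ × ℤ × ℤ × ℤ

namespace BCF

/-- The discriminant of a binary cubic form. -/
def disc (f : BCF) : ℤ :=
  f.2.1 ^ 2 * f.2.2.1 ^ 2 - 4 * f.1 * f.2.2.1 ^ 3 - 4 * f.2.1 ^ 3 * f.2.2.2
    - 27 * f.1 ^ 2 * f.2.2.2 ^ 2 + 18 * f.1 * f.2.1 * f.2.2.1 * f.2.2.2

/-- The (twisted) action of a matrix `γ` with `det γ = ±1` on binary cubic forms:
`(γ·f)(u,v) = (det γ)⁻¹ · f((u,v)·γ)`, written out on coefficients (for `det γ = ±1`,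
dividing by the determinant is the same as multiplying by it). -/
def act (γ : Matrix (Fin 2) (Fin 2) ℤ) (f : BCF) : BCF :=
  let a := f.1; let b := f.2.1; let c := f.2.2.1; let d := f.2.2.2
  let α := γ 0 0; let β := γ 1 0; let g := γ 0 1; let δ := γ 1 1
  (γ.det * (a * α ^ 3 + b * α ^ 2 * g + c * α * g ^ 2 + d * g ^ 3),
   γ.det * (3 * a * α ^ 2 * β + b * (α ^ 2 * δ + 2 * α * β * g)
      + c * (2 * α * g * δ + β * g ^ 2) + 3 * d * g ^ 2 * δ),
   γ.det * (3 * a * α * β ^ 2 + b * (2 * α * β * δ + β ^ 2 * g)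
      + c * (α * δ ^ 2 + 2 * β * g * δ) + 3 * d * g * δ ^ 2),
   γ.det * (a * β ^ 3 + b * β ^ 2 * δ + c * β * δ ^ 2 + d * δ ^ 3))

/-- `SL₂(ℤ)`-equivalence of binary cubic forms. -/
def SLeq (f g : BCF) : Prop := ∃ γ : Matrix (Fin 2) (Fin 2) ℤ, γ.det = 1 ∧ act γ f = g

/-- `GL₂(ℤ)`-equivalence of binary cubic forms. -/
def GLeq (f g : BCF) : Prop :=
  ∃ γ : Matrix (Fin 2) (Fin 2) ℤ, (γ.det = 1 ∨ γ.det = -1) ∧ act γ f = g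

/-- The Davenport–Heilbronn set `U_p`: `f` is not a multiple of `p`, and no
`GL₂(ℤ)`-transform of `f` has leading coefficient divisible by `p²` and second
coefficient divisible by `p`. -/
def inUp (p : ℕ) (f : BCF) : Prop :=
  (¬ ((p:ℤ) ∣ f.1 ∧ (p:ℤ) ∣ f.2.1 ∧ (p:ℤ) ∣ f.2.2.1 ∧ (p:ℤ) ∣ f.2.2.2)) ∧
  ∀ γ : Matrix (Fin 2) (Fin 2) ℤ, (γ.det = 1 ∨ γ.det = -1) →
    ¬ ((p:ℤ) ^ 2 ∣ (act γ f).1 ∧ (p:ℤ) ∣ (act γ f).2.1)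

/-- Membership in the dual lattice `V̂_ℤ`: the middle coefficients are divisible by 3. -/
def inDual (x : BCF) : Prop := (3:ℤ) ∣ x.2.1 ∧ (3:ℤ) ∣ x.2.2.1

/-- The pairing `[x, y] = x₄y₁ − x₃y₂/3 + x₂y₃/3 − x₁y₄` (an integer for `x ∈ V̂_ℤ`). -/
def pairQ (x y : BCF) : ℚ :=
  (x.2.2.2 * y.1 : ℤ) - ((x.2.2.1 * y.2.1 : ℤ) : ℚ) / 3
    + ((x.2.1 * y.2.2.1 : ℤ) : ℚ) / 3 - (x.1 * y.2.2.2 : ℤ)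

/-- `Φ_q`, the characteristic function of forms nonmaximal at every prime `p | q`. -/
def nonmaxAll (q : ℕ) (f : BCF) : Prop := ∀ p : ℕ, p.Prime → p ∣ q → ¬ inUp p f

/-- The cubic Gauss sum `Φ̂_q(x) = q⁻⁸ Σ_y Φ_q(y) exp(2πi [x,y]/q²)`, the sum running
over forms `y` with coefficients in `{0, …, q² − 1}`. -/
noncomputable def PhiHat (q : ℕ) (x : BCF) : ℂ :=
  ((q : ℂ) ^ 8)⁻¹ *
    ∑ y1 ∈ Finset.range (q ^ 2), ∑ y2 ∈ Finset.range (q ^ 2),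
    ∑ y3 ∈ Finset.range (q ^ 2), ∑ y4 ∈ Finset.range (q ^ 2),
      (if nonmaxAll q ((y1 : ℤ), (y2 : ℤ), (y3 : ℤ), (y4 : ℤ)) then 1 else 0) *
        Complex.exp (2 * Real.pi * Complex.I *
          ((pairQ x ((y1 : ℤ), (y2 : ℤ), (y3 : ℤ), (y4 : ℤ)) : ℚ) : ℂ) / (q : ℂ) ^ 2)

/-- The order of the stabilizer of `x` in `SL₂(ℤ)`. -/
noncomputable def stabCard (x : BCF) : ℕ :=
  Nat.card {γ : Matrix (Fin 2) (Fin 2) ℤ // γ.det = 1 ∧ act γ x = x}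

end BCF

namespace BCF

/-- Plain substitution `f(p u + q v, s u + t v)`. -/
def sub (p q s t : ℤ) (f : BCF) : BCF :=
  (f.1 * p ^ 3 + f.2.1 * p ^ 2 * s + f.2.2.1 * p * s ^ 2 + f.2.2.2 * s ^ 3,
   3 * f.1 * p ^ 2 * q + f.2.1 * (p ^ 2 * t + 2 * p * q * s)
      + f.2.2.1 * (2 * p * s * t + q * s ^ 2) + 3 * f.2.2.2 * s ^ 2 * t,
   3 * f.1 * p * q ^ 2 + f.2.1 * (2 * p * q * t + q ^ 2 * s)
      + f.2.2.1 * (p * t ^ 2 + 2 * q * s * t) + 3 * f.2.2.2 * s * t ^ 2,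
   f.1 * q ^ 3 + f.2.1 * q ^ 2 * t + f.2.2.1 * q * t ^ 2 + f.2.2.2 * t ^ 3)

theorem sub_sub (p q s t p' q' s' t' : ℤ) (f : BCF) :
    sub p' q' s' t' (sub p q s t f) =
      sub (p * p' + q * s') (p * q' + q * t') (s * p' + t * s') (s * q' + t * t') f := by
  simp only [sub, Prod.mk.injEq]
  refine ⟨?_, ?_, ?_, ?_⟩ <;> ring

theorem sub_one (f : BCF) : sub 1 0 0 1 f = f := by
  obtain ⟨a, b, c, d⟩ := f
  simp [sub]

theorem GLeq_iff (f g : BCF) : GLeq f g ↔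
    ∃ p q s t : ℤ, (p * t - q * s = 1 ∨ p * t - q * s = -1) ∧ g = sub p q s t f := by
  constructor
  · rintro ⟨γ, hγ, rfl⟩
    rcases hγ with h | h
    · refine ⟨γ 0 0, γ 1 0, γ 0 1, γ 1 1, ?_, ?_⟩
      · left; rw [Matrix.det_fin_two] at h; linarith
      · simp only [act, h, sub, Prod.mk.injEq]
        refine ⟨?_, ?_, ?_, ?_⟩ <;> ring
    · refine ⟨-γ 0 0, -γ 1 0, -γ 0 1, -γ 1 1, ?_, ?_⟩
      · right; rw [Matrix.det_fin_two] at h; linarith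
      · simp only [act, h, sub, Prod.mk.injEq]
        refine ⟨?_, ?_, ?_, ?_⟩ <;> ring
  · rintro ⟨p, q, s, t, h, rfl⟩
    rcases h with h | h
    · refine ⟨!![p, s; q, t], ?_, ?_⟩
      · left; rw [Matrix.det_fin_two_of]; linarith
      · have : (!![p, s; q, t]).det = 1 := by rw [Matrix.det_fin_two_of]; linarith
        simp only [act, this, sub, Prod.mk.injEq]
        simp
    · refine ⟨!![-p, -s; -q, -t], ?_, ?_⟩
      · right; rw [Matrix.det_fin_two_of]; linarith
      · have : (!![-p, -s; -q, -t]).det = -1 := by rw [Matrix.det_fin_two_of]; linarith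
        simp only [act, this, sub, Prod.mk.injEq]
        simp
        refine ⟨?_, ?_, ?_, ?_⟩ <;> ring

theorem GLeq_refl (f : BCF) : GLeq f f :=
  (GLeq_iff f f).2 ⟨1, 0, 0, 1, by simp, (sub_one f).symm⟩

theorem GLeq_symm {f g : BCF} (h : GLeq f g) : GLeq g f := by
  obtain ⟨p, q, s, t, hd, rfl⟩ := (GLeq_iff f g).1 h
  rw [GLeq_iff]
  rcases hd with h | h
  · refine ⟨t, -q, -s, p, by left; linarith, ?_⟩
    rw [sub_sub]
    conv_lhs => rw [← sub_one f]
    congr 1 <;> linarith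
  · refine ⟨-t, q, s, -p, by right; linarith, ?_⟩
    rw [sub_sub]
    conv_lhs => rw [← sub_one f]
    congr 1 <;> linarith

theorem GLeq_trans {f g k : BCF} (h : GLeq f g) (h' : GLeq g k) : GLeq f k := by
  obtain ⟨p, q, s, t, hd, rfl⟩ := (GLeq_iff f g).1 h
  obtain ⟨p', q', s', t', hd', rfl⟩ := (GLeq_iff _ k).1 h'
  rw [GLeq_iff]
  refine ⟨_, _, _, _, ?_, sub_sub _ _ _ _ _ _ _ _ _⟩
  have : (p * p' + q * s') * (s * q' + t * t') - (p * q' + q * t') * (s * p' + t * s')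
    = (p * t - q * s) * (p' * t' - q' * s') := by ring
  rw [this]
  rcases hd with h | h <;> rcases hd' with h' | h' <;> simp [h, h']

/-- The setoid of `GL₂(ℤ)`-equivalence. -/
def glSetoid : Setoid BCF := ⟨GLeq, ⟨GLeq_refl, GLeq_symm, GLeq_trans⟩⟩

/-- A chosen representative of the class of `f`. -/
def rep (f : BCF) : BCF := (Quotient.mk glSetoid f).out

theorem GLeq_rep (f : BCF) : GLeq (rep f) f :=
  Quotient.exact (s := glSetoid) (Quotient.out_eq (Quotient.mk glSetoid f))

theorem rep_eq {f g : BCF} (h : GLeq f g) : rep f = rep g := by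
  unfold rep
  rw [Quotient.sound (s := glSetoid) h]

theorem rep_eq_iff {f g : BCF} : rep f = rep g ↔ GLeq f g :=
  ⟨fun h => GLeq_trans (GLeq_symm (GLeq_rep f)) (h ▸ GLeq_rep g), rep_eq⟩

theorem disc_sub (p q s t : ℤ) (f : BCF) :
    disc (sub p q s t f) = (p * t - q * s) ^ 6 * disc f := by
  simp only [disc, sub]; ring

theorem disc_GLeq {f g : BCF} (h : GLeq f g) : disc g = disc f := by
  obtain ⟨p, q, s, t, hd, rfl⟩ := (GLeq_iff f g).1 h
  rw [disc_sub]
  rcases hd with h | h <;> rw [h] <;> ring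

/-- Hessian coefficients. -/
def H0 (f : BCF) : ℤ := f.2.1 ^ 2 - 3 * f.1 * f.2.2.1
def H1 (f : BCF) : ℤ := f.2.1 * f.2.2.1 - 9 * f.1 * f.2.2.2
def H2 (f : BCF) : ℤ := f.2.2.1 ^ 2 - 3 * f.2.1 * f.2.2.2

/-- `n` divides the Hessian of `f`. -/
def HD (n : ℤ) (f : BCF) : Prop := n ∣ H0 f ∧ n ∣ H1 f ∧ n ∣ H2 f

theorem H0_sub (p q s t : ℤ) (f : BCF) : H0 (sub p q s t f) =
    (p * t - q * s) ^ 2 * (H0 f * p ^ 2 + H1 f * p * s + H2 f * s ^ 2) := by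
  simp only [H0, H1, H2, sub]; ring
theorem H1_sub (p q s t : ℤ) (f : BCF) : H1 (sub p q s t f) =
    (p * t - q * s) ^ 2 * (2 * H0 f * p * q + H1 f * (p * t + q * s) + 2 * H2 f * s * t) := by
  simp only [H0, H1, H2, sub]; ring
theorem H2_sub (p q s t : ℤ) (f : BCF) : H2 (sub p q s t f) =
    (p * t - q * s) ^ 2 * (H0 f * q ^ 2 + H1 f * q * t + H2 f * t ^ 2) := by
  simp only [H0, H1, H2, sub]; ring

theorem H_disc (f : BCF) : H1 f ^ 2 - 4 * H0 f * H2 f = -3 * disc f := by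
  simp only [H0, H1, H2, disc]; ring

theorem HD_sub (p q s t n : ℤ) {f : BCF} (h : HD n f) : HD n (sub p q s t f) := by
  obtain ⟨⟨x, hx⟩, ⟨y, hy⟩, ⟨z, hz⟩⟩ := h
  refine ⟨?_, ?_, ?_⟩
  · rw [H0_sub, hx, hy, hz]
    exact ⟨(p * t - q * s) ^ 2 * (x * p ^ 2 + y * p * s + z * s ^ 2), by ring⟩
  · rw [H1_sub, hx, hy, hz]
    exact ⟨(p * t - q * s) ^ 2 * (2 * x * p * q + y * (p * t + q * s) + 2 * z * s * t), by ring⟩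
  · rw [H2_sub, hx, hy, hz]
    exact ⟨(p * t - q * s) ^ 2 * (x * q ^ 2 + y * q * t + z * t ^ 2), by ring⟩

theorem HD_GLeq {f g : BCF} (n : ℤ) (h : GLeq f g) : HD n f ↔ HD n g := by
  constructor
  · intro hf
    obtain ⟨p, q, s, t, hd, rfl⟩ := (GLeq_iff f g).1 h
    exact HD_sub _ _ _ _ _ hf
  · intro hf
    obtain ⟨p, q, s, t, h, rfl⟩ := (GLeq_iff g f).1 (GLeq_symm h)
    exact HD_sub _ _ _ _ _ hf

/-- Pairwise inequivalent finite set. -/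
def Sep (S : Finset BCF) : Prop := ∀ f ∈ S, ∀ g ∈ S, f ≠ g → ¬ GLeq f g

/-- Number of classes with property `P` is at most `B`. -/
def NB (P : BCF → Prop) (B : ℝ) : Prop :=
  ∀ S : Finset BCF, (∀ f ∈ S, P f) → Sep S → (S.card : ℝ) ≤ B

theorem Sep.mono {S T : Finset BCF} (h : Sep S) (hT : T ⊆ S) : Sep T :=
  fun f hf g hg => h f (hT hf) g (hT hg)

theorem sep_image_rep {ι : Type*} (S : Finset ι) (φ : ι → BCF) :
    Sep (S.image (fun f => rep (φ f))) := by
  intro f hf g hg hfg h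
  obtain ⟨x, _, rfl⟩ := Finset.mem_image.1 hf
  obtain ⟨y, _, rfl⟩ := Finset.mem_image.1 hg
  apply hfg
  apply rep_eq
  exact GLeq_trans (GLeq_symm (GLeq_rep _)) (GLeq_trans h (GLeq_rep _))

/-- `k`-to-one maps on classes. -/
theorem NB_map {P Q : BCF → Prop} {B : ℝ} (k : ℕ) (φ : BCF → BCF)
    (hQ : ∀ f g, GLeq f g → Q f → Q g)
    (hφ : ∀ f, P f → Q (φ f))
    (hfib : ∀ S : Finset BCF, ∀ g : BCF, (∀ f ∈ S, P f ∧ GLeq (φ f) g) → Sep S → S.card ≤ k)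
    (hB : NB Q B) : NB P (k * B) := by
  intro S hS hsep
  have h1 := hB (S.image (fun f => rep (φ f))) (by
    intro f hf
    obtain ⟨x, hx, rfl⟩ := Finset.mem_image.1 hf
    exact hQ _ _ (GLeq_symm (GLeq_rep _)) (hφ x (hS x hx))) (sep_image_rep _ _)
  have h2 : S.card ≤ k * (S.image (fun f => rep (φ f))).card := by
    apply Finset.card_le_mul_card_image
    intro g hg
    apply hfib _ g
    · intro f hf
      rw [Finset.mem_filter] at hf
      exact ⟨hS f hf.1, hf.2 ▸ GLeq_symm (GLeq_rep _)⟩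
    · exact hsep.mono (Finset.filter_subset _ _)
  calc (S.card : ℝ) ≤ k * (S.image (fun f => rep (φ f))).card := by exact_mod_cast h2
    _ ≤ k * B := by gcongr

end BCF

namespace BCF

open UpperHalfPlane in
theorem redQ (α β γ : ℝ) (hα : 0 < α) (hδ : 0 < 4 * α * γ - β ^ 2) :
    ∃ p q s t : ℤ, p * t - q * s = 1 ∧ 0 < α * (p : ℝ) ^ 2 + β * p * s + γ * s ^ 2 ∧
      3 * (α * p ^ 2 + β * p * s + γ * s ^ 2) ^ 2 ≤ 4 * α * γ - β ^ 2 := by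
  set δ := 4 * α * γ - β ^ 2 with hδd
  have hsq : 0 < Real.sqrt δ := Real.sqrt_pos.2 hδ
  have hss : Real.sqrt δ ^ 2 = δ := Real.sq_sqrt hδ.le
  let z : ℍ := ⟨⟨β / (2 * α), Real.sqrt δ / (2 * α)⟩, by
    show 0 < Real.sqrt δ / (2 * α); positivity⟩
  obtain ⟨g, hg⟩ := ModularGroup.exists_smul_mem_fd z
  have h3 := ModularGroup.three_le_four_mul_im_sq_of_mem_fd hg
  rw [ModularGroup.im_smul_eq_div_normSq] at h3
  have hdet : g 0 0 * g 1 1 - g 0 1 * g 1 0 = 1 := by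
    have := g.det_coe
    rwa [Matrix.det_fin_two] at this
  refine ⟨g 1 1, g 0 1, g 1 0, g 0 0, by linarith, ?_⟩
  set p : ℤ := g 1 1
  set s : ℤ := g 1 0
  have hre : (z : ℂ).re = β / (2 * α) := rfl
  have him : (z : ℂ).im = Real.sqrt δ / (2 * α) := rfl
  have him' : z.im = Real.sqrt δ / (2 * α) := rfl
  have hn : Complex.normSq (denom (g : GL (Fin 2) ℝ) z) =
      (α * p ^ 2 + β * p * s + γ * s ^ 2) / α := by
    rw [ModularGroup.denom_apply, Complex.normSq_apply]
    simp only [Complex.add_re, Complex.mul_re, Complex.intCast_re, Complex.intCast_im,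
      Complex.add_im, Complex.mul_im, hre, him]
    have : γ = (Real.sqrt δ ^ 2 + β ^ 2) / (4 * α) := by
      rw [hss, hδd]; field_simp; ring
    rw [this]
    field_simp
    ring
  rw [hn, him'] at h3
  set N := α * (p : ℝ) ^ 2 + β * p * s + γ * s ^ 2 with hN
  have hNpos : 0 < N := by
    have h4 : 0 ≤ 4 * α * N := by
      have : 4 * α * N = (2 * α * p + β * s) ^ 2 + δ * s ^ 2 := by rw [hN, hδd]; ring
      rw [this]; positivity
    have h5 : 0 ≤ N := by
      by_contra h; push Not at h; nlinarith
    rcases h5.lt_or_eq with h | h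
    · exact h
    · rw [← h] at h3; norm_num at h3
  have e : Real.sqrt δ / (2 * α) / (N / α) = Real.sqrt δ / (2 * N) := by field_simp
  rw [e, div_pow, hss] at h3
  have h6 : 4 * (δ / (2 * N) ^ 2) = δ / N ^ 2 := by field_simp; ring
  rw [h6, le_div_iff₀ (by positivity)] at h3
  exact ⟨hNpos, h3⟩

theorem cubic_root (b c d : ℝ) : ∃ x : ℝ, x ^ 3 + b * x ^ 2 + c * x + d = 0 := by
  set N := 1 + |b| + |c| + |d| with hN
  have hb := abs_nonneg b
  have hc := abs_nonneg c
  have hd := abs_nonneg d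
  have hN1 : 1 ≤ N := by linarith
  have b1 := le_abs_self b
  have b2 := neg_abs_le b
  have c1 := le_abs_self c
  have c2 := neg_abs_le c
  have d1 := le_abs_self d
  have d2 := neg_abs_le d
  have hN2 : N ≤ N ^ 2 := by nlinarith
  have key : N ^ 3 - |b| * N ^ 2 - |c| * N - |d| ≥ 0 := by
    have e : N ^ 3 = (1 + |b| + |c| + |d|) * N ^ 2 := by rw [← hN]; ring
    nlinarith [mul_nonneg hc (sub_nonneg.2 hN2), mul_nonneg hd (sub_nonneg.2 (hN1.trans hN2))]
  have hcont : Continuous (fun x : ℝ => x ^ 3 + b * x ^ 2 + c * x + d) := by fun_prop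
  have h1 : (fun x : ℝ => x ^ 3 + b * x ^ 2 + c * x + d) (-N) ≤ 0 := by
    simp only
    nlinarith [mul_le_mul_of_nonneg_right b1 (sq_nonneg N), mul_le_mul_of_nonneg_right c2 (by linarith : 0 ≤ N)]
  have h2 : 0 ≤ (fun x : ℝ => x ^ 3 + b * x ^ 2 + c * x + d) N := by
    simp only
    nlinarith [mul_le_mul_of_nonneg_right b2 (sq_nonneg N), mul_le_mul_of_nonneg_right c2 (by linarith : 0 ≤ N)]
  obtain ⟨x, _, hx⟩ := intermediate_value_Icc (by linarith : -N ≤ N) hcont.continuousOn ⟨h1, h2⟩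
  exact ⟨x, hx⟩

theorem syzygy (f : BCF) : (2 * f.2.1 ^ 3 - 9 * f.1 * f.2.1 * f.2.2.1 + 27 * f.1 ^ 2 * f.2.2.2) ^ 2
    + 27 * disc f * f.1 ^ 2 = 4 * H0 f ^ 3 := by
  simp only [disc, H0]; ring

theorem red_pos (f : BCF) (h : 0 < disc f) :
    ∃ g, GLeq f g ∧ g.1 ^ 4 ≤ |disc f| ∧ H0 g ^ 2 ≤ 9 * |disc f| := by
  have hd := H_disc f
  have hH0 : 0 < H0 f := by
    have h0 := syzygy f
    by_contra hneg
    push Not at hneg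
    have h1 : 4 * H0 f ^ 3 ≤ 0 := by nlinarith [sq_nonneg (H0 f)]
    have h2 : f.1 = 0 := by
      by_contra hne
      have : 0 < f.1 ^ 2 := by positivity
      nlinarith [sq_nonneg (2 * f.2.1 ^ 3 - 9 * f.1 * f.2.1 * f.2.2.1 + 27 * f.1 ^ 2 * f.2.2.2)]
    have h3 : f.2.1 = 0 := by
      simp only [H0, h2] at hneg
      nlinarith
    simp [disc, h2, h3] at h
  obtain ⟨p, q, s, t, hdet, _, hle⟩ := redQ (H0 f) (H1 f) (H2 f) (by exact_mod_cast hH0) (by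
    have : (0:ℤ) < 4 * H0 f * H2 f - H1 f ^ 2 := by linarith
    exact_mod_cast this)
  have hg : GLeq f (sub p q s t f) := (GLeq_iff _ _).2 ⟨p, q, s, t, Or.inl hdet, rfl⟩
  refine ⟨_, hg, ?_⟩
  have hD := disc_GLeq hg
  have hA := H0_sub p q s t f
  rw [hdet] at hA
  have hle' : 3 * H0 (sub p q s t f) ^ 2 ≤ 4 * H0 f * H2 f - H1 f ^ 2 := by
    rw [hA]
    have : (3:ℤ) * (H0 f * p ^ 2 + H1 f * p * s + H2 f * s ^ 2) ^ 2 ≤ 4 * H0 f * H2 f - H1 f ^ 2 := by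
      exact_mod_cast hle
    linarith
  have hsy := syzygy (sub p q s t f)
  rw [hD] at hsy
  set g := sub p q s t f
  set A := H0 g
  set D := disc f
  rw [abs_of_pos h]
  have hA2 : A ^ 2 ≤ D := by linarith
  refine ⟨?_, by linarith⟩
  have h27 : 27 * D * g.1 ^ 2 ≤ 4 * A ^ 3 := by
    nlinarith [sq_nonneg (2 * g.2.1 ^ 3 - 9 * g.1 * g.2.1 * g.2.2.1 + 27 * g.1 ^ 2 * g.2.2.2)]
  have h1 : (27 * D * g.1 ^ 2) ^ 2 ≤ (4 * A ^ 3) ^ 2 := by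
    apply pow_le_pow_left₀ _ h27
    positivity
  have h2 : (A ^ 2) ^ 3 ≤ D ^ 3 := pow_le_pow_left₀ (sq_nonneg A) hA2 3
  have h3 : D ^ 2 * (729 * g.1 ^ 4) ≤ D ^ 2 * (16 * D) := by nlinarith
  have h4 := le_of_mul_le_mul_left h3 (by positivity)
  nlinarith [sq_nonneg (g.1 ^ 2)]

theorem real_core (m n α β γ : ℝ) (hα : 0 < α) (hδ : 3 * α ^ 2 ≤ 4 * α * γ - β ^ 2) :
    (m * α) ^ 4 ≤ (4 * α * γ - β ^ 2) * (α * n ^ 2 - β * m * n + γ * m ^ 2) ^ 2 ∧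
    ((m * β + n * α) ^ 2 - 3 * (m * α) * (m * γ + n * β)) ^ 2 ≤
      9 * ((4 * α * γ - β ^ 2) * (α * n ^ 2 - β * m * n + γ * m ^ 2) ^ 2) := by
  have hA : (m * β + n * α) ^ 2 - 3 * (m * α) * (m * γ + n * β) =
    α * (α * n ^ 2 - β * m * n + γ * m ^ 2) - (4 * α * γ - β ^ 2) * m ^ 2 := by ring
  have h4 : 4 * α * (α * n ^ 2 - β * m * n + γ * m ^ 2) =
    (2 * α * n - β * m) ^ 2 + (4 * α * γ - β ^ 2) * m ^ 2 := by ring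
  rw [hA]
  set R := α * n ^ 2 - β * m * n + γ * m ^ 2
  set δ := 4 * α * γ - β ^ 2
  have hδ0 : 0 < δ := by nlinarith
  have h5 : δ * m ^ 2 ≤ 4 * (α * R) := by nlinarith [sq_nonneg (2 * α * n - β * m)]
  have h6 : 0 ≤ δ * m ^ 2 := by positivity
  have h7 : 0 ≤ α * R := by linarith
  constructor
  · have h8 : (δ * m ^ 2) ^ 2 ≤ (4 * (α * R)) ^ 2 := pow_le_pow_left₀ h6 h5 2
    have h9 : (3 * α ^ 2) ^ 3 ≤ δ ^ 3 := pow_le_pow_left₀ (by positivity) hδ 3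
    have h10 : δ ^ 2 * (m * α) ^ 4 ≤ δ ^ 2 * (δ * R ^ 2) := by
      calc δ ^ 2 * (m * α) ^ 4 = (δ * m ^ 2) ^ 2 * α ^ 4 := by ring
        _ ≤ (4 * (α * R)) ^ 2 * α ^ 4 := by gcongr
        _ = 16 / 27 * (3 * α ^ 2) ^ 3 * R ^ 2 := by ring
        _ ≤ 16 / 27 * δ ^ 3 * R ^ 2 := by gcongr
        _ ≤ 1 * δ ^ 3 * R ^ 2 := by gcongr; norm_num
        _ = _ := by ring
    exact le_of_mul_le_mul_left h10 (by positivity)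
  · have h8 : (α * R - δ * m ^ 2) ^ 2 ≤ 9 * (α * R) ^ 2 := by nlinarith
    nlinarith [mul_le_mul_of_nonneg_right hδ (sq_nonneg R)]

set_option maxHeartbeats 1000000 in
theorem red_neg (f : BCF) (h : disc f < 0) :
    ∃ g, GLeq f g ∧ g.1 ^ 4 ≤ |disc f| ∧ H0 g ^ 2 ≤ 9 * |disc f| := by
  obtain ⟨m, n, α, β, γ, ha, hb, hc, hd⟩ : ∃ m n α β γ : ℝ, (f.1 : ℝ) = m * α ∧
      (f.2.1 : ℝ) = m * β + n * α ∧ (f.2.2.1 : ℝ) = m * γ + n * β ∧ (f.2.2.2 : ℝ) = n * γ := by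
    by_cases h0 : f.1 = 0
    · exact ⟨0, 1, f.2.1, f.2.2.1, f.2.2.2, by simp [h0]⟩
    · have h0' : (f.1 : ℝ) ≠ 0 := by exact_mod_cast h0
      obtain ⟨x, hx⟩ := cubic_root (f.2.1 / f.1) (f.2.2.1 / f.1) (f.2.2.2 / f.1)
      refine ⟨1, -x, f.1, f.2.1 + f.1 * x, f.2.2.1 + (f.2.1 + f.1 * x) * x, by ring, by ring,
        by ring, ?_⟩
      field_simp at hx
      linarith
  set R := α * n ^ 2 - β * m * n + γ * m ^ 2 with hR
  set δ := 4 * α * γ - β ^ 2 with hδ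
  have hD : (disc f : ℝ) = - δ * R ^ 2 := by
    simp only [disc]
    push_cast
    rw [ha, hb, hc, hd, hδ, hR]
    ring
  have hDneg : (disc f : ℝ) < 0 := by exact_mod_cast h
  have hR0 : 0 < R ^ 2 := by
    rcases (sq_nonneg R).lt_or_eq with h | h
    · exact h
    · rw [← h] at hD; linarith
  have hδ0 : 0 < δ := by
    by_contra hh; push Not at hh; nlinarith
  -- we may assume α > 0
  obtain ⟨m, n, α, β, γ, ha, hb, hc, hd, hα, hδ0⟩ : ∃ m n α β γ : ℝ, (f.1 : ℝ) = m * α ∧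
      (f.2.1 : ℝ) = m * β + n * α ∧ (f.2.2.1 : ℝ) = m * γ + n * β ∧ (f.2.2.2 : ℝ) = n * γ ∧ 0 < α
      ∧ 0 < 4 * α * γ - β ^ 2 := by
    have hα : α ≠ 0 := by
      rintro rfl
      nlinarith [sq_nonneg β]
    rcases lt_or_gt_of_ne hα with h | h
    · exact ⟨-m, -n, -α, -β, -γ, by linarith, by linarith, by linarith, by linarith, by linarith,
        by nlinarith⟩
    · exact ⟨m, n, α, β, γ, ha, hb, hc, hd, h, hδ0⟩
  obtain ⟨p, q, s, t, hdet, hα', hle⟩ := redQ α β γ hα hδ0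
  have hdetR : (p : ℝ) * t - q * s = 1 := by exact_mod_cast hdet
  have hg : GLeq f (sub p q s t f) := (GLeq_iff _ _).2 ⟨p, q, s, t, Or.inl hdet, rfl⟩
  refine ⟨_, hg, ?_⟩
  have hDg := disc_GLeq hg
  set g := sub p q s t f with hgd
  have ga : (g.1 : ℝ) = (m * p + n * s) * (α * p ^ 2 + β * p * s + γ * s ^ 2) := by
    simp only [hgd, sub]; push_cast; rw [ha, hb, hc, hd]; ring
  have gb : (g.2.1 : ℝ) = (m * p + n * s) * (2 * α * p * q + β * (p * t + q * s) + 2 * γ * s * t)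
      + (m * q + n * t) * (α * p ^ 2 + β * p * s + γ * s ^ 2) := by
    simp only [hgd, sub]; push_cast; rw [ha, hb, hc, hd]; ring
  have gc : (g.2.2.1 : ℝ) = (m * p + n * s) * (α * q ^ 2 + β * q * t + γ * t ^ 2)
      + (m * q + n * t) * (2 * α * p * q + β * (p * t + q * s) + 2 * γ * s * t) := by
    simp only [hgd, sub]; push_cast; rw [ha, hb, hc, hd]; ring
  have gd : (g.2.2.2 : ℝ) = (m * q + n * t) * (α * q ^ 2 + β * q * t + γ * t ^ 2) := by
    simp only [hgd, sub]; push_cast; rw [ha, hb, hc, hd]; ring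
  have hδ' : 4 * (α * p ^ 2 + β * p * s + γ * s ^ 2) * (α * q ^ 2 + β * q * t + γ * t ^ 2) -
      (2 * α * p * q + β * (p * t + q * s) + 2 * γ * s * t) ^ 2 = 4 * α * γ - β ^ 2 := by
    have : 4 * (α * p ^ 2 + β * p * s + γ * s ^ 2) * (α * q ^ 2 + β * q * t + γ * t ^ 2) -
      (2 * α * p * q + β * (p * t + q * s) + 2 * γ * s * t) ^ 2 =
      (4 * α * γ - β ^ 2) * ((p : ℝ) * t - q * s) ^ 2 := by ring
    rw [this, hdetR]; ring
  rw [← hδ'] at hle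
  have := real_core (m * p + n * s) (m * q + n * t) _ _ _ hα' hle
  rw [← ga, ← gb, ← gc] at this
  set α' := α * (p : ℝ) ^ 2 + β * p * s + γ * s ^ 2
  set β' := 2 * α * p * q + β * (p * t + q * s) + 2 * γ * s * t
  set γ' := α * (q : ℝ) ^ 2 + β * q * t + γ * t ^ 2
  have hDD : |(disc f : ℝ)| = (4 * α' * γ' - β' ^ 2) * (α' * (m * q + n * t) ^ 2
      - β' * (m * p + n * s) * (m * q + n * t) + γ' * (m * p + n * s) ^ 2) ^ 2 := by
    rw [abs_of_neg hDneg, ← hDg]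
    simp only [disc]
    push_cast
    rw [ga, gb, gc, gd]
    ring
  rw [← hDD] at this
  refine ⟨by exact_mod_cast this.1, ?_⟩
  simp only [H0]
  exact_mod_cast this.2

/-- The reduced shape used for counting. -/
theorem reduce (f : BCF) (h : disc f ≠ 0) :
    ∃ g, GLeq f g ∧ ((g.1 ≠ 0 ∧ g.1 ^ 4 ≤ |disc f| ∧ H0 g ^ 2 ≤ 9 * |disc f| ∧
        0 ≤ g.2.1 ∧ g.2.1 < 3 * |g.1|) ∨
      (g.1 = 0 ∧ g.2.1 ≠ 0 ∧ 0 ≤ g.2.2.1 ∧ g.2.2.1 < 2 * |g.2.1|)) := by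
  obtain ⟨g, hg, h1, h2⟩ : ∃ g, GLeq f g ∧ g.1 ^ 4 ≤ |disc f| ∧ H0 g ^ 2 ≤ 9 * |disc f| := by
    rcases lt_or_gt_of_ne h with h | h
    · exact red_neg f h
    · exact red_pos f h
  have hD := disc_GLeq hg
  by_cases h0 : g.1 = 0
  · have hb : g.2.1 ≠ 0 := by
      intro hb; apply h; rw [← hD]; simp [disc, h0, hb]
    refine ⟨sub 1 (-(g.2.2.1 / (2 * g.2.1))) 0 1 g, GLeq_trans hg ((GLeq_iff _ _).2
      ⟨_, _, _, _, by simp, rfl⟩), Or.inr ⟨by simp [sub, h0], by simp [sub, h0, hb], ?_⟩⟩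
    have e : (sub 1 (-(g.2.2.1 / (2 * g.2.1))) 0 1 g).2.2.1 = g.2.2.1 % (2 * g.2.1) := by
      rw [Int.emod_def]; simp [sub, h0]; ring
    have e' : (sub 1 (-(g.2.2.1 / (2 * g.2.1))) 0 1 g).2.1 = g.2.1 := by
      simp [sub, h0]
    rw [e, e']
    refine ⟨Int.emod_nonneg _ (by simpa using hb), ?_⟩
    have := Int.emod_lt_abs g.2.2.1 (by simpa using hb : 2 * g.2.1 ≠ 0)
    rwa [abs_mul] at this
  · refine ⟨sub 1 (-(g.2.1 / (3 * g.1))) 0 1 g, GLeq_trans hg ((GLeq_iff _ _).2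
      ⟨_, _, _, _, by simp, rfl⟩), Or.inl ?_⟩
    have e : (sub 1 (-(g.2.1 / (3 * g.1))) 0 1 g).2.1 = g.2.1 % (3 * g.1) := by
      rw [Int.emod_def]; simp [sub]; ring
    have e' : (sub 1 (-(g.2.1 / (3 * g.1))) 0 1 g).1 = g.1 := by
      simp [sub]
    have e'' : H0 (sub 1 (-(g.2.1 / (3 * g.1))) 0 1 g) = H0 g := by
      rw [H0_sub]; ring
    rw [e, e', e'']
    refine ⟨h0, h1, h2, Int.emod_nonneg _ (by simpa using h0), ?_⟩
    have := Int.emod_lt_abs g.2.1 (by simpa using h0 : 3 * g.1 ≠ 0)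
    rwa [abs_mul] at this

end BCF

namespace BCF

theorem card_le_of_diff (s : Finset ℤ) (K : ℝ) (hK : 0 ≤ K)
    (h : ∀ x ∈ s, ∀ y ∈ s, ((x - y : ℤ) : ℝ) ≤ K) : (s.card : ℝ) ≤ K + 1 := by
  rcases s.eq_empty_or_nonempty with rfl | hs
  · simp; linarith
  · have h1 := h _ (s.max'_mem hs) _ (s.min'_mem hs)
    have h2 : s ⊆ Finset.Icc (s.min' hs) (s.max' hs) := by
      intro x hx
      exact Finset.mem_Icc.2 ⟨s.min'_le x hx, s.le_max' x hx⟩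
    have h3 := Finset.card_le_card h2
    rw [Int.card_Icc] at h3
    have h4 : s.min' hs ≤ s.max' hs := s.min'_le _ (s.max'_mem hs)
    have h5 : (s.card : ℤ) ≤ s.max' hs + 1 - s.min' hs := by omega
    have h6 : (s.card : ℝ) ≤ s.max' hs + 1 - s.min' hs := by exact_mod_cast h5
    push_cast at h1
    linarith

theorem delta_bound (G1 G2 A W : ℝ) (h2 : 0 ≤ G2) (h12 : G2 ≤ G1)
    (e1 : |G1 ^ 2 - 4 * A ^ 3| ≤ W) (e2 : |G2 ^ 2 - 4 * A ^ 3| ≤ W) :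
    (G1 - G2) ^ 2 ≤ 2 * W ∧ (G1 - G2) ^ 6 * |A| ^ 3 ≤ 4 * W ^ 4 := by
  rw [abs_le] at e1 e2
  have hW : 0 ≤ W := by linarith
  have a1 : (G1 - G2) * (G1 + G2) ≤ 2 * W := by nlinarith
  have a0 : 0 ≤ (G1 - G2) * (G1 + G2) := mul_nonneg (by linarith) (by linarith)
  have a2 : (G1 - G2) ^ 2 ≤ 2 * W := by nlinarith
  refine ⟨a2, ?_⟩
  have hA := abs_nonneg A
  by_cases hc : |A| ^ 3 ≤ W / 2
  · calc (G1 - G2) ^ 6 * |A| ^ 3 = ((G1 - G2) ^ 2) ^ 3 * |A| ^ 3 := by ring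
      _ ≤ (2 * W) ^ 3 * (W / 2) := by gcongr
      _ = 4 * W ^ 4 := by ring
  · push Not at hc
    have hA0 : 0 ≤ A := by
      by_contra h
      push Not at h
      rw [abs_of_neg h] at hc
      nlinarith [sq_nonneg G1]
    rw [abs_of_nonneg hA0] at *
    have b1 : 2 * A ^ 3 ≤ G2 ^ 2 := by linarith
    have b2 : G2 ^ 2 ≤ G1 * G2 := by nlinarith
    have b3 : 8 * A ^ 3 ≤ (G1 + G2) ^ 2 := by nlinarith
    have b4 : (G1 - G2) ^ 2 * (8 * A ^ 3) ≤ 4 * W ^ 2 := by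
      calc (G1 - G2) ^ 2 * (8 * A ^ 3) ≤ (G1 - G2) ^ 2 * (G1 + G2) ^ 2 := by gcongr
        _ = ((G1 - G2) * (G1 + G2)) ^ 2 := by ring
        _ ≤ (2 * W) ^ 2 := by gcongr
        _ = _ := by ring
    have b5 : ((G1 - G2) ^ 2) ^ 2 ≤ (2 * W) ^ 2 := by gcongr
    have b6 : 0 ≤ (G1 - G2) ^ 2 * A ^ 3 := by positivity
    calc (G1 - G2) ^ 6 * A ^ 3 = ((G1 - G2) ^ 2) ^ 2 * ((G1 - G2) ^ 2 * A ^ 3) := by ring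
      _ ≤ (2 * W) ^ 2 * (W ^ 2 / 2) := by
        apply mul_le_mul b5 _ b6 (by positivity)
        linarith
      _ ≤ 4 * W ^ 4 := by nlinarith [sq_nonneg (W ^ 2)]

theorem delta_bound' (G1 G2 A W : ℝ) (hs : (0 ≤ G1 ↔ 0 ≤ G2))
    (e1 : |G1 ^ 2 - 4 * A ^ 3| ≤ W) (e2 : |G2 ^ 2 - 4 * A ^ 3| ≤ W) :
    (G1 - G2) ^ 2 ≤ 2 * W ∧ (G1 - G2) ^ 6 * |A| ^ 3 ≤ 4 * W ^ 4 := by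
  by_cases h : 0 ≤ G1
  · have h' := hs.1 h
    rcases le_total G2 G1 with h12 | h12
    · exact delta_bound _ _ _ _ h' h12 e1 e2
    · have := delta_bound _ _ _ _ h h12 e2 e1
      rw [show (G1 - G2) ^ 2 = (G2 - G1) ^ 2 by ring, show (G1 - G2) ^ 6 = (G2 - G1) ^ 6 by ring]
      exact this
  · have h' : ¬ 0 ≤ G2 := fun h2 => h (hs.2 h2)
    push Not at h h'
    have e1' : |(-G1) ^ 2 - 4 * A ^ 3| ≤ W := by rwa [neg_sq]
    have e2' : |(-G2) ^ 2 - 4 * A ^ 3| ≤ W := by rwa [neg_sq]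
    rcases le_total G2 G1 with h12 | h12
    · have := delta_bound (-G2) (-G1) _ _ (by linarith) (by linarith) e2' e1'
      rw [show (G1 - G2) ^ 2 = (-G2 - -G1) ^ 2 by ring,
        show (G1 - G2) ^ 6 = (-G2 - -G1) ^ 6 by ring]
      exact this
    · have := delta_bound (-G1) (-G2) _ _ (by linarith) (by linarith) e1' e2'
      rw [show (G1 - G2) ^ 2 = (-G1 - -G2) ^ 2 by ring,
        show (G1 - G2) ^ 6 = (-G1 - -G2) ^ 6 by ring]
      exact this

theorem sum_inv_sqrt (n : ℕ) : ∑ j ∈ Finset.range n, 1 / Real.sqrt (j + 1) ≤ 2 * Real.sqrt n := by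
  induction n with
  | zero => simp
  | succ n ih =>
    rw [Finset.sum_range_succ]
    have h1 : 0 < Real.sqrt ((n : ℝ) + 1) := Real.sqrt_pos.2 (by positivity)
    have h0 : 0 ≤ Real.sqrt (n : ℝ) := Real.sqrt_nonneg _
    have s1 : Real.sqrt ((n : ℝ) + 1) ^ 2 = n + 1 := Real.sq_sqrt (by positivity)
    have s0 : Real.sqrt (n : ℝ) ^ 2 = n := Real.sq_sqrt (by positivity)
    have : 1 / Real.sqrt ((n : ℝ) + 1) ≤ 2 * Real.sqrt ((n : ℝ) + 1) - 2 * Real.sqrt n := by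
      rw [div_le_iff₀ h1]
      nlinarith [sq_nonneg (Real.sqrt ((n : ℝ) + 1) - Real.sqrt n)]
    push_cast
    linarith

/-- sixth root -/
def y6 (n : ℕ) : ℝ := (n : ℝ) ^ (1 / 6 : ℝ)

theorem y6_pow (n : ℕ) : y6 n ^ 6 = n := by
  unfold y6
  rw [← Real.rpow_natCast, ← Real.rpow_mul (by positivity)]
  norm_num

theorem y6_nonneg (n : ℕ) : 0 ≤ y6 n := by unfold y6; positivity

theorem y6_pos {n : ℕ} (h : 0 < n) : 0 < y6 n := by unfold y6; positivity

theorem sum_y6 (n : ℕ) : ∑ j ∈ Finset.range n, 1 / y6 (j + 1) ^ 4 ≤ 3 * y6 n ^ 2 := by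
  induction n with
  | zero =>
    simp; positivity
  | succ n ih =>
    rw [Finset.sum_range_succ]
    have h1 : 0 < y6 (n + 1) := y6_pos (by omega)
    have h0 : 0 ≤ y6 n := y6_nonneg n
    have s1 := y6_pow (n + 1)
    have s0 := y6_pow n
    push_cast at s1
    set x := y6 (n + 1) ^ 2 with hx
    set z := y6 n ^ 2 with hz
    have hx0 : 0 < x := by positivity
    have hz0 : 0 ≤ z := by positivity
    have s1' : x ^ 3 = z ^ 3 + 1 := by
      rw [hx, hz, ← pow_mul, ← pow_mul]; norm_num; rw [s1, s0]
    have e : y6 (n + 1) ^ 4 = x ^ 2 := by rw [hx]; ring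
    rw [e]
    have : 1 / x ^ 2 ≤ 3 * x - 3 * z := by
      rw [div_le_iff₀ (by positivity)]
      nlinarith [mul_nonneg (sq_nonneg (x - z)) (by linarith : 0 ≤ 2 * x + z)]
    linarith

end BCF

namespace BCF

/-- cubic covariant leading coefficient -/
def Gc (f : BCF) : ℤ := 2 * f.2.1 ^ 3 - 9 * f.1 * f.2.1 * f.2.2.1 + 27 * f.1 ^ 2 * f.2.2.2

def nn (T : ℝ) (α j : ℕ) : ℝ := if j = 0 then T ^ 6 / α else T ^ 8 / (y6 α ^ 7 * Real.sqrt j)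

theorem nn_nonneg {T : ℝ} (hT : 0 ≤ T) (α j : ℕ) : 0 ≤ nn T α j := by
  unfold nn
  have := y6_nonneg α
  split_ifs <;> positivity

theorem cnt_d (V : Finset BCF) (a b c : ℤ) (T : ℝ) (hT : 0 ≤ T) (ha : a ≠ 0)
    (h : ∀ f ∈ V, f.1 = a ∧ f.2.1 = b ∧ f.2.2.1 = c ∧ |(disc f : ℝ)| < T ^ 12)
    (hG : ∀ f ∈ V, ∀ g ∈ V, (0 ≤ Gc f ↔ 0 ≤ Gc g)) (j : ℕ)
    (hj : 3 * (a.natAbs : ℤ) * j ≤ |b ^ 2 - 3 * a * c|) :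
    (V.card : ℝ) ≤ nn T a.natAbs j + 1 := by
  have hinj : Set.InjOn (fun f : BCF => f.2.2.2) (V : Set BCF) := by
    intro f hf g hg hfg
    obtain ⟨f1, f2, f3, -⟩ := h f hf
    obtain ⟨g1, g2, g3, -⟩ := h g hg
    exact Prod.ext (f1.trans g1.symm) (Prod.ext (f2.trans g2.symm)
      (Prod.ext (f3.trans g3.symm) hfg))
  rw [← Finset.card_image_of_injOn hinj]
  apply card_le_of_diff _ _ (nn_nonneg hT _ _)
  intro x hx y hy
  obtain ⟨f, hf, rfl⟩ := Finset.mem_image.1 hx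
  obtain ⟨g, hg, rfl⟩ := Finset.mem_image.1 hy
  obtain ⟨f1, f2, f3, f4⟩ := h f hf
  obtain ⟨g1, g2, g3, g4⟩ := h g hg
  have hs := hG f hf g hg
  set A : ℝ := ((b ^ 2 - 3 * a * c : ℤ) : ℝ) with hA
  have key : ∀ f : BCF, f.1 = a → f.2.1 = b → f.2.2.1 = c → |(disc f : ℝ)| < T ^ 12 →
      |(Gc f : ℝ) ^ 2 - 4 * A ^ 3| ≤ 27 * a ^ 2 * T ^ 12 := by
    intro f f1 f2 f3 f4
    have : (Gc f : ℝ) ^ 2 - 4 * A ^ 3 = - (27 * a ^ 2 * disc f) := by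
      rw [hA]
      have : Gc f ^ 2 - 4 * (b ^ 2 - 3 * a * c) ^ 3 = - (27 * a ^ 2 * disc f) := by
        rw [← f1, ← f2, ← f3]; simp only [Gc, disc]; ring
      exact_mod_cast this
    rw [this, abs_neg, abs_mul, abs_of_nonneg (by positivity)]
    gcongr
  obtain ⟨d1, d2⟩ := delta_bound' (Gc f) (Gc g) A (27 * a ^ 2 * T ^ 12) (by exact_mod_cast hs)
    (key f f1 f2 f3 f4) (key g g1 g2 g3 g4)
  have hdiff : (Gc f : ℝ) - Gc g = 27 * a ^ 2 * ((f.2.2.2 - g.2.2.2 : ℤ) : ℝ) := by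
    simp only [Gc]
    rw [f1, f2, f3, g1, g2, g3]; push_cast; ring
  rw [hdiff] at d1 d2
  set n : ℝ := ((f.2.2.2 - g.2.2.2 : ℤ) : ℝ)
  show n ≤ _
  have hα : (0 : ℝ) < a.natAbs := by
    have := Int.natAbs_pos.2 ha
    exact_mod_cast this
  have hα2 : (a : ℝ) ^ 2 = (a.natAbs : ℝ) ^ 2 := by
    have : (a : ℝ) = (a : ℤ) := rfl
    rw [← sq_abs]
    rw [show |(a : ℝ)| = (a.natAbs : ℝ) by rw [Nat.cast_natAbs]; push_cast; rfl]
  rw [hα2] at d1 d2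
  have hy := y6_pow a.natAbs
  have hy0 : 0 < y6 a.natAbs := y6_pos (Int.natAbs_pos.2 ha)
  set α : ℝ := (a.natAbs : ℝ)
  rcases le_or_gt n 0 with hn | hn
  · exact hn.trans (nn_nonneg hT _ _)
  unfold nn
  split_ifs with hj0
  · rw [le_div_iff₀ hα]
    apply le_of_sq_le_sq _ (by positivity) 
    have e1 : (α ^ 2) * (729 * (n * α) ^ 2) ≤ α ^ 2 * (54 * T ^ 12) := by nlinarith
    have e2 := le_of_mul_le_mul_left e1 (by positivity)
    have : 0 ≤ T ^ 12 := by positivity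
    rw [show (T ^ 6) ^ 2 = T ^ 12 by ring]
    nlinarith
  · have hj1 : 0 < (j : ℝ) := by have := Nat.pos_of_ne_zero hj0; exact_mod_cast this
    have hsj : 0 < Real.sqrt j := Real.sqrt_pos.2 hj1
    have hsj2 : Real.sqrt j ^ 2 = j := Real.sq_sqrt hj1.le
    have hj' : 3 * α * j ≤ |A| := by
      have h1 : (((3 * (a.natAbs : ℤ) * j : ℤ)) : ℝ) ≤ ((|b ^ 2 - 3 * a * c| : ℤ) : ℝ) := by
        exact_mod_cast hj
      rw [Int.cast_abs] at h1
      have h2 : (((3 * (a.natAbs : ℤ) * j : ℤ)) : ℝ) = 3 * α * j := by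
        push_cast
        rw [show α = |(a : ℝ)| by simp [α, Nat.cast_natAbs]]
      rw [← h2]
      exact h1
    rw [le_div_iff₀ (by positivity)]
    set z := y6 a.natAbs
    set w := Real.sqrt j
    have e1 : (27 * α ^ 2 * n) ^ 6 * (3 * α * j) ^ 3 ≤ 4 * (27 * α ^ 2 * T ^ 12) ^ 4 :=
      le_trans (by gcongr) d2
    have e2 : α ^ 8 * (27 ^ 7 * (n ^ 6 * α ^ 7 * j ^ 3)) ≤ α ^ 8 * (4 * 27 ^ 4 * T ^ 48) := by
      calc _ = (27 * α ^ 2 * n) ^ 6 * (3 * α * j) ^ 3 := by ring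
        _ ≤ _ := e1
        _ = _ := by ring
    have e3 := le_of_mul_le_mul_left e2 (by positivity)
    have hT48 : 0 ≤ T ^ 48 := by positivity
    have e4 : n ^ 6 * α ^ 7 * j ^ 3 ≤ T ^ 48 := by linarith
    have e5 : (n * (z ^ 7 * w)) ^ 6 ≤ (T ^ 8) ^ 6 := by
      calc (n * (z ^ 7 * w)) ^ 6 = n ^ 6 * (z ^ 6) ^ 7 * (w ^ 2) ^ 3 := by ring
        _ = n ^ 6 * α ^ 7 * j ^ 3 := by rw [hy, hsj2]
        _ ≤ T ^ 48 := e4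
        _ = _ := by ring
    exact le_of_pow_le_pow_left₀ (by norm_num) (by positivity) e5

theorem cnt_j (V : Finset BCF) (a b : ℤ) (T : ℝ) (hT : 0 ≤ T) (ha : a ≠ 0) (j : ℕ)
    (h : ∀ f ∈ V, f.1 = a ∧ f.2.1 = b ∧ |(disc f : ℝ)| < T ^ 12 ∧
      3 * (a.natAbs : ℤ) * j ≤ |H0 f| ∧ |H0 f| < 3 * (a.natAbs : ℤ) * (j + 1)) :
    (V.card : ℝ) ≤ 4 * (nn T a.natAbs j + 1) := by
  let φ : BCF → Bool × Bool := fun f => (decide (0 ≤ H0 f), decide (0 ≤ Gc f))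
  have e : (V.card : ℝ) = ∑ s : Bool × Bool, ((V.filter (fun f => φ f = s)).card : ℝ) := by
    rw [Finset.card_eq_sum_card_fiberwise (f := φ) (t := Finset.univ) (by simp)]
    push_cast; rfl
  rw [e]
  have : ∀ s ∈ (Finset.univ : Finset (Bool × Bool)),
      ((V.filter (fun f => φ f = s)).card : ℝ) ≤ nn T a.natAbs j + 1 := by
    intro s _
    rcases (V.filter (fun f => φ f = s)).eq_empty_or_nonempty with h0 | ⟨f0, hf0⟩
    · rw [h0]; have := nn_nonneg hT a.natAbs j; simp; linarith
    · have hf0' := Finset.mem_filter.1 hf0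
      obtain ⟨f1, f2, f3, f4, f5⟩ := h f0 hf0'.1
      apply cnt_d _ a b f0.2.2.1 T hT ha
      · intro f hf
        rw [Finset.mem_filter] at hf
        obtain ⟨g1, g2, g3, g4, g5⟩ := h f hf.1
        refine ⟨g1, g2, ?_, g3⟩
        have hs : (0 ≤ H0 f ↔ 0 ≤ H0 f0) := by
          have := congrArg Prod.fst (hf.2.trans hf0'.2.symm)
          simpa [φ] using this
        have hlt : |H0 f - H0 f0| < 3 * (a.natAbs : ℤ) := by
          by_cases hh : 0 ≤ H0 f
          · have hh' := hs.1 hh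
            rw [abs_of_nonneg hh] at g4 g5
            rw [abs_of_nonneg hh'] at f4 f5
            rw [abs_lt]; constructor <;> nlinarith
          · have hh' : ¬ 0 ≤ H0 f0 := fun h2 => hh (hs.2 h2)
            push Not at hh hh'
            rw [abs_of_neg hh] at g4 g5
            rw [abs_of_neg hh'] at f4 f5
            rw [abs_lt]; constructor <;> nlinarith
        have e3 : H0 f - H0 f0 = 3 * a * (f0.2.2.1 - f.2.2.1) := by
          simp only [H0]; rw [g1, g2, f1, f2]; ring
        rw [e3, abs_mul, abs_mul, Int.natCast_natAbs] at hlt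
        have ha' : 0 < |a| := abs_pos.2 ha
        have : |f0.2.2.1 - f.2.2.1| < 1 := by
          simp at hlt
          by_contra hcon
          push Not at hcon
          nlinarith
        rw [Int.abs_lt_one_iff] at this
        linarith
      · intro f hf g hg
        rw [Finset.mem_filter] at hf hg
        have := congrArg Prod.snd (hf.2.trans hg.2.symm)
        simpa [φ] using this
      · simp only [H0] at f4
        rw [f1, f2] at f4
        exact f4
  refine (Finset.sum_le_card_nsmul _ _ _ this).trans ?_
  simp
  linarith

theorem sum_nn (T : ℝ) (hT : 0 ≤ T) (α : ℕ) (hα : 0 < α) :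
    ∑ j ∈ Finset.range (⌊T ^ 6 / α⌋₊ + 1), 4 * (nn T α j + 1) ≤
      8 * (T ^ 6 / α) + 4 + 8 * T ^ 11 / y6 α ^ 10 := by
  rw [← Finset.mul_sum, Finset.sum_add_distrib, Finset.sum_range_succ']
  set J := ⌊T ^ 6 / α⌋₊ with hJ
  have hJle : (J : ℝ) ≤ T ^ 6 / α := Nat.floor_le (by positivity)
  have hy := y6_pow α
  have hy0 : 0 < y6 α := y6_pos hα
  have e1 : ∑ k ∈ Finset.range J, nn T α (k + 1) =
      T ^ 8 / y6 α ^ 7 * ∑ k ∈ Finset.range J, 1 / Real.sqrt (k + 1) := by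
    rw [Finset.mul_sum]
    apply Finset.sum_congr rfl
    intro k _
    unfold nn
    rw [if_neg (by omega)]
    push_cast
    rw [div_mul_div_comm, mul_one]
  have e2 : Real.sqrt J ≤ T ^ 3 / y6 α ^ 3 := by
    apply Real.sqrt_le_iff.2
    refine ⟨by positivity, hJle.trans ?_⟩
    rw [← hy, div_pow]
    apply le_of_eq; congr 1 <;> ring
  have e3 := sum_inv_sqrt J
  have e0 : nn T α 0 = T ^ 6 / α := by unfold nn; simp
  rw [e0, e1]
  simp only [Finset.sum_const, Finset.card_range, nsmul_eq_mul, mul_one]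
  have e4 : T ^ 8 / y6 α ^ 7 * ∑ k ∈ Finset.range J, 1 / Real.sqrt (k + 1) ≤
      T ^ 8 / y6 α ^ 7 * (2 * (T ^ 3 / y6 α ^ 3)) := by
    gcongr; linarith
  have e5 : T ^ 8 / y6 α ^ 7 * (2 * (T ^ 3 / y6 α ^ 3)) = 2 * T ^ 11 / y6 α ^ 10 := by
    field_simp
  rw [e5] at e4
  have e6 : 8 * T ^ 11 / y6 α ^ 10 = 4 * (2 * T ^ 11 / y6 α ^ 10) := by ring
  rw [e6]
  push_cast
  linarith

theorem cnt_ab (V : Finset BCF) (a b : ℤ) (T : ℝ) (hT : 0 ≤ T) (ha : a ≠ 0)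
    (h : ∀ f ∈ V, f.1 = a ∧ f.2.1 = b ∧ |(disc f : ℝ)| < T ^ 12 ∧
      (H0 f : ℝ) ^ 2 ≤ 9 * T ^ 12) :
    (V.card : ℝ) ≤ 8 * (T ^ 6 / a.natAbs) + 4 + 8 * T ^ 11 / y6 a.natAbs ^ 10 := by
  refine le_trans ?_ (sum_nn T hT a.natAbs (Int.natAbs_pos.2 ha))
  have hα : 0 < a.natAbs := Int.natAbs_pos.2 ha
  let φ : BCF → ℕ := fun f => (H0 f).natAbs / (3 * a.natAbs)
  rw [Finset.card_eq_sum_card_fiberwise (f := φ)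
    (t := Finset.range (⌊T ^ 6 / (a.natAbs : ℝ)⌋₊ + 1)) ?_]
  · push_cast
    apply Finset.sum_le_sum
    intro j _
    apply cnt_j _ a b T hT ha j
    intro f hf
    rw [Finset.mem_filter] at hf
    obtain ⟨h1, h2, h3, h4⟩ := h f hf.1
    refine ⟨h1, h2, h3, ?_⟩
    have hj := hf.2
    simp only [φ] at hj
    have q1 := Nat.div_mul_le_self (H0 f).natAbs (3 * a.natAbs)
    have q2 := Nat.lt_div_mul_add (a := (H0 f).natAbs) (b := 3 * a.natAbs) (by omega)
    rw [hj] at q1 q2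
    zify at q1 q2
    simp only [Int.natCast_natAbs]
    constructor <;> nlinarith
  · intro f hf
    obtain ⟨h1, h2, h3, h4⟩ := h f hf
    rw [Finset.mem_coe, Finset.mem_range, Nat.lt_succ_iff]
    apply Nat.le_floor
    have hα' : (0 : ℝ) < a.natAbs := by exact_mod_cast hα
    rw [le_div_iff₀ hα']
    have q1 := Nat.div_mul_le_self (H0 f).natAbs (3 * a.natAbs)
    have q1' : ((φ f : ℝ)) * (3 * a.natAbs) ≤ ((H0 f).natAbs : ℝ) := by exact_mod_cast q1
    have q2 : ((H0 f).natAbs : ℝ) ≤ 3 * T ^ 6 := by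
      apply le_of_sq_le_sq _ (by positivity)
      rw [Nat.cast_natAbs, Int.cast_abs, sq_abs]
      calc _ ≤ _ := h4
        _ = _ := by ring
    linarith

theorem cnt_a (V : Finset BCF) (α : ℕ) (T : ℝ) (hT : 0 ≤ T) (hα : 0 < α)
    (h : ∀ f ∈ V, f.1.natAbs = α ∧ 0 ≤ f.2.1 ∧ f.2.1 < 3 * |f.1| ∧ |(disc f : ℝ)| < T ^ 12 ∧
      (H0 f : ℝ) ^ 2 ≤ 9 * T ^ 12) :
    (V.card : ℝ) ≤ 48 * T ^ 6 + 24 * α + 48 * T ^ 11 / y6 α ^ 4 := by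
  let φ : BCF → ℤ × ℤ := fun f => (f.1, f.2.1)
  have hy := y6_pow α
  have hy0 : 0 < y6 α := y6_pos hα
  have hα' : (0 : ℝ) < α := by exact_mod_cast hα
  set t : Finset (ℤ × ℤ) := ({(α : ℤ), -(α : ℤ)} : Finset ℤ) ×ˢ Finset.Ico (0 : ℤ) (3 * α)
  have ht : (t.card : ℝ) ≤ 6 * α := by
    have h1 : t.card ≤ 2 * (3 * α) := by
      rw [Finset.card_product]
      apply Nat.mul_le_mul Finset.card_le_two
      simp
    have : (t.card : ℝ) ≤ ((2 * (3 * α) : ℕ) : ℝ) := by exact_mod_cast h1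
    push_cast at this
    linarith
  rw [Finset.card_eq_sum_card_fiberwise (f := φ) (t := t) ?_]
  · push_cast
    have : ∀ s ∈ t, ((V.filter (fun f => φ f = s)).card : ℝ) ≤
        8 * (T ^ 6 / α) + 4 + 8 * T ^ 11 / y6 α ^ 10 := by
      intro s hs
      have hs1 : s.1.natAbs = α := by
        have := (Finset.mem_product.1 hs).1
        simp at this
        rcases this with h | h <;> rw [h] <;> simp
      rw [← hs1]
      apply cnt_ab _ s.1 s.2 T hT (by rintro h0; rw [h0] at hs1; simp at hs1; omega)
      intro f hf
      rw [Finset.mem_filter] at hf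
      obtain ⟨h1, h2, h3, h4, h5⟩ := h f hf.1
      rw [← hf.2]
      exact ⟨rfl, rfl, h4, h5⟩
    refine (Finset.sum_le_card_nsmul _ _ _ this).trans ?_
    rw [nsmul_eq_mul]
    calc _ ≤ 6 * α * (8 * (T ^ 6 / α) + 4 + 8 * T ^ 11 / y6 α ^ 10) := by gcongr
      _ = 48 * T ^ 6 + 24 * α + 48 * T ^ 11 / y6 α ^ 4 := by
        rw [← hy]; field_simp; ring
  · intro f hf
    obtain ⟨h1, h2, h3, h4, h5⟩ := h f hf
    simp only [t, φ, Finset.coe_product, Set.mem_prod, Finset.mem_coe, Finset.mem_insert,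
      Finset.mem_singleton, Finset.mem_Ico]
    rw [← h1]
    refine ⟨?_, h2, by rw [Int.natCast_natAbs]; exact h3⟩
    omega

theorem cnt_nonzero (V : Finset BCF) (T : ℝ) (hT : 1 ≤ T)
    (h : ∀ f ∈ V, f.1 ≠ 0 ∧ (f.1 : ℝ) ^ 4 ≤ T ^ 12 ∧ 0 ≤ f.2.1 ∧ f.2.1 < 3 * |f.1| ∧
      |(disc f : ℝ)| < T ^ 12 ∧ (H0 f : ℝ) ^ 2 ≤ 9 * T ^ 12) :
    (V.card : ℝ) ≤ 216 * T ^ 12 := by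
  have hT0 : 0 ≤ T := by linarith
  set N := ⌊T ^ 3⌋₊
  have hN : (N : ℝ) ≤ T ^ 3 := Nat.floor_le (by positivity)
  let φ : BCF → ℕ := fun f => f.1.natAbs - 1
  rw [Finset.card_eq_sum_card_fiberwise (f := φ) (t := Finset.range N) ?_]
  · push_cast
    calc ∑ x ∈ Finset.range N, ((V.filter (fun f => φ f = x)).card : ℝ) ≤
        ∑ x ∈ Finset.range N, (72 * T ^ 9 + 48 * T ^ 11 * (1 / y6 (x + 1) ^ 4)) := by
          apply Finset.sum_le_sum
          intro x hx
          have := cnt_a (V.filter (fun f => φ f = x)) (x + 1) T hT0 (by omega) (by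
            intro f hf
            rw [Finset.mem_filter] at hf
            obtain ⟨h1, h2, h3, h4, h5, h6⟩ := h f hf.1
            refine ⟨?_, h3, h4, h5, h6⟩
            have := hf.2
            simp only [φ] at this
            have := Int.natAbs_pos.2 h1
            omega)
          refine this.trans ?_
          have hx1 : ((x + 1 : ℕ) : ℝ) ≤ T ^ 3 := by
            refine le_trans ?_ hN
            exact_mod_cast Finset.mem_range.1 hx
          have p1 : T ^ 3 ≤ T ^ 9 := pow_le_pow_right₀ hT (by norm_num)
          have p2 : T ^ 6 ≤ T ^ 9 := pow_le_pow_right₀ hT (by norm_num)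
          have : 48 * T ^ 11 / y6 (x + 1) ^ 4 = 48 * T ^ 11 * (1 / y6 (x + 1) ^ 4) := by ring
          linarith
      _ = N * (72 * T ^ 9) + 48 * T ^ 11 * ∑ x ∈ Finset.range N, (1 / y6 (x + 1) ^ 4) := by
          rw [Finset.sum_add_distrib, Finset.mul_sum]; simp
      _ ≤ T ^ 3 * (72 * T ^ 9) + 48 * T ^ 11 * (3 * T) := by
          have h1 := sum_y6 N
          have h2 : y6 N ^ 2 ≤ T := by
            apply le_of_pow_le_pow_left₀ (n := 3) (by norm_num) hT0
            rw [← pow_mul]; rw [y6_pow]; exact hN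
          gcongr
          linarith
      _ = 216 * T ^ 12 := by ring
  · intro f hf
    obtain ⟨h1, h2, h3, h4, h5, h6⟩ := h f hf
    rw [Finset.mem_coe, Finset.mem_range]
    have h7 : (f.1.natAbs : ℝ) ≤ T ^ 3 := by
      apply le_of_pow_le_pow_left₀ (n := 4) (by norm_num) (by positivity)
      rw [Nat.cast_natAbs, Int.cast_abs]
      rw [show |(f.1 : ℝ)| ^ 4 = (f.1 : ℝ) ^ 4 from by
        rw [show (4 : ℕ) = 2 * 2 by norm_num, pow_mul, pow_mul, sq_abs]]
      calc _ ≤ _ := h2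
        _ = _ := by ring
    have h8 : f.1.natAbs ≤ N := Nat.le_floor h7
    have := Int.natAbs_pos.2 h1
    simp only [φ]
    omega

theorem sum_inv_sq (n : ℕ) :
    ∑ x ∈ Finset.range n, 1 / ((x : ℝ) + 1) ^ 2 ≤ 2 - 1 / (n : ℝ) := by
  induction n with
  | zero => norm_num
  | succ n ih =>
    rw [Finset.sum_range_succ]
    rcases Nat.eq_zero_or_pos n with rfl | hn
    · norm_num
    · have hn' : (0 : ℝ) < n := by exact_mod_cast hn
      have : 1 / ((n : ℝ) + 1) ^ 2 ≤ 1 / (n : ℝ) - 1 / ((n : ℝ) + 1) := by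
        rw [div_sub_div _ _ (by positivity) (by positivity),
          div_le_div_iff₀ (by positivity) (by positivity)]
        nlinarith
      push_cast
      linarith

theorem cnt_zero_bc (V : Finset BCF) (b c : ℤ) (X : ℝ) (hX : 0 ≤ X) (hb : b ≠ 0)
    (h : ∀ f ∈ V, f.1 = 0 ∧ f.2.1 = b ∧ f.2.2.1 = c ∧ |(disc f : ℝ)| < X) :
    (V.card : ℝ) ≤ X / (2 * b.natAbs ^ 3) + 1 := by
  have hinj : Set.InjOn (fun f : BCF => f.2.2.2) (V : Set BCF) := by
    intro f hf g hg hfg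
    obtain ⟨f1, f2, f3, -⟩ := h f hf
    obtain ⟨g1, g2, g3, -⟩ := h g hg
    exact Prod.ext (f1.trans g1.symm) (Prod.ext (f2.trans g2.symm)
      (Prod.ext (f3.trans g3.symm) hfg))
  rw [← Finset.card_image_of_injOn hinj]
  apply card_le_of_diff _ _ (by positivity)
  intro x hx y hy
  obtain ⟨f, hf, rfl⟩ := Finset.mem_image.1 hx
  obtain ⟨g, hg, rfl⟩ := Finset.mem_image.1 hy
  obtain ⟨f1, f2, f3, f4⟩ := h f hf
  obtain ⟨g1, g2, g3, g4⟩ := h g hg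
  have hα : (0 : ℝ) < b.natAbs := by
    have := Int.natAbs_pos.2 hb
    exact_mod_cast this
  rw [le_div_iff₀ (by positivity)]
  have e : (disc g : ℝ) - disc f = 4 * b ^ 3 * ((f.2.2.2 - g.2.2.2 : ℤ) : ℝ) := by
    have : disc g - disc f = 4 * b ^ 3 * (f.2.2.2 - g.2.2.2) := by
      simp only [disc]; rw [f1, f2, f3, g1, g2, g3]; ring
    exact_mod_cast this
  set n : ℝ := ((f.2.2.2 - g.2.2.2 : ℤ) : ℝ)
  have e1 : |4 * (b : ℝ) ^ 3 * n| ≤ 2 * X := by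
    rw [← e]
    have := abs_sub (disc g : ℝ) (disc f)
    linarith
  rw [abs_mul, abs_mul, abs_pow] at e1
  have e2 : |(b : ℝ)| = b.natAbs := by rw [Nat.cast_natAbs, Int.cast_abs]
  rw [e2] at e1
  have e3 : |(4 : ℝ)| = 4 := by norm_num
  rw [e3] at e1
  have e4 : 4 * (b.natAbs : ℝ) ^ 3 * n ≤ 4 * (b.natAbs : ℝ) ^ 3 * |n| := by
    gcongr; exact le_abs_self n
  linarith

theorem cnt_zero_b (V : Finset BCF) (β : ℕ) (X : ℝ) (hX : 0 ≤ X) (hβ : 0 < β)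
    (h : ∀ f ∈ V, f.1 = 0 ∧ f.2.1.natAbs = β ∧ 0 ≤ f.2.2.1 ∧ f.2.2.1 < 2 * |f.2.1| ∧
      |(disc f : ℝ)| < X) :
    (V.card : ℝ) ≤ 2 * X * (1 / β ^ 2) + 4 * β := by
  let φ : BCF → ℤ × ℤ := fun f => (f.2.1, f.2.2.1)
  have hβ' : (0 : ℝ) < β := by exact_mod_cast hβ
  set t : Finset (ℤ × ℤ) := ({(β : ℤ), -(β : ℤ)} : Finset ℤ) ×ˢ Finset.Ico (0 : ℤ) (2 * β)
  have ht : (t.card : ℝ) ≤ 4 * β := by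
    have h1 : t.card ≤ 2 * (2 * β) := by
      rw [Finset.card_product]
      apply Nat.mul_le_mul Finset.card_le_two
      simp
    have : (t.card : ℝ) ≤ ((2 * (2 * β) : ℕ) : ℝ) := by exact_mod_cast h1
    push_cast at this
    linarith
  rw [Finset.card_eq_sum_card_fiberwise (f := φ) (t := t) ?_]
  · push_cast
    have : ∀ s ∈ t, ((V.filter (fun f => φ f = s)).card : ℝ) ≤ X / (2 * β ^ 3) + 1 := by
      intro s hs
      have hs1 : s.1.natAbs = β := by
        have := (Finset.mem_product.1 hs).1
        simp at this
        rcases this with h | h <;> rw [h] <;> simp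
      rw [← hs1]
      apply cnt_zero_bc _ s.1 s.2 X hX (by rintro h0; rw [h0] at hs1; simp at hs1; omega)
      intro f hf
      rw [Finset.mem_filter] at hf
      obtain ⟨h1, h2, h3, h4, h5⟩ := h f hf.1
      rw [← hf.2]
      exact ⟨h1, rfl, rfl, h5⟩
    refine (Finset.sum_le_card_nsmul _ _ _ this).trans ?_
    rw [nsmul_eq_mul]
    calc _ ≤ 4 * β * (X / (2 * β ^ 3) + 1) := by gcongr
      _ = _ := by field_simp; ring
  · intro f hf
    obtain ⟨h1, h2, h3, h4, h5⟩ := h f hf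
    simp only [t, φ, Finset.coe_product, Set.mem_prod, Finset.mem_coe, Finset.mem_insert,
      Finset.mem_singleton, Finset.mem_Ico]
    rw [← h2]
    refine ⟨?_, h3, by rw [Int.natCast_natAbs]; exact h4⟩
    omega

theorem cnt_zero (V : Finset BCF) (X : ℝ) (hX : 0 ≤ X)
    (h : ∀ f ∈ V, f.1 = 0 ∧ f.2.1 ≠ 0 ∧ 0 ≤ f.2.2.1 ∧ f.2.2.1 < 2 * |f.2.1| ∧ disc f ≠ 0 ∧
      |(disc f : ℝ)| < X) :
    (V.card : ℝ) ≤ 8 * X := by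
  set N := ⌊Real.sqrt X⌋₊
  have hN : (N : ℝ) ≤ Real.sqrt X := Nat.floor_le (by positivity)
  have hss : Real.sqrt X ^ 2 = X := Real.sq_sqrt hX
  have hNX : (N : ℝ) ^ 2 ≤ X := by rw [← hss]; gcongr
  let φ : BCF → ℕ := fun f => f.2.1.natAbs - 1
  rw [Finset.card_eq_sum_card_fiberwise (f := φ) (t := Finset.range N) ?_]
  · push_cast
    calc ∑ x ∈ Finset.range N, ((V.filter (fun f => φ f = x)).card : ℝ) ≤
        ∑ x ∈ Finset.range N, (2 * X * (1 / ((x : ℝ) + 1) ^ 2) + 4 * N) := by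
          apply Finset.sum_le_sum
          intro x hx
          have := cnt_zero_b (V.filter (fun f => φ f = x)) (x + 1) X hX (by omega) (by
            intro f hf
            rw [Finset.mem_filter] at hf
            obtain ⟨h1, h2, h3, h4, h5, h6⟩ := h f hf.1
            refine ⟨h1, ?_, h3, h4, h6⟩
            have := hf.2
            simp only [φ] at this
            have := Int.natAbs_pos.2 h2
            omega)
          refine this.trans ?_
          have hx1 : ((x + 1 : ℕ) : ℝ) ≤ N := by
            exact_mod_cast Finset.mem_range.1 hx
          push_cast at hx1 ⊢
          linarith
      _ = 2 * X * ∑ x ∈ Finset.range N, 1 / ((x : ℝ) + 1) ^ 2 + 4 * N ^ 2 := by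
          rw [Finset.sum_add_distrib, Finset.mul_sum]; simp; ring
      _ ≤ 2 * X * 2 + 4 * X := by
          have h1 := sum_inv_sq N
          have h2 : 0 ≤ 1 / (N : ℝ) := by positivity
          gcongr
          linarith
      _ = 8 * X := by ring
  · intro f hf
    obtain ⟨h1, h2, h3, h4, h5, h6⟩ := h f hf
    rw [Finset.mem_coe, Finset.mem_range]
    have e : disc f = f.2.1 ^ 2 * (f.2.2.1 ^ 2 - 4 * f.2.1 * f.2.2.2) := by
      simp only [disc]; rw [h1]; ring
    have e1 : f.2.1 ^ 2 ≤ |disc f| :=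
      Int.le_of_dvd (abs_pos.2 h5) ((dvd_abs _ _).2 ⟨_, e⟩)
    have e2 : (f.2.1 : ℝ) ^ 2 ≤ |(disc f : ℝ)| := by exact_mod_cast e1
    have h7 : (f.2.1.natAbs : ℝ) ≤ Real.sqrt X := by
      apply Real.le_sqrt_of_sq_le
      rw [Nat.cast_natAbs, Int.cast_abs, sq_abs]
      linarith
    have h8 : f.2.1.natAbs ≤ N := Nat.le_floor h7
    have := Int.natAbs_pos.2 h2
    simp only [φ]
    omega

/-- Davenport's bound. -/
theorem davenport (X : ℝ) (hX : 0 < X) :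
    NB (fun f => disc f ≠ 0 ∧ |(disc f : ℝ)| < X) (224 * X) := by
  intro S hS hsep
  by_cases hX1 : X < 1
  · have : S = ∅ := by
      apply Finset.eq_empty_of_forall_notMem
      intro f hf
      obtain ⟨h1, h2⟩ := hS f hf
      have h3 : (1 : ℤ) ≤ |disc f| := Int.one_le_abs h1
      have h4 : (1 : ℝ) ≤ |(disc f : ℝ)| := by exact_mod_cast h3
      linarith
    rw [this]; simp; linarith
  push Not at hX1
  let ψ : BCF → BCF := fun f => if h : disc f ≠ 0 then (reduce f h).choose else f
  have hψ : ∀ f ∈ S, GLeq f (ψ f) ∧ (((ψ f).1 ≠ 0 ∧ (ψ f).1 ^ 4 ≤ |disc f| ∧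
        H0 (ψ f) ^ 2 ≤ 9 * |disc f| ∧
        0 ≤ (ψ f).2.1 ∧ (ψ f).2.1 < 3 * |(ψ f).1|) ∨
      ((ψ f).1 = 0 ∧ (ψ f).2.1 ≠ 0 ∧ 0 ≤ (ψ f).2.2.1 ∧ (ψ f).2.2.1 < 2 * |(ψ f).2.1|)) := by
    intro f hf
    have h := (hS f hf).1
    simp only [ψ, dif_pos h]
    exact (reduce f h).choose_spec
  have hinj : Set.InjOn ψ (S : Set BCF) := by
    intro f hf g hg hfg
    by_contra hne
    apply hsep f hf g hg hne
    exact GLeq_trans (hψ f hf).1 (hfg ▸ GLeq_symm (hψ g hg).1)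
  rw [← Finset.card_image_of_injOn hinj]
  set V := S.image ψ
  rw [← Finset.card_filter_add_card_filter_not (s := V) (fun f => f.1 = 0)]
  push_cast
  have c1 : ((V.filter (fun f => f.1 = 0)).card : ℝ) ≤ 8 * X := by
    apply cnt_zero _ X hX.le
    intro g hg
    obtain ⟨hg, hg0⟩ := Finset.mem_filter.1 hg
    obtain ⟨f, hf, rfl⟩ := Finset.mem_image.1 hg
    obtain ⟨h1, h2⟩ := hψ f hf
    have hD := disc_GLeq h1
    rcases h2 with h2 | h2
    · exact absurd hg0 h2.1
    · rw [hD]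
      exact ⟨h2.1, h2.2.1, h2.2.2.1, h2.2.2.2, hS f hf⟩
  have c2 : ((V.filter (fun f => ¬ f.1 = 0)).card : ℝ) ≤ 216 * X := by
    obtain ⟨T, hT1, hTX⟩ : ∃ T : ℝ, 1 ≤ T ∧ T ^ 12 = X := by
      refine ⟨X ^ (1 / 12 : ℝ), Real.one_le_rpow hX1 (by norm_num), ?_⟩
      rw [← Real.rpow_natCast, ← Real.rpow_mul hX.le]
      norm_num
    rw [← hTX]
    apply cnt_nonzero _ T hT1
    intro g hg
    obtain ⟨hg, hg0⟩ := Finset.mem_filter.1 hg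
    obtain ⟨f, hf, rfl⟩ := Finset.mem_image.1 hg
    obtain ⟨h1, h2⟩ := hψ f hf
    have hD := disc_GLeq h1
    rcases h2 with h2 | h2
    · rw [hD, hTX]
      have hd := (hS f hf).2
      have q1 : ((ψ f).1 : ℝ) ^ 4 ≤ |(disc f : ℝ)| := by exact_mod_cast h2.2.1
      have q2 : (H0 (ψ f) : ℝ) ^ 2 ≤ 9 * |(disc f : ℝ)| := by exact_mod_cast h2.2.2.1
      exact ⟨hg0, by linarith, h2.2.2.2.1, h2.2.2.2.2, hd, by linarith⟩
    · exact absurd h2.1 hg0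
  linarith

end BCF

namespace BCF

theorem exists_dbl (p : ℕ) (hp : p.Prime) (h5 : 5 ≤ p) (f : BCF) (hD : (p : ℤ) ^ 2 ∣ disc f)
    (hH : ¬ HD p f) : ∃ g, GLeq f g ∧ (p : ℤ) ∣ g.2.2.1 ∧ (p : ℤ) ^ 2 ∣ g.2.2.2 ∧
      ¬ (p : ℤ) ∣ g.2.1 := by
  have hpp : Prime (p : ℤ) := Nat.prime_iff_prime_int.1 hp
  have hp2 : ¬ (p : ℤ) ∣ 2 := by
    intro h; have := Int.le_of_dvd (by norm_num) h; omega
  have hp3 : ¬ (p : ℤ) ∣ 3 := by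
    intro h; have := Int.le_of_dvd (by norm_num) h; omega
  have hpD : (p : ℤ) ∣ disc f := dvd_trans (dvd_pow_self _ (by norm_num)) hD
  -- step 1 : a form whose Hessian has H2 divisible by p
  obtain ⟨g, hg, hg2⟩ : ∃ g, GLeq f g ∧ (p : ℤ) ∣ H2 g := by
    by_cases h0 : (p : ℤ) ∣ H0 f
    · refine ⟨sub 0 1 1 0 f, (GLeq_iff _ _).2 ⟨_, _, _, _, by simp, rfl⟩, ?_⟩
      rw [H2_sub]; simpa using h0
    · have hc : IsCoprime (2 * H0 f) (p : ℤ) := by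
        apply IsCoprime.symm
        rw [Prime.coprime_iff_not_dvd hpp]
        intro h
        rcases hpp.dvd_or_dvd h with h | h
        · exact hp2 h
        · exact h0 h
      obtain ⟨u, v, huv⟩ := hc
      refine ⟨sub 1 (-u * H1 f) 0 1 f, (GLeq_iff _ _).2 ⟨_, _, _, _, by simp, rfl⟩, ?_⟩
      rw [H2_sub]
      have : (p : ℤ) ∣ 2 * (2 * H0 f) * (H0 f * (-u * H1 f) ^ 2 + H1 f * (-u * H1 f) + H2 f) := by
        have e : 2 * (2 * H0 f) * (H0 f * (-u * H1 f) ^ 2 + H1 f * (-u * H1 f) + H2 f) =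
          (2 * H0 f * (-u * H1 f) + H1 f) ^ 2 - (H1 f ^ 2 - 4 * H0 f * H2 f) := by ring
        rw [e, H_disc]
        have e2 : 2 * H0 f * (-u * H1 f) + H1 f = p * (v * H1 f) := by
          have : u * (2 * H0 f) = 1 - v * p := by linarith
          linear_combination (- H1 f) * this
        rw [e2]
        apply dvd_sub
        · exact dvd_pow (Dvd.intro _ rfl) (by norm_num)
        · exact Dvd.dvd.mul_left hpD _
      rcases hpp.dvd_or_dvd this with h | h
      · rcases hpp.dvd_or_dvd h with h | h
        · exact absurd h hp2
        · rcases hpp.dvd_or_dvd h with h | h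
          · exact absurd h hp2
          · exact absurd h h0
      · simpa using h
  refine ⟨g, hg, ?_⟩
  rw [← disc_GLeq hg] at hD hpD
  rw [HD_GLeq p hg] at hH
  have h1 : (p : ℤ) ∣ H1 g := by
    apply hpp.dvd_of_dvd_pow (n := 2)
    have e := H_disc g
    have : H1 g ^ 2 = 4 * H0 g * H2 g + -3 * disc g := by linarith
    rw [this]
    exact dvd_add (Dvd.dvd.mul_left hg2 _) (Dvd.dvd.mul_left hpD _)
  have h0 : ¬ (p : ℤ) ∣ H0 g := fun h => hH ⟨h, h1, hg2⟩
  obtain ⟨a, b, c, d⟩ := g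
  simp only [H0, H1, H2] at h0 h1 hg2
  simp only [disc] at hD
  simp only
  have hc : (p : ℤ) ∣ c := by
    have : (p : ℤ) ∣ c * (b ^ 2 - 3 * a * c) := by
      have e : c * (b ^ 2 - 3 * a * c) = b * (b * c - 9 * a * d) - 3 * a * (c ^ 2 - 3 * b * d) := by
        ring
      rw [e]
      exact dvd_sub (Dvd.dvd.mul_left h1 _) (Dvd.dvd.mul_left hg2 _)
    rcases hpp.dvd_or_dvd this with h | h
    · exact h
    · exact absurd h h0
  have hb : ¬ (p : ℤ) ∣ b := by
    intro hb
    apply h0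
    exact dvd_sub (Dvd.dvd.pow hb (by norm_num)) (Dvd.dvd.mul_left hc _)
  have hd : (p : ℤ) ∣ d := by
    have : (p : ℤ) ∣ 3 * (b * d) := by
      have e : 3 * (b * d) = c * c - (c ^ 2 - 3 * b * d) := by ring
      rw [e]
      exact dvd_sub (Dvd.dvd.mul_left hc _) hg2
    rcases hpp.dvd_or_dvd this with h | h
    · exact absurd h hp3
    · rcases hpp.dvd_or_dvd h with h | h
      · exact absurd h hb
      · exact h
  refine ⟨hc, ?_, hb⟩
  obtain ⟨c', rfl⟩ := hc
  obtain ⟨d', rfl⟩ := hd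
  have : (p : ℤ) ^ 2 ∣ p * (2 * 2 * (b ^ 3 * d')) := by
    have e : p * (2 * 2 * (b ^ 3 * d')) = p ^ 2 * (b ^ 2 * c' ^ 2 - 4 * a * p * c' ^ 3 -
       27 * a ^ 2 * d' ^ 2 + 18 * a * b * c' * d') - (b ^ 2 * (p * c') ^ 2 - 4 * a * (p * c') ^ 3
       - 4 * b ^ 3 * (p * d') - 27 * a ^ 2 * (p * d') ^ 2 + 18 * a * b * (p * c') * (p * d')) := by
      ring
    rw [e]
    exact dvd_sub (Dvd.intro _ rfl) hD
  rw [pow_two] at this ⊢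
  have := Int.dvd_of_mul_dvd_mul_left (by exact hpp.ne_zero) this
  apply mul_dvd_mul_left
  rcases hpp.dvd_or_dvd this with h | h
  · rcases hpp.dvd_or_dvd h with h | h <;> exact absurd h hp2
  · rcases hpp.dvd_or_dvd h with h | h
    · exact absurd (hpp.dvd_of_dvd_pow h) hb
    · exact h

/-- Overring form. -/
theorem exists_over (p : ℕ) (hp : p.Prime) (h5 : 5 ≤ p) (f : BCF) (hD : (p : ℤ) ^ 2 ∣ disc f)
    (hH : ¬ HD p f) : ∃ k : BCF, ∃ a : ℤ, k.1 = p * a ∧ ¬ (p : ℤ) ∣ k.2.1 ∧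
      GLeq f (a, k.2.1, p * k.2.2.1, p ^ 2 * k.2.2.2) := by
  obtain ⟨⟨a, b, c, d⟩, hg, ⟨c', hc⟩, ⟨d', hd⟩, hb⟩ := exists_dbl p hp h5 f hD hH
  simp only at hc hd hb
  subst hc hd
  exact ⟨(p * a, b, c', d'), a, rfl, hb, hg⟩

theorem over_inj (p : ℕ) (hp : p ≠ 0) (k1 k2 : BCF) (a1 a2 : ℤ) (h1 : k1.1 = p * a1)
    (h2 : k2.1 = p * a2) (P Q s t : ℤ) (hdet : P * t - Q * (p * s) = 1 ∨ P * t - Q * (p * s) = -1)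
    (h : k2 = sub P Q (p * s) t k1) :
    GLeq (a1, k1.2.1, p * k1.2.2.1, p ^ 2 * k1.2.2.2)
      (a2, k2.2.1, p * k2.2.2.1, p ^ 2 * k2.2.2.2) := by
  rw [GLeq_iff]
  refine ⟨P, p * Q, s, t, ?_, ?_⟩
  · rw [show P * t - p * Q * s = P * t - Q * (p * s) by ring]; exact hdet
  · obtain ⟨A, b, c, d⟩ := k1
    obtain ⟨A', b', c', d'⟩ := k2
    simp only [sub, Prod.mk.injEq] at h1 h2 h ⊢
    obtain ⟨e1, e2, e3, e4⟩ := h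
    have hp' : (p : ℤ) ≠ 0 := by exact_mod_cast hp
    subst h1 h2
    refine ⟨?_, ?_, ?_, ?_⟩
    · apply mul_left_cancel₀ hp'
      rw [e1]; ring
    · rw [e2]; ring
    · rw [e3]; ring
    · rw [e4]; ring

open Polynomial in
theorem root_count (p : ℕ) [Fact p.Prime] (k : BCF) (hk : ¬ ((p : ℤ) ∣ k.1 ∧ (p : ℤ) ∣ k.2.1 ∧
    (p : ℤ) ∣ k.2.2.1 ∧ (p : ℤ) ∣ k.2.2.2)) (R : Finset (Option (ZMod p)))
    (h1 : ∀ x, some x ∈ R → (k.1 : ZMod p) * x ^ 3 + k.2.1 * x ^ 2 + k.2.2.1 * x + k.2.2.2 = 0)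
    (h2 : none ∈ R → (k.1 : ZMod p) = 0) : R.card ≤ 3 := by
  set c : Cubic (ZMod p) := ⟨k.1, k.2.1, k.2.2.1, k.2.2.2⟩
  have hc : c.toPoly ≠ 0 := by
    intro h
    apply hk
    have h0 := (Cubic.toPoly_eq_zero_iff c).1 h
    have e1 : (k.1 : ZMod p) = 0 := congrArg Cubic.a h0
    have e2 : (k.2.1 : ZMod p) = 0 := congrArg Cubic.b h0
    have e3 : (k.2.2.1 : ZMod p) = 0 := congrArg Cubic.c h0
    have e4 : (k.2.2.2 : ZMod p) = 0 := congrArg Cubic.d h0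
    rw [ZMod.intCast_zmod_eq_zero_iff_dvd] at e1 e2 e3 e4
    exact ⟨e1, e2, e3, e4⟩
  have hsub : R.eraseNone ⊆ c.toPoly.roots.toFinset := by
    intro x hx
    rw [Finset.mem_eraseNone] at hx
    rw [Multiset.mem_toFinset, mem_roots hc, IsRoot.def]
    simp only [Cubic.toPoly, eval_add, eval_mul, eval_C, eval_pow, eval_X]
    exact h1 x hx
  have hcard := (Finset.card_le_card hsub).trans
    ((Multiset.toFinset_card_le _).trans (card_roots' c.toPoly))
  by_cases hn : none ∈ R
  · have : c.toPoly.natDegree ≤ 2 := Cubic.natDegree_of_a_eq_zero (h2 hn)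
    have h3 := Finset.card_eraseNone_eq_card_erase R
    have := Finset.card_erase_of_mem hn
    omega
  · have : c.toPoly.natDegree ≤ 3 := natDegree_cubic_le
    have h3 := Finset.card_eraseNone_eq_card_erase R
    have := Finset.erase_eq_of_notMem hn
    rw [this] at h3
    omega

theorem fib_three (p : ℕ) [Fact p.Prime] (S : Finset BCF) (g : BCF) (φ : BCF → BCF)
    (h : ∀ f ∈ S, (∃ a : ℤ, (φ f).1 = p * a ∧ ¬ (p : ℤ) ∣ (φ f).2.1 ∧
      GLeq f (a, (φ f).2.1, p * (φ f).2.2.1, p ^ 2 * (φ f).2.2.2)) ∧ GLeq (φ f) g)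
    (hsep : Sep S) : S.card ≤ 3 := by
  rcases S.eq_empty_or_nonempty with rfl | ⟨f0, hf0⟩
  · simp
  have hp : p.Prime := Fact.out
  have h' : ∀ f ∈ S, ∃ a P Q s t : ℤ, (φ f).1 = p * a ∧
      GLeq f (a, (φ f).2.1, p * (φ f).2.2.1, p ^ 2 * (φ f).2.2.2) ∧
      (P * t - Q * s = 1 ∨ P * t - Q * s = -1) ∧ φ f = sub P Q s t g := by
    intro f hf
    obtain ⟨⟨a, h1, _, h2⟩, h3⟩ := h f hf
    obtain ⟨P, Q, s, t, h4, h5⟩ := (GLeq_iff _ _).1 (GLeq_symm h3)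
    exact ⟨a, P, Q, s, t, h1, h2, h4, h5⟩
  choose! a P Q s t H1 H2 H3 H4 using h'
  let ρ : BCF → Option (ZMod p) := fun f =>
    if (s f : ZMod p) = 0 then none else some ((P f : ZMod p) / (s f))
  have hinj : Set.InjOn ρ (S : Set BCF) := by
    intro f1 hf1 f2 hf2 h12
    by_contra hne
    apply hsep f1 hf1 f2 hf2 hne
    have hdvd : (p : ℤ) ∣ P f1 * s f2 - P f2 * s f1 := by
      rw [← ZMod.intCast_zmod_eq_zero_iff_dvd]
      push_cast
      simp only [ρ] at h12
      split_ifs at h12 with c1 c2 c2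
      · rw [c1, c2]; ring
      · have := Option.some.inj h12
        rw [div_eq_div_iff c1 c2] at this
        rw [this]; ring
    obtain ⟨w, hw⟩ := hdvd
    refine GLeq_trans (H2 f1 hf1) (GLeq_trans ?_ (GLeq_symm (H2 f2 hf2)))
    have e1 := H4 f1 hf1
    have e2 := H4 f2 hf2
    have d1 := H3 f1 hf1
    have d2 := H3 f2 hf2
    rcases d1 with d1 | d1
    · apply over_inj p hp.ne_zero (φ f1) (φ f2) _ _ (H1 f1 hf1) (H1 f2 hf2)
        (t f1 * P f2 - Q f1 * s f2) (t f1 * Q f2 - Q f1 * t f2) w (P f1 * t f2 - s f1 * Q f2)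
      · rw [← hw]
        have : (t f1 * P f2 - Q f1 * s f2) * (P f1 * t f2 - s f1 * Q f2) -
          (t f1 * Q f2 - Q f1 * t f2) * (P f1 * s f2 - P f2 * s f1) =
          (P f1 * t f1 - Q f1 * s f1) * (P f2 * t f2 - Q f2 * s f2) := by ring
        rw [this, d1, one_mul]; exact d2
      · rw [← hw, e1, sub_sub, e2]
        congr 1
        · linear_combination (- P f2) * d1
        · linear_combination (- Q f2) * d1
        · linear_combination (- s f2) * d1
        · linear_combination (- t f2) * d1
    · apply over_inj p hp.ne_zero (φ f1) (φ f2) _ _ (H1 f1 hf1) (H1 f2 hf2)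
        (-(t f1 * P f2 - Q f1 * s f2)) (-(t f1 * Q f2 - Q f1 * t f2)) (-w)
        (-(P f1 * t f2 - s f1 * Q f2))
      · rw [mul_neg (p : ℤ) w, ← hw]
        have : -(t f1 * P f2 - Q f1 * s f2) * -(P f1 * t f2 - s f1 * Q f2) -
          -(t f1 * Q f2 - Q f1 * t f2) * -(P f1 * s f2 - P f2 * s f1) =
          (P f1 * t f1 - Q f1 * s f1) * (P f2 * t f2 - Q f2 * s f2) := by ring
        rw [this, d1]
        rcases d2 with d2 | d2 <;> rw [d2] <;> simp
      · rw [mul_neg (p : ℤ) w, ← hw, e1, sub_sub, e2]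
        congr 1
        · linear_combination (P f2) * d1
        · linear_combination (Q f2) * d1
        · linear_combination (s f2) * d1
        · linear_combination (t f2) * d1
  rw [← Finset.card_image_of_injOn hinj]
  have hval : ∀ f ∈ S, (g.1 : ZMod p) * P f ^ 3 + g.2.1 * P f ^ 2 * s f + g.2.2.1 * P f * s f ^ 2
      + g.2.2.2 * s f ^ 3 = 0 := by
    intro f hf
    have e1 : (p : ℤ) ∣ (φ f).1 := ⟨_, H1 f hf⟩
    rw [H4 f hf, ← ZMod.intCast_zmod_eq_zero_iff_dvd] at e1
    simp only [sub] at e1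
    push_cast at e1
    exact e1
  apply root_count p g
  · rintro ⟨⟨g1, h1⟩, ⟨g2, h2⟩, ⟨g3, h3⟩, ⟨g4, h4⟩⟩
    obtain ⟨⟨_, _, hb, _⟩, _⟩ := h f0 hf0
    apply hb
    rw [H4 f0 hf0]
    simp only [sub]
    rw [h1, h2, h3, h4]
    exact ⟨3 * g1 * P f0 ^ 2 * Q f0 + g2 * (P f0 ^ 2 * t f0 + 2 * P f0 * Q f0 * s f0) +
      g3 * (2 * P f0 * s f0 * t f0 + Q f0 * s f0 ^ 2) + 3 * g4 * s f0 ^ 2 * t f0, by ring⟩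
  · intro x hx
    obtain ⟨f, hf, hfx⟩ := Finset.mem_image.1 hx
    simp only [ρ] at hfx
    split_ifs at hfx with c1
    have hfx := Option.some.inj hfx
    rw [← hfx]
    have := hval f hf
    field_simp
    linear_combination this
  · intro hx
    obtain ⟨f, hf, hfx⟩ := Finset.mem_image.1 hx
    simp only [ρ] at hfx
    split_ifs at hfx with c1
    have h1 := hval f hf
    rw [c1] at h1
    have h2 : (g.1 : ZMod p) * (P f : ZMod p) ^ 3 = 0 := by linear_combination h1
    rcases mul_eq_zero.1 h2 with h3 | h3
    · exact h3
    · exfalso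
      have hP : (P f : ZMod p) = 0 := pow_eq_zero_iff (by norm_num) |>.1 h3
      have hd := H3 f hf
      have : ((P f * t f - Q f * s f : ℤ) : ZMod p) = 0 := by push_cast; rw [hP, c1]; ring
      rcases hd with hd | hd <;> rw [hd] at this <;> simp at this

/-- Classes with Hessian divisible by `r1`, and discriminant divisible by `r2²` but Hessian
prime to `r2`. -/
def SP (r1 r2 : ℕ) (Y : ℝ) (f : BCF) : Prop :=
  disc f ≠ 0 ∧ |(disc f : ℝ)| < Y ∧ HD r1 f ∧ (r2 : ℤ) ^ 2 ∣ disc f ∧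
    ∀ q : ℕ, q.Prime → q ∣ r2 → ¬ HD q f

theorem SP_step (p r1 r2 : ℕ) (hp : p.Prime) (h5 : 5 ≤ p) (h1 : ¬ p ∣ r1) (h2 : ¬ p ∣ r2)
    (Y B : ℝ) (hB : NB (SP r1 r2 (Y / p ^ 2)) B) : NB (SP r1 (p * r2) Y) (3 * B) := by
  haveI : Fact p.Prime := ⟨hp⟩
  let φ : BCF → BCF := fun f => if h : (p : ℤ) ^ 2 ∣ disc f ∧ ¬ HD p f then
    (exists_over p hp h5 f h.1 h.2).choose else f
  have hφ : ∀ f, SP r1 (p * r2) Y f → ∃ a : ℤ, (φ f).1 = p * a ∧ ¬ (p : ℤ) ∣ (φ f).2.1 ∧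
      GLeq f (a, (φ f).2.1, p * (φ f).2.2.1, p ^ 2 * (φ f).2.2.2) := by
    intro f hf
    have h : (p : ℤ) ^ 2 ∣ disc f ∧ ¬ HD p f := by
      refine ⟨dvd_trans ?_ hf.2.2.2.1, hf.2.2.2.2 p hp (Dvd.intro _ rfl)⟩
      apply pow_dvd_pow_of_dvd
      push_cast
      exact Dvd.intro _ rfl
    simp only [φ, dif_pos h]
    exact (exists_over p hp h5 f h.1 h.2).choose_spec
  have hpp : Prime (p : ℤ) := Nat.prime_iff_prime_int.1 hp
  have hp0 : (p : ℤ) ≠ 0 := hpp.ne_zero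
  have hp0' : (0 : ℝ) < p := by exact_mod_cast hp.pos
  apply NB_map 3 φ (Q := SP r1 r2 (Y / p ^ 2)) _ _ _ hB
  · rintro f g hfg ⟨a1, a2, a3, a4, a5⟩
    have e := disc_GLeq hfg
    refine ⟨by rwa [e], by rwa [e], (HD_GLeq _ hfg).1 a3, by rwa [e], ?_⟩
    intro q hq hq2 hh
    exact a5 q hq hq2 ((HD_GLeq _ hfg).2 hh)
  · intro f hf
    obtain ⟨a, e1, e2, e3⟩ := hφ f hf
    obtain ⟨a1, a2, a3, a4, a5⟩ := hf
    rcases hk : φ f with ⟨A, b, c, d⟩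
    rw [hk] at e1 e2 e3
    simp only at e1 e2 e3
    subst e1
    have hdd : disc f = p ^ 2 * disc (p * a, b, c, d) := by
      rw [← disc_GLeq e3]; simp only [disc]; ring
    have q0 : H0 (a, b, p * c, p ^ 2 * d) = H0 (p * a, b, c, d) := by simp only [H0]; ring
    have q1 : H1 (a, b, p * c, p ^ 2 * d) = p * H1 (p * a, b, c, d) := by simp only [H1]; ring
    have q2 : H2 (a, b, p * c, p ^ 2 * d) = p ^ 2 * H2 (p * a, b, c, d) := by simp only [H2]; ring
    refine ⟨?_, ?_, ?_, ?_, ?_⟩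
    · intro h; apply a1; rw [hdd, h]; ring
    · rw [lt_div_iff₀ (by positivity)]
      have : (disc f : ℝ) = p ^ 2 * (disc (p * a, b, c, d) : ℝ) := by exact_mod_cast hdd
      rw [this, abs_mul, abs_of_pos (by positivity : (0 : ℝ) < (p : ℝ) ^ 2)] at a2
      linarith
    · rw [HD_GLeq _ e3] at a3
      obtain ⟨b0, b1, b2⟩ := a3
      rw [q0] at b0
      rw [q1] at b1
      rw [q2] at b2
      have hc : IsCoprime (r1 : ℤ) (p : ℤ) := by
        apply IsCoprime.symm
        rw [Prime.coprime_iff_not_dvd hpp]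
        exact_mod_cast h1
      exact ⟨b0, hc.dvd_of_dvd_mul_left b1, (hc.pow_right).dvd_of_dvd_mul_left b2⟩
    · rw [hdd] at a4
      push_cast at a4
      rw [mul_pow] at a4
      exact Int.dvd_of_mul_dvd_mul_left (by positivity) a4
    · intro q hq hq2 hh
      apply a5 q hq (Dvd.dvd.mul_left hq2 _)
      rw [HD_GLeq _ e3]
      obtain ⟨b0, b1, b2⟩ := hh
      refine ⟨by rw [q0]; exact b0, by rw [q1]; exact Dvd.dvd.mul_left b1 _,
        by rw [q2]; exact Dvd.dvd.mul_left b2 _⟩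
  · intro S g hS hsep
    exact fib_three p S g φ (fun f hf => ⟨hφ f (hS f hf).1, (hS f hf).2⟩) hsep

theorem SP_all (r1 r2 : ℕ) : Squarefree r2 → Nat.Coprime r2 6 → Nat.Coprime r1 r2 →
    ∀ (Y B : ℝ), NB (SP r1 1 (Y / r2 ^ 2)) B → NB (SP r1 r2 Y) (3 ^ r2.primeFactors.card * B) := by
  induction r2 using induction_on_primes with
  | zero => intro h; exact absurd h not_squarefree_zero
  | one => intro _ _ _ Y B hB; simpa using hB
  | prime_mul p n hp ih =>
    intro hsq h6 hc Y B hB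
    have hpn : ¬ p ∣ n := by
      intro h
      obtain ⟨m, rfl⟩ := h
      have := hsq p ⟨m, by ring⟩
      exact hp.one_lt.ne' (Nat.isUnit_iff.1 this)
    have hn0 : n ≠ 0 := by rintro rfl; simp at hpn
    have h5 : 5 ≤ p := by
      have h6' : Nat.Coprime p 6 := h6.coprime_dvd_left (Dvd.intro _ rfl)
      by_contra hlt
      push Not at hlt
      have := hp.two_le
      interval_cases p <;> revert h6' <;> decide
    have hcard : (p * n).primeFactors.card = n.primeFactors.card + 1 := by
      rw [Nat.primeFactors_mul hp.ne_zero hn0, hp.primeFactors]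
      rw [Finset.singleton_union, Finset.card_insert_of_notMem]
      intro h; exact hpn (Nat.dvd_of_mem_primeFactors h)
    rw [hcard, pow_succ, mul_comm _ (3 : ℝ), mul_assoc]
    apply SP_step p r1 n hp h5 _ hpn
    · apply ih (hsq.squarefree_of_dvd (Dvd.intro_left _ rfl))
        (h6.coprime_dvd_left (Dvd.intro_left _ rfl)) (hc.coprime_dvd_right (Dvd.intro_left _ rfl))
      rw [div_div]
      push_cast at hB
      rw [mul_pow] at hB
      exact hB
    · intro h
      have := Nat.dvd_gcd h (Dvd.intro n rfl : p ∣ p * n)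
      rw [hc] at this
      exact hp.one_lt.ne' (Nat.dvd_one.1 this)

end BCF

namespace BCF

/-- The quadratic algebra `ℚ[ε]`, `ε² = Δ`. -/
def KK (Δ : ℤ) : Type := QuadraticAlgebra ℚ (Δ : ℚ) 0

instance instCommRingKK (Δ : ℤ) : CommRing (KK Δ) :=
  inferInstanceAs (CommRing (QuadraticAlgebra ℚ (Δ : ℚ) 0))

namespace KK
variable {Δ : ℤ}

def re (z : KK Δ) : ℚ := QuadraticAlgebra.re z
def im (z : KK Δ) : ℚ := QuadraticAlgebra.im z
def mk (a b : ℚ) : KK Δ := (⟨a, b⟩ : QuadraticAlgebra ℚ (Δ : ℚ) 0)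

theorem ext {z w : KK Δ} (h1 : re z = re w) (h2 : im z = im w) : z = w :=
  QuadraticAlgebra.ext h1 h2

@[simp] theorem re_mk (a b : ℚ) : re (mk a b : KK Δ) = a := rfl
@[simp] theorem im_mk (a b : ℚ) : im (mk a b : KK Δ) = b := rfl
@[simp] theorem re_add (z w : KK Δ) : re (z + w) = re z + re w := rfl
@[simp] theorem im_add (z w : KK Δ) : im (z + w) = im z + im w := rfl
@[simp] theorem re_sub (z w : KK Δ) : re (z - w) = re z - re w := rfl
@[simp] theorem im_sub (z w : KK Δ) : im (z - w) = im z - im w := rfl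
@[simp] theorem re_neg (z : KK Δ) : re (-z) = -re z := rfl
@[simp] theorem im_neg (z : KK Δ) : im (-z) = -im z := rfl
@[simp] theorem re_zero : re (0 : KK Δ) = 0 := rfl
@[simp] theorem im_zero : im (0 : KK Δ) = 0 := rfl
@[simp] theorem re_one : re (1 : KK Δ) = 1 := rfl
@[simp] theorem im_one : im (1 : KK Δ) = 0 := rfl
@[simp] theorem re_intCast (n : ℤ) : re (n : KK Δ) = n := rfl
@[simp] theorem im_intCast (n : ℤ) : im (n : KK Δ) = 0 := rfl
@[simp] theorem re_mul (z w : KK Δ) : re (z * w) = re z * re w + Δ * im z * im w := by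
  exact QuadraticAlgebra.re_mul _ _
@[simp] theorem im_mul (z w : KK Δ) : im (z * w) = re z * im w + im z * re w := by
  refine (QuadraticAlgebra.im_mul _ _).trans ?_
  simp [re, im]
@[simp] theorem re_three : re (3 : KK Δ) = 3 := by
  have h : (3 : KK Δ) = ((3 : ℤ) : KK Δ) := by norm_num
  rw [h, re_intCast]; norm_num
@[simp] theorem im_three : im (3 : KK Δ) = 0 := by
  have h : (3 : KK Δ) = ((3 : ℤ) : KK Δ) := by norm_num
  rw [h, im_intCast]

/-- Conjugation. -/
def cj : KK Δ →+* KK Δ where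
  toFun z := mk (re z) (-im z)
  map_one' := ext (by simp) (by simp)
  map_zero' := ext (by simp) (by simp)
  map_mul' z w := ext (by simp) (by simp; ring)
  map_add' z w := ext (by simp) (by simp; ring)

@[simp] theorem re_cj (z : KK Δ) : re (cj z) = re z := rfl
@[simp] theorem im_cj (z : KK Δ) : im (cj z) = -im z := rfl
@[simp] theorem cj_cj (z : KK Δ) : cj (cj z) = z := ext (by simp) (by simp)

def nm (z : KK Δ) : ℚ := re z ^ 2 - Δ * im z ^ 2

theorem nm_mul (z w : KK Δ) : nm (z * w) = nm z * nm w := by simp [nm]; ring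
theorem nm_cj (z : KK Δ) : nm (cj z) = nm z := by simp [nm]
theorem nm_pow (z : KK Δ) (n : ℕ) : nm (z ^ n) = nm z ^ n := by
  induction n with
  | zero => simp [nm]
  | succ n ih => rw [pow_succ, nm_mul, ih, pow_succ]
theorem nm_int (n : ℤ) : nm (n : KK Δ) = (n : ℚ) ^ 2 := by simp [nm]

/-- Inverse. -/
def inv (z : KK Δ) : KK Δ := mk (re z / nm z) (-im z / nm z)

theorem mul_inv {z : KK Δ} (h : nm z ≠ 0) : z * inv z = 1 := by
  apply ext
  · simp only [re_mul, inv, re_mk, im_mk, re_one]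
    field_simp
    unfold nm; ring
  · simp only [im_mul, inv, re_mk, im_mk, im_one]
    field_simp
    ring

theorem cancel {z w w' : KK Δ} (h : nm z ≠ 0) (hw : z * w = z * w') : w = w' := by
  have := congrArg (fun t => inv z * t) hw
  simp only [← mul_assoc, mul_comm (inv z) z, mul_inv h, one_mul] at this
  exact this

theorem nm_inv {z : KK Δ} (h : nm z ≠ 0) : nm (inv z) = (nm z)⁻¹ := by
  have := congrArg nm (mul_inv h)
  rw [nm_mul] at this
  have h1 : nm (1 : KK Δ) = 1 := by simp [nm]
  rw [h1] at this
  field_simp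
  linarith

/-- `f` is the form `im2 (α (u x + v y)^3)`. -/
def FormOf (α x y : KK Δ) (f : BCF) : Prop :=
  2 * im (α * x ^ 3) = f.1 ∧ 2 * (3 * im (α * (x ^ 2 * y))) = f.2.1 ∧
  2 * (3 * im (α * (x * y ^ 2))) = f.2.2.1 ∧ 2 * im (α * y ^ 3) = f.2.2.2

theorem im_int_mul (n : ℤ) (z : KK Δ) : im ((n : KK Δ) * z) = n * im z := by simp

theorem formOf_sub {α x y : KK Δ} {f : BCF} (h : FormOf α x y f) (p q s t : ℤ) :
    FormOf α ((p : KK Δ) * x + (s : KK Δ) * y) ((q : KK Δ) * x + (t : KK Δ) * y) (sub p q s t f) := by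
  obtain ⟨h0, h1, h2, h3⟩ := h
  have key : ∀ c0 c1 c2 c3 : ℤ, 2 * im ((c0 : KK Δ) * (α * x ^ 3) + (c1 : KK Δ) * (3 * (α * (x ^ 2 * y)))
      + (c2 : KK Δ) * (3 * (α * (x * y ^ 2))) + (c3 : KK Δ) * (α * y ^ 3)) =
      (c0 * f.1 + c1 * f.2.1 + c2 * f.2.2.1 + c3 * f.2.2.2 : ℤ) := by
    intro c0 c1 c2 c3
    have h3' : ∀ z : KK Δ, im (3 * z) = 3 * im z := by intro z; simp
    simp only [im_add, im_int_mul, h3']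
    push_cast
    rw [← h0, ← h1, ← h2, ← h3]; ring
  have im3 : ∀ z : KK Δ, 2 * (3 * im z) = 2 * im (3 * z) := by intro z; simp
  refine ⟨?_, ?_, ?_, ?_⟩
  · rw [show (sub p q s t f).1 = p ^ 3 * f.1 + (p ^ 2 * s) * f.2.1 + (p * s ^ 2) * f.2.2.1
      + s ^ 3 * f.2.2.2 by simp only [sub]; ring, ← key]
    congr 2; push_cast; ring
  · rw [show (sub p q s t f).2.1 = (3 * p ^ 2 * q) * f.1 + (p ^ 2 * t + 2 * p * q * s) * f.2.1 +
      (2 * p * s * t + q * s ^ 2) * f.2.2.1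
      + (3 * s ^ 2 * t) * f.2.2.2 by simp only [sub]; ring, ← key, im3]
    congr 2; push_cast; ring
  · rw [show (sub p q s t f).2.2.1 = (3 * p * q ^ 2) * f.1 + (2 * p * q * t + q ^ 2 * s) * f.2.1 +
      (p * t ^ 2 + 2 * q * s * t) * f.2.2.1
      + (3 * s * t ^ 2) * f.2.2.2 by simp only [sub]; ring, ← key, im3]
    congr 2; push_cast; ring
  · rw [show (sub p q s t f).2.2.2 = q ^ 3 * f.1 + (q ^ 2 * t) * f.2.1 + (q * t ^ 2) * f.2.2.1
      + t ^ 3 * f.2.2.2 by simp only [sub]; ring, ← key]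
    congr 2; push_cast; ring

theorem formOf_unique {α x y : KK Δ} {f g : BCF} (h : FormOf α x y f) (h' : FormOf α x y g) :
    f = g := by
  obtain ⟨a, b, c, d⟩ := f
  obtain ⟨a', b', c', d'⟩ := g
  obtain ⟨h0, h1, h2, h3⟩ := h
  obtain ⟨h0', h1', h2', h3'⟩ := h'
  simp only at *
  rw [h0] at h0'; rw [h1] at h1'; rw [h2] at h2'; rw [h3] at h3'
  norm_cast at h0' h1' h2' h3'
  simp [*]

theorem mem_span_pair_int {x y z : KK Δ} :
    z ∈ Submodule.span ℤ {x, y} ↔ ∃ a b : ℤ, (a : KK Δ) * x + (b : KK Δ) * y = z := by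
  rw [Submodule.mem_span_pair]
  simp only [zsmul_eq_mul]

theorem basis_change {x y x' y' : KK Δ} (h : Submodule.span ℤ {x, y} = Submodule.span ℤ {x', y'})
    (hd : im (cj x * y) ≠ 0) :
    ∃ p q s t : ℤ, (p * t - q * s = 1 ∨ p * t - q * s = -1) ∧ x' = (p : KK Δ) * x + (s : KK Δ) * y ∧
      y' = (q : KK Δ) * x + (t : KK Δ) * y := by
  have hx' : x' ∈ Submodule.span ℤ {x, y} := by rw [h]; exact Submodule.subset_span (by simp)
  have hy' : y' ∈ Submodule.span ℤ {x, y} := by rw [h]; exact Submodule.subset_span (by simp)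
  have hx : x ∈ Submodule.span ℤ {x', y'} := by rw [← h]; exact Submodule.subset_span (by simp)
  have hy : y ∈ Submodule.span ℤ {x', y'} := by rw [← h]; exact Submodule.subset_span (by simp)
  rw [mem_span_pair_int] at hx hy hx' hy'
  obtain ⟨p, s, h1⟩ := hx'
  obtain ⟨q, t, h2⟩ := hy'
  obtain ⟨p', s', h3⟩ := hx
  obtain ⟨q', t', h4⟩ := hy
  have e1 : im (cj x' * y') = ((p * t - q * s : ℤ) : ℚ) * im (cj x * y) := by
    rw [← h1, ← h2]; simp; ring
  have e2 : im (cj x * y) = ((p' * t' - q' * s' : ℤ) : ℚ) * im (cj x' * y') := by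
    rw [← h3, ← h4]; simp; ring
  refine ⟨p, q, s, t, ?_, h1.symm, h2.symm⟩
  have : (((p * t - q * s) * (p' * t' - q' * s') : ℤ) : ℚ) = ((1 : ℤ) : ℚ) := by
    rw [e1] at e2
    have e3 : im (cj x * y) * (((p * t - q * s) * (p' * t' - q' * s') : ℤ) - 1 : ℚ) = 0 := by
      push_cast at *
      linarith
    rcases mul_eq_zero.1 e3 with h | h
    · exact absurd h hd
    · push_cast at *; linarith
  have := Int.isUnit_iff.1 (IsUnit.of_mul_eq_one _ (Int.cast_injective this))
  exact this

/-- Scaling a form. -/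
theorem formOf_scale {α x y κ : KK Δ} {f : BCF} :
    FormOf (κ ^ 3 * α) x y f ↔ FormOf α (κ * x) (κ * y) f := by
  unfold FormOf
  rw [show κ ^ 3 * α * x ^ 3 = α * (κ * x) ^ 3 by ring,
    show κ ^ 3 * α * (x ^ 2 * y) = α * ((κ * x) ^ 2 * (κ * y)) by ring,
    show κ ^ 3 * α * (x * y ^ 2) = α * ((κ * x) * (κ * y) ^ 2) by ring,
    show κ ^ 3 * α * y ^ 3 = α * (κ * y) ^ 3 by ring]

end KK
end BCF

namespace BCF
namespace KK
variable {Δ : ℤ}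

theorem form_h0 {α x y : KK Δ} {f : BCF} (h : FormOf α x y f) :
    (H0 f : ℚ) = 9 * (nm α * nm x * (2 * im (cj x * y)) ^ 2) := by
  obtain ⟨h0, h1, h2, h3⟩ := h
  have : (H0 f : ℚ) = (f.2.1 : ℚ) ^ 2 - 3 * f.1 * f.2.2.1 := by simp [H0]
  rw [this, ← h0, ← h1, ← h2]
  simp only [im_mul, re_mul, pow_succ, pow_zero, one_mul, re_cj, im_cj, nm]
  ring

theorem form_h1 {α x y : KK Δ} {f : BCF} (h : FormOf α x y f) :
    (H1 f : ℚ) = 9 * (nm α * (2 * re (cj x * y)) * (2 * im (cj x * y)) ^ 2) := by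
  obtain ⟨h0, h1, h2, h3⟩ := h
  have : (H1 f : ℚ) = (f.2.1 : ℚ) * f.2.2.1 - 9 * f.1 * f.2.2.2 := by simp [H1]
  rw [this, ← h0, ← h1, ← h2, ← h3]
  simp only [im_mul, re_mul, pow_succ, pow_zero, one_mul, re_cj, im_cj, nm]
  ring

theorem form_h2 {α x y : KK Δ} {f : BCF} (h : FormOf α x y f) :
    (H2 f : ℚ) = 9 * (nm α * nm y * (2 * im (cj x * y)) ^ 2) := by
  obtain ⟨h0, h1, h2, h3⟩ := h
  have : (H2 f : ℚ) = (f.2.2.1 : ℚ) ^ 2 - 3 * f.2.1 * f.2.2.2 := by simp [H2]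
  rw [this, ← h1, ← h2, ← h3]
  simp only [im_mul, re_mul, pow_succ, pow_zero, one_mul, re_cj, im_cj, nm]
  ring

theorem form_disc {α x y : KK Δ} {f : BCF} (h : FormOf α x y f) :
    (disc f : ℚ) = -27 * (nm α * (2 * im (cj x * y)) ^ 3) ^ 2 * Δ := by
  have h1 : ((H1 f ^ 2 - 4 * H0 f * H2 f : ℤ) : ℚ) = ((-3 * disc f : ℤ) : ℚ) := by rw [H_disc]
  push_cast at h1
  rw [form_h0 h, form_h1 h, form_h2 h] at h1
  have h2 : nm (cj x * y) = nm x * nm y := by rw [nm_mul, nm_cj]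
  have h3 : nm (cj x * y) = re (cj x * y) ^ 2 - Δ * im (cj x * y) ^ 2 := rfl
  rw [h2] at h3
  have : nm x * nm y * (nm α ^ 2 * (2 * im (cj x * y)) ^ 4) =
    (re (cj x * y) ^ 2 - Δ * im (cj x * y) ^ 2) * (nm α ^ 2 * (2 * im (cj x * y)) ^ 4) := by rw [h3]
  linear_combination 1/3 * h1 + 108 * this

theorem recover {α x y : KK Δ} {f : BCF} (h : FormOf α x y f) {σ : ℚ} (hσ : σ ≠ 0)
    (hs : nm α * (2 * im (cj x * y)) ^ 3 = σ) (hH : H0 f ≠ 0) :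
    nm x ≠ 0 ∧ y = x * mk (H1 f / (2 * H0 f)) (9 * σ / (2 * H0 f)) ∧
    α * x ^ 3 = mk ((f.2.1 / 6 - f.1 / 2 * (H1 f / (2 * H0 f))) / (9 * σ / (2 * H0 f))) (f.1 / 2) := by
  have hHq : (H0 f : ℚ) ≠ 0 := by exact_mod_cast hH
  have e0 := form_h0 h
  have e1 := form_h1 h
  have hx : nm x ≠ 0 := by
    rintro h0; rw [h0] at e0; apply hHq; rw [e0]; ring
  have ha : nm α ≠ 0 := by
    rintro h0; rw [h0] at hs; apply hσ; rw [← hs]; ring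
  have hd : im (cj x * y) ≠ 0 := by
    rintro h0; rw [h0] at hs; apply hσ; rw [← hs]; ring
  have hy : y = x * mk (H1 f / (2 * H0 f)) (9 * σ / (2 * H0 f)) := by
    apply cancel (z := cj x) (by rwa [nm_cj])
    have t1 : re (cj x * y) = nm x * (H1 f / (2 * H0 f)) := by
      rw [e0, e1]; field_simp
    have t2 : im (cj x * y) = nm x * (9 * σ / (2 * H0 f)) := by
      rw [e0, ← hs]; field_simp
    apply ext
    · rw [t1]; simp only [re_mul, im_mul, re_mk, im_mk, re_cj, im_cj, nm]; ring
    · rw [t2]; simp only [re_mul, im_mul, re_mk, im_mk, re_cj, im_cj, nm]; ring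
  refine ⟨hx, hy, ?_⟩
  obtain ⟨h0, h1, h2, h3⟩ := h
  apply ext
  · rw [re_mk, eq_div_iff (by positivity)]
    have : α * (x ^ 2 * y) = (α * x ^ 3) * mk (H1 f / (2 * H0 f)) (9 * σ / (2 * H0 f)) := by
      conv_lhs => rw [hy]
      ring
    rw [this, im_mul (α * x ^ 3)] at h1
    rw [re_mk, im_mk] at h1
    linear_combination h1 / 6 - (H1 f / (2 * H0 f) : ℚ) / 2 * h0
  · rw [im_mk]; linarith

theorem recover2 {α x y α' x' y' : KK Δ} {f : BCF} (h : FormOf α x y f) (h' : FormOf α' x' y' f)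
    {σ : ℚ} (hσ : σ ≠ 0) (hs : nm α * (2 * im (cj x * y)) ^ 3 = σ)
    (hs' : nm α' * (2 * im (cj x' * y')) ^ 3 = σ) (hH : H0 f ≠ 0) :
    ∃ κ : KK Δ, nm κ ≠ 0 ∧ x' = κ * x ∧ y' = κ * y ∧ α = κ ^ 3 * α' := by
  obtain ⟨hx, hy, hα⟩ := recover h hσ hs hH
  obtain ⟨hx', hy', hα'⟩ := recover h' hσ hs' hH
  have hk : x' = x' * inv x * x := by
    rw [mul_assoc, mul_comm (inv x), mul_inv hx, mul_one]
  refine ⟨x' * inv x, ?_, hk, ?_, ?_⟩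
  · rw [nm_mul, nm_inv hx]; exact mul_ne_zero hx' (inv_ne_zero hx)
  · rw [hy, hy', ← mul_assoc, ← hk]
  · apply cancel (z := x ^ 3) (by rw [nm_pow]; exact pow_ne_zero _ hx)
    rw [mul_comm, hα, ← hα']
    conv_lhs => rw [hk]
    ring

/-- The ring of integers `ℤ[(Δ+ε)/2]`. -/
def om : KK Δ := mk (Δ / 2) (1 / 2)
def OO (Δ : ℤ) : Submodule ℤ (KK Δ) := Submodule.span ℤ {1, om}

def cjA : KK Δ →ₐ[ℤ] KK Δ := cj.toIntAlgHom
@[simp] theorem cjA_apply (z : KK Δ) : cjA z = cj z := rfl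

/-- conjugate lattice -/
def bar (L : Submodule ℤ (KK Δ)) : Submodule ℤ (KK Δ) := L.map (cjA : KK Δ →ₐ[ℤ] KK Δ).toLinearMap

theorem bar_mul (L M : Submodule ℤ (KK Δ)) : bar (L * M) = bar L * bar M := Submodule.map_mul _ _ _

theorem bar_pair (x y : KK Δ) : bar (Submodule.span ℤ {x, y}) = Submodule.span ℤ {cj x, cj y} := by
  unfold bar
  rw [Submodule.map_span, Set.image_pair]; rfl

theorem bar_single (x : KK Δ) : bar (Submodule.span ℤ {x}) = Submodule.span ℤ {cj x} := by
  unfold bar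
  rw [Submodule.map_span, Set.image_singleton]; rfl

theorem bar_bar (L : Submodule ℤ (KK Δ)) : bar (bar L) = L := by
  unfold bar
  rw [← Submodule.map_comp]
  conv_rhs => rw [← Submodule.map_id L]
  congr 1
  ext z
  simp

theorem mem_bar {L : Submodule ℤ (KK Δ)} {z : KK Δ} (h : z ∈ L) : cj z ∈ bar L :=
  Submodule.mem_map_of_mem h

theorem bar_mono {L M : Submodule ℤ (KK Δ)} (h : L ≤ M) : bar L ≤ bar M := Submodule.map_mono h

theorem mem_OO {z : KK Δ} : z ∈ OO Δ ↔ ∃ a b : ℤ, (a : KK Δ) + (b : KK Δ) * om = z := by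
  unfold OO; rw [mem_span_pair_int]; simp only [mul_one]

/-- parity: `Δ(Δ-1)/4`-type integrality of `om` -/
theorem om_sq (hΔ : ∃ k : ℤ, Δ ^ 2 - Δ = 4 * k) :
    (om : KK Δ) * om ∈ OO Δ := by
  obtain ⟨k, hk⟩ := hΔ
  rw [mem_OO]
  refine ⟨-k, Δ, ?_⟩
  have hk' : (Δ : ℚ) ^ 2 - Δ = 4 * k := by exact_mod_cast hk
  apply ext
  · simp only [om, re_add, re_mul, im_mul, re_mk, im_mk, re_intCast, im_intCast]
    push_cast; linarith
  · simp only [om, im_add, re_mul, im_mul, re_mk, im_mk, re_intCast, im_intCast]; ring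

theorem OO_mul (hΔ : ∃ k : ℤ, Δ ^ 2 - Δ = 4 * k) : OO Δ * OO Δ = OO Δ := by
  apply le_antisymm
  · conv_lhs => unfold OO
    rw [Submodule.span_mul_span, Submodule.span_le]
    rintro z ⟨a, ha, b, hb, rfl⟩
    have h1 : (1 : KK Δ) ∈ OO Δ := Submodule.subset_span (by simp)
    have h2 : (om : KK Δ) ∈ OO Δ := Submodule.subset_span (by simp)
    rcases ha with rfl | rfl <;> rcases hb with rfl | rfl
    · simpa using h1
    · simpa using h2
    · simpa using h2
    · exact om_sq hΔ
  · intro z hz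
    have := Submodule.mul_mem_mul (show (1 : KK Δ) ∈ OO Δ from Submodule.subset_span (by simp)) hz
    rwa [one_mul] at this

theorem bar_OO : bar (OO Δ) = OO Δ := by
  have h : bar (OO Δ) ≤ OO Δ := by
    conv_lhs => unfold OO
    rw [bar_pair, Submodule.span_le]
    rintro z (rfl | rfl)
    · simp only [map_one]; exact Submodule.subset_span (by simp)
    · rw [SetLike.mem_coe, mem_OO]
      refine ⟨Δ, -1, ?_⟩
      apply ext
      · simp only [om, re_add, re_mul, re_mk, im_mk, re_intCast, im_intCast, re_cj]; push_cast; ring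
      · simp only [om, im_add, im_mul, re_mk, im_mk, re_intCast, im_intCast, im_cj]; push_cast; ring
  apply le_antisymm h
  have := bar_mono h
  rwa [bar_bar] at this

theorem OO_coeff {a b a' b' : ℤ} (h : (a : KK Δ) + (b : KK Δ) * om = (a' : KK Δ) + (b' : KK Δ) * om) :
    a = a' ∧ b = b' := by
  have h1 := congrArg im h
  have h2 := congrArg re h
  simp only [om, im_add, re_add, re_mul, im_mul, re_mk, im_mk, re_intCast, im_intCast] at h1 h2
  have hb : (b : ℚ) = b' := by linarith
  have ha : (a : ℚ) = a' := by rw [hb] at h2; linarith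
  exact ⟨by exact_mod_cast ha, by exact_mod_cast hb⟩

/-- Hermite normal form basis. -/
theorem hnf (L : Submodule ℤ (KK Δ)) (hL : L ≤ OO Δ) :
    ∃ k x g : ℤ, L = Submodule.span ℤ {(k : KK Δ), (x : KK Δ) + (g : KK Δ) * om} := by
  let I1 : Submodule ℤ ℤ :=
    { carrier := {a | (a : KK Δ) ∈ L}
      add_mem' := by intro a b ha hb; simp only [Set.mem_ofPred_eq] at *; push_cast; exact L.add_mem ha hb
      zero_mem' := by simp
      smul_mem' := by
        intro c a ha; simp only [Set.mem_ofPred_eq, smul_eq_mul] at *; push_cast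
        rw [← zsmul_eq_mul]; exact L.smul_mem c ha }
  let I2 : Submodule ℤ ℤ :=
    { carrier := {b | ∃ a : ℤ, (a : KK Δ) + (b : KK Δ) * om ∈ L}
      add_mem' := by
        rintro b b' ⟨a, ha⟩ ⟨a', ha'⟩
        refine ⟨a + a', ?_⟩
        have := L.add_mem ha ha'
        push_cast
        convert this using 1; ring
      zero_mem' := ⟨0, by simp⟩
      smul_mem' := by
        rintro c b ⟨a, ha⟩
        refine ⟨c * a, ?_⟩
        have := L.smul_mem c ha
        rw [zsmul_eq_mul] at this
        push_cast
        convert this using 1; simp only [smul_eq_mul]; push_cast; ring }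
  obtain ⟨k, hk⟩ := (IsPrincipalIdealRing.principal (I1 : Ideal ℤ)).principal
  obtain ⟨g, hg⟩ := (IsPrincipalIdealRing.principal (I2 : Ideal ℤ)).principal
  have hkm : k ∈ I1 := by rw [hk]; exact Submodule.mem_span_singleton_self k
  have hgm : g ∈ I2 := by rw [hg]; exact Submodule.mem_span_singleton_self g
  obtain ⟨x, hx⟩ := hgm
  refine ⟨k, x, g, le_antisymm ?_ ?_⟩
  · intro z hz
    obtain ⟨a, b, rfl⟩ := mem_OO.1 (hL hz)
    have hb : b ∈ I2 := ⟨a, hz⟩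
    rw [hg, Submodule.mem_span_singleton] at hb
    obtain ⟨c, hc⟩ := hb
    have hc' : b = c * g := hc.symm
    subst hc'
    have ha : a - c * x ∈ I1 := by
      show ((a - c * x : ℤ) : KK Δ) ∈ L
      have := L.sub_mem hz (L.smul_mem c hx)
      rw [zsmul_eq_mul] at this
      convert this using 1
      push_cast; ring
    rw [hk, Submodule.mem_span_singleton] at ha
    obtain ⟨e, he⟩ := ha
    rw [mem_span_pair_int]
    refine ⟨e, c, ?_⟩
    have he' : a = e * k + c * x := by simp only [smul_eq_mul] at he; linarith
    rw [he']; push_cast; ring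
  · rw [Submodule.span_le]
    rintro z (rfl | rfl)
    · exact hkm
    · exact hx

end KK
end BCF

namespace BCF
namespace KK
variable {Δ : ℤ}

theorem bar_sub_self (w : KK Δ) : cj w * w = mk (nm w) 0 := by
  apply ext
  · simp [nm]; ring
  · simp; ring

theorem cj_om : cj (om : KK Δ) = (Δ : KK Δ) - om := by
  apply ext
  · simp only [om, re_sub, re_mk, re_intCast, re_cj]; ring
  · simp only [om, im_sub, im_mk, im_intCast, im_cj]; ring

theorem hnf_norm (hΔ : ∃ k : ℤ, Δ ^ 2 - Δ = 4 * k) (L : Submodule ℤ (KK Δ)) (k x g n : ℤ)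
    (hL : L = Submodule.span ℤ {(k : KK Δ), (x : KK Δ) + (g : KK Δ) * om})
    (hn : L * bar L = Submodule.span ℤ {(n : KK Δ)} * OO Δ) :
    k * g = n ∨ k * g = -n := by
  obtain ⟨k0, hk0⟩ := hΔ
  have hk0' : (Δ : ℚ) ^ 2 - Δ = 4 * k0 := by exact_mod_cast hk0
  have hoo : (om : KK Δ) * cj om = (k0 : KK Δ) := by
    apply ext
    · simp only [om, re_mul, re_mk, im_mk, re_intCast, re_cj, im_cj]; linarith
    · simp only [om, im_mul, re_mk, im_mk, im_intCast, re_cj, im_cj]; ring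
  have hkL : (k : KK Δ) ∈ L := by rw [hL]; exact Submodule.subset_span (by simp)
  have hwL : (x : KK Δ) + (g : KK Δ) * om ∈ L := by rw [hL]; exact Submodule.subset_span (by simp)
  have h1 : n ∣ k * g := by
    have := Submodule.mul_mem_mul hkL (mem_bar hwL)
    rw [hn, Submodule.mem_span_singleton_mul] at this
    obtain ⟨z, hz, hz'⟩ := this
    obtain ⟨a, b, rfl⟩ := mem_OO.1 hz
    simp only [map_add, map_mul, map_intCast, cj_om] at hz'
    have := OO_coeff (Δ := Δ) (a := n * a) (b := n * b) (a' := k * x + k * g * Δ) (b' := - (k * g)) (by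
      push_cast
      linear_combination hz')
    exact ⟨-b, by linarith [this.2]⟩
  have h2 : k * g ∣ n := by
    have hle : L * bar L ≤ Submodule.span ℤ {(1 : KK Δ), ((k * g : ℤ) : KK Δ) * om} := by
      rw [hL, bar_pair, Submodule.span_mul_span, Submodule.span_le]
      rintro z ⟨a, ha, b, hb, rfl⟩
      rw [SetLike.mem_coe, mem_span_pair_int]
      simp only [map_add, map_mul, map_intCast] at hb
      rcases ha with rfl | rfl <;> rcases hb with rfl | rfl
      · exact ⟨k * k, 0, by push_cast; ring⟩
      · refine ⟨k * x + k * g * Δ, -1, ?_⟩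
        simp only [cj_om]; push_cast; ring
      · exact ⟨k * x, 1, by push_cast; ring⟩
      · refine ⟨x ^ 2 + x * g * Δ + g ^ 2 * k0, 0, ?_⟩
        push_cast
        rw [← hoo]
        simp only [cj_om]; ring
    have hm : (n : KK Δ) * om ∈ L * bar L := by
      rw [hn, Submodule.mem_span_singleton_mul]
      exact ⟨om, Submodule.subset_span (by simp), rfl⟩
    obtain ⟨a, b, hab⟩ := mem_span_pair_int.1 (hle hm)
    have := OO_coeff (Δ := Δ) (a := a) (b := b * (k * g)) (a' := 0) (b' := n) (by
      push_cast at hab ⊢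
      linear_combination hab)
    exact ⟨b, by linarith [this.2]⟩
  have := Int.associated_iff.1 (associated_of_dvd_dvd h2 h1)
  exact this

/-- Data attached to a cubic form. -/
structure KD (m s : ℤ) (Φ : BCF) (α : KK Δ) (L : Submodule ℤ (KK Δ)) (A : ℤ) : Prop where
  hA : A ≠ 0
  hN : nm α * (A : ℚ) ^ 3 = m
  hB : ∃ x y, L = Submodule.span ℤ {x, y} ∧ FormOf α x y Φ ∧ im (cj x * y) ≠ 0
  hO : OO Δ * L = L
  hLO : L ≤ OO Δ
  hLL : L * bar L = Submodule.span ℤ {(A : KK Δ)} * OO Δ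
  hJ : Submodule.span ℤ {α} * (L * L * L) ≤ Submodule.span ℤ {mk (s / 2) (1 / 2), (m : KK Δ)}

/-- elements whose imaginary part is a multiple of `m/2` -/
def WW (Δ m : ℤ) : Submodule ℤ (KK Δ) where
  carrier := {z | ∃ c : ℤ, 2 * im z = m * c}
  add_mem' := by
    rintro z w ⟨c, hc⟩ ⟨c', hc'⟩
    exact ⟨c + c', by rw [im_add]; push_cast; linarith⟩
  zero_mem' := ⟨0, by simp⟩
  smul_mem' := by
    rintro a z ⟨c, hc⟩
    refine ⟨a * c, ?_⟩
    rw [zsmul_eq_mul, im_int_mul]; push_cast; linear_combination (a : ℚ) * hc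

theorem JJ (m s : ℤ) : Submodule.span ℤ {(mk (s / 2) (1 / 2) : KK Δ), (m : KK Δ)} *
    bar (Submodule.span ℤ {(mk (s / 2) (1 / 2) : KK Δ), (m : KK Δ)}) ≤ WW Δ m := by
  rw [bar_pair, Submodule.span_mul_span, Submodule.span_le]
  rintro z ⟨a, ha, b, hb, rfl⟩
  simp only [map_intCast] at hb
  rcases ha with rfl | rfl <;> rcases hb with rfl | rfl
  · exact ⟨0, by simp; ring⟩
  · exact ⟨1, by simp⟩
  · exact ⟨-1, by simp; ring⟩
  · exact ⟨0, by simp⟩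

/-- the composite multiplier -/
def comp (m : ℤ) (α2 α1 : KK Δ) : KK Δ := mk (1 / m) 0 * (α2 * cj α1)

theorem KD.exists_comp (hΔ : ∃ k : ℤ, Δ ^ 2 - Δ = 4 * k) {m s : ℤ} (hm : m ≠ 0) {Φ1 Φ2 : BCF}
    {α1 α2 : KK Δ} {L1 L2 : Submodule ℤ (KK Δ)}
    {A1 A2 : ℤ} (h1 : KD m s Φ1 α1 L1 A1) (h2 : KD m s Φ2 α2 L2 A2) :
    ∃ x y Ψ, L2 * bar L1 = Submodule.span ℤ {x, y} ∧ FormOf (comp m α2 α1) x y Ψ ∧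
      (nm (comp m α2 α1) * (2 * im (cj x * y)) ^ 3 = 1 ∨
        nm (comp m α2 α1) * (2 * im (cj x * y)) ^ 3 = -1) := by
  have hle : L2 * bar L1 ≤ OO Δ := by
    calc L2 * bar L1 ≤ OO Δ * bar (OO Δ) := mul_le_mul' h2.hLO (bar_mono h1.hLO)
      _ = OO Δ := by rw [bar_OO, OO_mul hΔ]
  obtain ⟨k, x, g, hL⟩ := hnf _ hle
  have hLL : (L2 * bar L1) * bar (L2 * bar L1) =
      Submodule.span ℤ {((A2 * A1 : ℤ) : KK Δ)} * OO Δ := by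
    rw [bar_mul, bar_bar]
    calc L2 * bar L1 * (bar L2 * L1) = (L2 * bar L2) * (L1 * bar L1) := by ring
      _ = (Submodule.span ℤ {(A2 : KK Δ)} * Submodule.span ℤ {(A1 : KK Δ)}) * (OO Δ * OO Δ) := by
        rw [h1.hLL, h2.hLL]; ring
      _ = _ := by
        rw [OO_mul hΔ, Submodule.span_mul_span]; simp
  have hn := hnf_norm hΔ _ k x g (A2 * A1) hL hLL
  have key : ∀ u ∈ L2 * bar L1, ∀ v ∈ L2 * bar L1, ∀ w ∈ L2 * bar L1,
      ∃ c : ℤ, 2 * im (comp m α2 α1 * (u * v * w)) = c := by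
    intro u hu v hv w hw
    have hmem : (α2 * cj α1) * (u * v * w) ∈ WW Δ m := by
      apply JJ m s
      refine mul_le_mul' h2.hJ (bar_mono h1.hJ) ?_
      rw [bar_mul, bar_mul, bar_mul, bar_single]
      have e : Submodule.span ℤ {α2} * (L2 * L2 * L2) *
          (Submodule.span ℤ {cj α1} * (bar L1 * bar L1 * bar L1)) =
          (Submodule.span ℤ {α2} * Submodule.span ℤ {cj α1}) *
          ((L2 * bar L1) * (L2 * bar L1) * (L2 * bar L1)) := by ring
      rw [e]
      refine Submodule.mul_mem_mul (Submodule.mul_mem_mul ?_ ?_)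
        (Submodule.mul_mem_mul (Submodule.mul_mem_mul hu hv) hw)
      · exact Submodule.mem_span_singleton_self _
      · exact Submodule.mem_span_singleton_self _
    obtain ⟨c, hc⟩ := hmem
    refine ⟨c, ?_⟩
    have hmq : (m : ℚ) ≠ 0 := by exact_mod_cast hm
    unfold comp
    rw [mul_assoc, im_mul, re_mk, im_mk]
    field_simp
    linarith
  set X : KK Δ := (k : KK Δ) with hX
  set Z : KK Δ := (x : KK Δ) + (g : KK Δ) * om with hZ
  have hXm : X ∈ L2 * bar L1 := by rw [hL]; exact Submodule.subset_span (by simp)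
  have hZm : Z ∈ L2 * bar L1 := by rw [hL]; exact Submodule.subset_span (by simp)
  obtain ⟨c0, hc0⟩ := key X hXm X hXm X hXm
  obtain ⟨c1, hc1⟩ := key X hXm X hXm Z hZm
  obtain ⟨c2, hc2⟩ := key X hXm Z hZm Z hZm
  obtain ⟨c3, hc3⟩ := key Z hZm Z hZm Z hZm
  refine ⟨X, Z, (c0, 3 * c1, 3 * c2, c3), hL, ⟨?_, ?_, ?_, ?_⟩, ?_⟩
  · rw [← hc0]; congr 3; ring
  · show 2 * (3 * im (comp m α2 α1 * (X ^ 2 * Z))) = ((3 * c1 : ℤ) : ℚ)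
    push_cast; rw [← hc1, pow_two]; ring
  · show 2 * (3 * im (comp m α2 α1 * (X * Z ^ 2))) = ((3 * c2 : ℤ) : ℚ)
    push_cast; rw [← hc2, pow_two, mul_assoc X Z Z]; ring
  · rw [← hc3]; congr 3; ring
  · have hmq : (m : ℚ) ≠ 0 := by exact_mod_cast hm
    have hA1 : (A1 : ℚ) ≠ 0 := by exact_mod_cast h1.hA
    have hA2 : (A2 : ℚ) ≠ 0 := by exact_mod_cast h2.hA
    have hd : 2 * im (cj X * Z) = ((k * g : ℤ) : ℚ) := by
      rw [hX, hZ]; simp [om]; ring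
    have hN : nm (comp m α2 α1) * ((A2 : ℚ) * A1) ^ 3 = 1 := by
      unfold comp
      rw [nm_mul, nm_mul, nm_cj]
      have : nm (KK.mk (1 / m) 0 : KK Δ) = 1 / (m : ℚ) ^ 2 := by simp [nm]
      rw [this]
      have e1 := h1.hN
      have e2 := h2.hN
      calc 1 / (m : ℚ) ^ 2 * (nm α2 * nm α1) * ((A2 : ℚ) * A1) ^ 3
          = 1 / (m : ℚ) ^ 2 * ((nm α2 * (A2 : ℚ) ^ 3) * (nm α1 * (A1 : ℚ) ^ 3)) := by ring
        _ = 1 := by rw [e1, e2]; field_simp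
    rw [hd]
    rcases hn with h | h
    · left; rw [h]; push_cast; exact hN
    · right; rw [h]; push_cast; linear_combination -hN

theorem span_single_pair (κ x y : KK Δ) :
    Submodule.span ℤ {κ} * Submodule.span ℤ {x, y} = Submodule.span ℤ {κ * x, κ * y} := by
  rw [Submodule.span_mul_span]
  congr 1
  rw [Set.singleton_mul, Set.image_pair]

theorem KD.nm_ne {m s : ℤ} (hm : m ≠ 0) {Φ1 : BCF}
    {α1 : KK Δ} {L1 : Submodule ℤ (KK Δ)}
    {A1 : ℤ} (h1 : KD m s Φ1 α1 L1 A1) : nm α1 ≠ 0 := by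
  intro h
  have := h1.hN
  rw [h, zero_mul] at this
  exact hm (by exact_mod_cast this.symm)

theorem KD.inj {m s : ℤ} (hm : m ≠ 0) {Φ1 Φ Φ' f : BCF}
    {α1 α α' : KK Δ} {L1 L L' : Submodule ℤ (KK Δ)}
    {A1 A A' : ℤ} (h1 : KD m s Φ1 α1 L1 A1) (h : KD m s Φ α L A) (h' : KD m s Φ' α' L' A')
    {x y x' y' : KK Δ} {σ : ℚ} (hσ : σ ≠ 0)
    (hL : L * bar L1 = Submodule.span ℤ {x, y}) (hL' : L' * bar L1 = Submodule.span ℤ {x', y'})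
    (hf : FormOf (comp m α α1) x y f) (hf' : FormOf (comp m α' α1) x' y' f)
    (hs : nm (comp m α α1) * (2 * im (cj x * y)) ^ 3 = σ)
    (hs' : nm (comp m α' α1) * (2 * im (cj x' * y')) ^ 3 = σ)
    (hH : H0 f ≠ 0) : GLeq Φ Φ' := by
  obtain ⟨κ, hκ, rfl, rfl, hα⟩ := recover2 hf hf' hσ hs hs' hH
  have hmq : (m : ℚ) ≠ 0 := by exact_mod_cast hm
  have hα2 : α = κ ^ 3 * α' := by
    apply cancel (z := KK.mk (1 / m) 0 * cj α1)
    · rw [nm_mul, nm_cj]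
      refine mul_ne_zero ?_ (h1.nm_ne hm)
      simp [nm, hmq]
    · unfold comp at hα
      linear_combination hα
  have hLL : L' = Submodule.span ℤ {κ} * L := by
    rw [← span_single_pair, ← hL] at hL'
    have e1 : L' * bar L1 * L1 = Submodule.span ℤ {(A1 : KK Δ)} * L' := by
      rw [mul_assoc, mul_comm (bar L1), h1.hLL, mul_comm L', mul_assoc, h'.hO]
    have e2 : L * bar L1 * L1 = Submodule.span ℤ {(A1 : KK Δ)} * L := by
      rw [mul_assoc, mul_comm (bar L1), h1.hLL, mul_comm L, mul_assoc, h.hO]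
    have e3 : Submodule.span ℤ {(A1 : KK Δ)} * L' =
        Submodule.span ℤ {(A1 : KK Δ)} * (Submodule.span ℤ {κ} * L) := by
      rw [← e1, hL', mul_assoc, e2]; ring
    have hA : nm (A1 : KK Δ) ≠ 0 := by
      rw [nm_int]; have := h1.hA; positivity
    have e4 : Submodule.span ℤ {inv (A1 : KK Δ)} * Submodule.span ℤ {(A1 : KK Δ)} = 1 := by
      rw [Submodule.span_mul_span, Set.singleton_mul_singleton, mul_comm, mul_inv hA,
        Submodule.one_eq_span]
    calc L' = Submodule.span ℤ {inv (A1 : KK Δ)} * (Submodule.span ℤ {(A1 : KK Δ)} * L') := by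
          rw [← mul_assoc, e4, one_mul]
      _ = _ := by rw [e3, ← mul_assoc, e4, one_mul]
  obtain ⟨u, v, hu, hFu, hd⟩ := h.hB
  obtain ⟨u', v', hu', hFu', hd'⟩ := h'.hB
  rw [hu, hu', span_single_pair] at hLL
  obtain ⟨p, q, r, t, hdet, e1, e2⟩ := basis_change hLL hd'
  rw [hα2, formOf_scale, e1, e2] at hFu
  have := formOf_unique hFu (formOf_sub hFu' p q r t)
  apply GLeq_symm
  rw [GLeq_iff]
  exact ⟨p, q, r, t, hdet, this⟩

theorem span_sub {x y : KK Δ} (p q s t : ℤ) (h : p * t - q * s = 1 ∨ p * t - q * s = -1) :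
    Submodule.span ℤ {x, y} = Submodule.span ℤ
      {(p : KK Δ) * x + (s : KK Δ) * y, (q : KK Δ) * x + (t : KK Δ) * y} := by
  apply le_antisymm
  · rw [Submodule.span_le]
    obtain ⟨u, hu, hu'⟩ : ∃ u : ℤ, u * (p * t - q * s) = 1 ∧ u * u = 1 := by
      rcases h with h | h
      · exact ⟨1, by rw [h]; ring, by ring⟩
      · exact ⟨-1, by rw [h]; ring, by ring⟩
    have hu2 : (u : KK Δ) * (p * t - q * s) = 1 := by exact_mod_cast congrArg (Int.cast : ℤ → KK Δ) hu
    rintro z (rfl | rfl)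
    · rw [SetLike.mem_coe, mem_span_pair_int]
      refine ⟨u * t, -u * s, ?_⟩
      push_cast; linear_combination z * hu2
    · rw [SetLike.mem_coe, mem_span_pair_int]
      refine ⟨-u * q, u * p, ?_⟩
      push_cast; linear_combination z * hu2
  · rw [Submodule.span_le]
    rintro z (rfl | rfl)
    · rw [SetLike.mem_coe, mem_span_pair_int]; exact ⟨p, s, rfl⟩
    · rw [SetLike.mem_coe, mem_span_pair_int]; exact ⟨q, t, rfl⟩

/-- moving the composite inside its class -/
theorem comp_move {β x y : KK Δ} {L : Submodule ℤ (KK Δ)} {Ψ g : BCF} (hg : GLeq Ψ g)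
    (hL : L = Submodule.span ℤ {x, y}) (hf : FormOf β x y Ψ)
    (hs : nm β * (2 * im (cj x * y)) ^ 3 = 1 ∨ nm β * (2 * im (cj x * y)) ^ 3 = -1) :
    ∃ x y, L = Submodule.span ℤ {x, y} ∧ FormOf β x y g ∧
    (nm β * (2 * im (cj x * y)) ^ 3 = 1 ∨ nm β * (2 * im (cj x * y)) ^ 3 = -1) := by
  obtain ⟨p, q, s, t, hd, rfl⟩ := (GLeq_iff _ _).1 hg
  refine ⟨_, _, hL.trans (span_sub p q s t hd), formOf_sub hf p q s t, ?_⟩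
  have e : im (cj ((p : KK Δ) * x + (s : KK Δ) * y) * ((q : KK Δ) * x + (t : KK Δ) * y)) =
      ((p * t - q * s : ℤ) : ℚ) * im (cj x * y) := by
    simp; ring
  rw [e]
  rcases hd with h | h
  · rw [h]; simpa using hs
  · rw [h]
    rcases hs with h | h
    · right; push_cast; linear_combination -h
    · left; push_cast; linear_combination -h

end KK
end BCF

namespace BCF

/-- Integral data of a primitive form. -/
structure Dat (m Δ s F0 F1 F2 F3 A B C : ℤ) : Prop where
  hm : 0 < m
  h0 : F1 ^ 2 - F0 * F2 = m * A
  h1 : F1 * F2 - F0 * F3 = m * B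
  h2 : F2 ^ 2 - F1 * F3 = m * C
  hA : A ≠ 0
  hD : B ^ 2 - 4 * A * C = Δ
  hp : ∃ y1 y2 y3 : ℤ, y1 * A + y2 * B + y3 * C = 1
  g0 : 2 * m ∣ 2 * F1 * A - F0 * B - s * F0
  g1 : 2 * m ∣ 2 * A * F2 - B * F1 - s * F1
  g2 : 2 * m ∣ 2 * A * F3 - B * F2 - s * F2
  g3 : 2 * m ∣ B * F3 - 2 * C * F2 - s * F3

theorem Dat.syz1 {m Δ s F0 F1 F2 F3 A B C : ℤ} (h : Dat m Δ s F0 F1 F2 F3 A B C) :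
    A * F2 - B * F1 + C * F0 = 0 := by
  have : m * (A * F2 - B * F1 + C * F0) = 0 := by
    linear_combination -F2 * h.h0 + F1 * h.h1 - F0 * h.h2
  exact (mul_eq_zero.1 this).resolve_left h.hm.ne'

theorem Dat.syz2 {m Δ s F0 F1 F2 F3 A B C : ℤ} (h : Dat m Δ s F0 F1 F2 F3 A B C) :
    A * F3 - B * F2 + C * F1 = 0 := by
  have : m * (A * F3 - B * F2 + C * F1) = 0 := by
    linear_combination -F3 * h.h0 + F2 * h.h1 - F1 * h.h2
  exact (mul_eq_zero.1 this).resolve_left h.hm.ne'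

theorem Dat.par {m Δ s F0 F1 F2 F3 A B C : ℤ} (h : Dat m Δ s F0 F1 F2 F3 A B C) :
    (∃ w : ℤ, Δ - B = 2 * w) ∧ ∃ k : ℤ, Δ ^ 2 - Δ = 4 * k := by
  obtain ⟨t, ht⟩ : ∃ t : ℤ, B ^ 2 - B = 2 * t := by
    obtain ⟨t, ht⟩ := Int.even_mul_pred_self B
    exact ⟨t, by linear_combination ht⟩
  have hD := h.hD
  refine ⟨⟨t - 2 * A * C, by linear_combination ht - hD⟩, ?_⟩
  refine ⟨t + t ^ 2 - 2 * B ^ 2 * A * C + 4 * A ^ 2 * C ^ 2 + A * C + B * t - t  , ?_⟩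
  rw [← hD]
  have : B ^ 2 = B + 2 * t := by linarith
  have h4 : B ^ 4 = B ^ 2 + 4 * t * B + 4 * t ^ 2 := by
    calc B ^ 4 = (B ^ 2) ^ 2 := by ring
      _ = (B + 2 * t) ^ 2 := by rw [this]
      _ = _ := by ring
  linear_combination h4

namespace KK
variable {Δ : ℤ}

theorem KD_of_dat {m s F0 F1 F2 F3 A B C : ℤ} (h : Dat m Δ s F0 F1 F2 F3 A B C) :
    ∃ (α : KK Δ) (L : Submodule ℤ (KK Δ)), KD m s (F0, 3 * F1, 3 * F2, F3) α L A := by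
  have hA : (A : ℚ) ≠ 0 := by exact_mod_cast h.hA
  have s1 : (A : ℚ) * F2 - B * F1 + C * F0 = 0 := by exact_mod_cast h.syz1
  have s2 : (A : ℚ) * F3 - B * F2 + C * F1 = 0 := by exact_mod_cast h.syz2
  have hD : (B : ℚ) ^ 2 - 4 * A * C = Δ := by exact_mod_cast h.hD
  have h0 : (F1 : ℚ) ^ 2 - F0 * F2 = m * A := by exact_mod_cast h.h0
  obtain ⟨⟨w, hw⟩, -⟩ := h.par
  have hwq : (Δ : ℚ) - B = 2 * w := by exact_mod_cast hw
  set b0 : KK Δ := mk ((2 * F1 * A - F0 * B) / 2) (F0 / 2) with hb0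
  set b1 : KK Δ := mk ((2 * A * F2 - B * F1) / 2) (F1 / 2) with hb1
  set b2 : KK Δ := mk ((2 * A * F3 - B * F2) / 2) (F2 / 2) with hb2
  set b3 : KK Δ := mk ((B * F3 - 2 * C * F2) / 2) (F3 / 2) with hb3
  set e : KK Δ := mk (B / 2) (1 / 2) with he
  have E0 : b0 * e = (A : KK Δ) * b1 := by
    apply ext
    · simp only [re_mul, re_mk, im_mk, re_intCast, im_intCast, hb0, hb1, he]
      rw [← hD]; linear_combination (-A) * s1
    · simp only [im_mul, re_mk, im_mk, re_intCast, im_intCast, hb0, hb1, he]; ring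
  have E1 : b1 * e = (A : KK Δ) * b2 := by
    apply ext
    · simp only [re_mul, re_mk, im_mk, re_intCast, im_intCast, hb1, hb2, he]
      rw [← hD]; linear_combination (-A) * s2
    · simp only [im_mul, re_mk, im_mk, re_intCast, im_intCast, hb1, hb2, he]; ring
  have E2 : b2 * e = (A : KK Δ) * b3 := by
    apply ext
    · simp only [re_mul, re_mk, im_mk, re_intCast, im_intCast, hb2, hb3, he]
      rw [← hD]; ring
    · simp only [im_mul, re_mk, im_mk, re_intCast, im_intCast, hb2, hb3, he]; ring
  set α : KK Δ := mk (1 / (A : ℚ) ^ 3) 0 * b0 with hα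
  have hAinv : (mk (1 / (A : ℚ) ^ 3) 0 : KK Δ) * (A : KK Δ) ^ 3 = 1 := by
    apply ext
    · simp only [pow_succ, pow_zero, one_mul, re_mul, im_mul, re_mk, im_mk, re_intCast, im_intCast, re_one]
      field_simp; ring
    · simp only [pow_succ, pow_zero, one_mul, re_mul, im_mul, re_mk, im_mk, re_intCast, im_intCast, im_one]
      ring
  have a0 : α * (A : KK Δ) ^ 3 = b0 := by rw [hα]; linear_combination b0 * hAinv
  have nA : nm (A : KK Δ) ≠ 0 := by rw [nm_int]; positivity
  have a1 : α * ((A : KK Δ) ^ 2 * e) = b1 := by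
    apply cancel nA; linear_combination e * a0 + E0
  have a2 : α * ((A : KK Δ) * e ^ 2) = b2 := by
    apply cancel nA; linear_combination e * a1 + E1
  have a3 : α * e ^ 3 = b3 := by
    apply cancel nA; linear_combination e * a2 + E2
  have hee : e * e = (B : KK Δ) * e - ((A * C : ℤ) : KK Δ) := by
    apply ext
    · simp only [re_mul, re_sub, re_mk, im_mk, re_intCast, im_intCast, he]; rw [← hD]; push_cast; ring
    · simp only [im_mul, im_sub, re_mk, im_mk, re_intCast, im_intCast, he]; ring
  have hce : cj e = (B : KK Δ) - e := by
    apply ext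
    · simp only [re_sub, re_mk, re_intCast, re_cj, he]; ring
    · simp only [im_sub, im_mk, im_intCast, im_cj, he]; ring
  have hom : (om : KK Δ) = e + (w : KK Δ) := by
    apply ext
    · simp only [re_add, om, re_mk, re_intCast, he]; linarith
    · simp only [im_add, om, im_mk, im_intCast, he]; ring
  have J : ∀ (F G : ℤ), 2 * m ∣ G - s * F →
      (mk ((G : ℚ) / 2) (F / 2) : KK Δ) ∈
        Submodule.span ℤ {(mk (s / 2) (1 / 2) : KK Δ), (m : KK Δ)} := by
    rintro F G ⟨t, ht⟩
    have htq : (G : ℚ) - s * F = 2 * m * t := by exact_mod_cast ht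
    rw [mem_span_pair_int]
    refine ⟨F, t, ?_⟩
    apply ext
    · simp only [re_add, re_mul, re_mk, im_mk, re_intCast, im_intCast]; linarith
    · simp only [im_add, im_mul, re_mk, im_mk, re_intCast, im_intCast]; ring
  have j0 := J F0 (2 * F1 * A - F0 * B) h.g0
  have j1 := J F1 (2 * A * F2 - B * F1) h.g1
  have j2 := J F2 (2 * A * F3 - B * F2) h.g2
  have j3 := J F3 (B * F3 - 2 * C * F2) h.g3
  push_cast at j0 j1 j2 j3
  rw [← hb0] at j0; rw [← hb1] at j1; rw [← hb2] at j2; rw [← hb3] at j3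
  refine ⟨α, Submodule.span ℤ {(A : KK Δ), e}, ?_⟩
  have om1 : (1 : KK Δ) ∈ OO Δ := Submodule.subset_span (by simp)
  have omem : (om : KK Δ) ∈ OO Δ := Submodule.subset_span (by simp)
  refine ⟨h.hA, ?_, ⟨_, _, rfl, ⟨?_, ?_, ?_, ?_⟩, ?_⟩, ?_, ?_, ?_, ?_⟩
  · rw [hα, nm_mul]
    have e1 : nm (mk (1 / (A : ℚ) ^ 3) 0 : KK Δ) = 1 / (A : ℚ) ^ 6 := by simp [nm]; ring
    have e2 : nm b0 = m * (A : ℚ) ^ 3 := by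
      simp only [nm, hb0, re_mk, im_mk]
      rw [← hD]
      linear_combination (A : ℚ) ^ 2 * h0 + A * F0 * s1
    rw [e1, e2]; field_simp
  · rw [a0]; simp [hb0]; ring
  · rw [a1]; simp [hb1]; ring
  · rw [a2]; simp [hb2]; ring
  · rw [a3]; simp [hb3]; ring
  · simp [he, hA]
  · apply le_antisymm
    · unfold OO
      rw [Submodule.span_mul_span, Submodule.span_le]
      rintro z ⟨a, ha, b, hb, rfl⟩
      rw [SetLike.mem_coe, mem_span_pair_int]
      rcases ha with rfl | rfl <;> rcases hb with rfl | rfl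
      · exact ⟨1, 0, by push_cast; ring⟩
      · exact ⟨0, 1, by push_cast; ring⟩
      · exact ⟨w, A, by rw [hom]; push_cast; ring⟩
      · refine ⟨-C, B + w, ?_⟩
        simp only [hom]; push_cast at hee ⊢; linear_combination -hee
    · intro z hz
      have := Submodule.mul_mem_mul om1 hz
      rwa [one_mul] at this
  · rw [Submodule.span_le]
    rintro z (rfl | rfl)
    · rw [SetLike.mem_coe, mem_OO]; exact ⟨A, 0, by push_cast; ring⟩
    · rw [SetLike.mem_coe, mem_OO]; exact ⟨-w, 1, by rw [hom]; push_cast; ring⟩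
  · rw [bar_pair, map_intCast]
    apply le_antisymm
    · rw [Submodule.span_mul_span, Submodule.span_le]
      rintro z ⟨a, ha, b, hb, rfl⟩
      rw [SetLike.mem_coe, Submodule.mem_span_singleton_mul]
      simp only [mem_OO]
      rcases ha with rfl | rfl <;> rcases hb with rfl | rfl
      · exact ⟨_, ⟨A, 0, rfl⟩, by push_cast; ring⟩
      · refine ⟨_, ⟨B + w, -1, rfl⟩, ?_⟩
        simp only [hom, hce]; push_cast; ring
      · refine ⟨_, ⟨- w, 1, rfl⟩, ?_⟩
        simp only [hom]; push_cast; ring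
      · refine ⟨_, ⟨C, 0, rfl⟩, ?_⟩
        simp only [hce]; push_cast at hee ⊢; linear_combination hee
    · unfold OO
      obtain ⟨y1, y2, y3, hy⟩ := h.hp
      have hyK : (y1 : KK Δ) * A + (y2 : KK Δ) * B + (y3 : KK Δ) * C = 1 := by
        exact_mod_cast congrArg (Int.cast : ℤ → KK Δ) hy
      have m1 : (A : KK Δ) ∈ Submodule.span ℤ {(A : KK Δ), e} := Submodule.subset_span (by simp)
      have m2 : e ∈ Submodule.span ℤ {(A : KK Δ), e} := Submodule.subset_span (by simp)
      have m3 : (A : KK Δ) ∈ Submodule.span ℤ {(A : KK Δ), cj e} := Submodule.subset_span (by simp)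
      have m4 : cj e ∈ Submodule.span ℤ {(A : KK Δ), cj e} := Submodule.subset_span (by simp)
      have n1 := Submodule.mul_mem_mul m1 m3
      have n2 := Submodule.mul_mem_mul m1 m4
      have n3 := Submodule.mul_mem_mul m2 m3
      have n4 := Submodule.mul_mem_mul m2 m4
      set P := Submodule.span ℤ {(A : KK Δ), e} * Submodule.span ℤ {(A : KK Δ), cj e} with hP
      have hAP : (A : KK Δ) ∈ P := by
        have := P.add_mem (P.add_mem (P.smul_mem y1 n1) (P.smul_mem y2 (P.add_mem n2 n3)))
          (P.smul_mem y3 n4)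
        simp only [zsmul_eq_mul] at this
        convert this using 1
        rw [hce]; push_cast at hee; linear_combination (y3 : KK Δ) * hee - (A : KK Δ) * hyK
      rw [Submodule.span_mul_span, Submodule.span_le]
      rintro z ⟨a, ha, b, hb, rfl⟩
      rcases ha with rfl
      rcases hb with rfl | rfl
      · simpa using hAP
      · have := P.add_mem n3 (P.smul_mem w hAP)
        rw [zsmul_eq_mul] at this
        show (A : KK Δ) * om ∈ P
        convert this using 1
        rw [hom]; ring
  · rw [Submodule.span_mul_span, Submodule.span_mul_span, Submodule.span_mul_span, Submodule.span_le]
    rintro z ⟨a, ha, b, ⟨c, ⟨u, hu, v, hv, rfl⟩, d, hd, rfl⟩, rfl⟩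
    rcases ha with rfl
    show _ * (u * v * d) ∈ Submodule.span ℤ {(mk (s / 2) (1 / 2) : KK Δ), (m : KK Δ)}
    rcases hu with rfl | rfl <;> rcases hv with rfl | rfl <;> rcases hd with rfl | rfl
    · convert j0 using 1; rw [← a0]; ring
    · convert j1 using 1; rw [← a1]; ring
    · convert j1 using 1; rw [← a1]; ring
    · convert j2 using 1; rw [← a2]; ring
    · convert j1 using 1; rw [← a1]; ring
    · convert j2 using 1; rw [← a2]; ring
    · convert j2 using 1; rw [← a2]; ring
    · convert j3 using 1; rw [← a3]; ring

end KK
end BCF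

namespace BCF
open KK

theorem exists_H0 {f : BCF} (hf : disc f ≠ 0) : ∃ f', GLeq f f' ∧ H0 f' ≠ 0 := by
  by_cases h0 : H0 f = 0
  · by_cases h2 : H2 f = 0
    · refine ⟨sub 1 0 1 1 f, (GLeq_iff _ _).2 ⟨1, 0, 1, 1, by simp, rfl⟩, ?_⟩
      rw [H0_sub, h0, h2]
      have := H_disc f
      rw [h0] at this
      intro h
      ring_nf at h
      rw [h] at this
      apply hf; linarith
    · refine ⟨sub 0 1 1 0 f, (GLeq_iff _ _).2 ⟨0, 1, 1, 0, by simp, rfl⟩, ?_⟩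
      rw [H0_sub]
      intro h; apply h2; ring_nf at h; exact h
  · exact ⟨f, GLeq_refl f, h0⟩

/-- `3 f = e Φ`. -/
def Tri (e : ℤ) (f Φ : BCF) : Prop :=
  3 * f.1 = e * Φ.1 ∧ 3 * f.2.1 = e * Φ.2.1 ∧ 3 * f.2.2.1 = e * Φ.2.2.1 ∧ 3 * f.2.2.2 = e * Φ.2.2.2

theorem Tri.gleq {e : ℤ} {f Φ f' Φ' : BCF} (h : Tri e f Φ) (h' : Tri e f' Φ')
    (hg : GLeq Φ Φ') : GLeq f f' := by
  obtain ⟨p, q, s, t, hd, rfl⟩ := (GLeq_iff _ _).1 hg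
  rw [GLeq_iff]
  refine ⟨p, q, s, t, hd, ?_⟩
  obtain ⟨a, b, c, d⟩ := f
  obtain ⟨a', b', c', d'⟩ := f'
  obtain ⟨h0, h1, h2, h3⟩ := h
  obtain ⟨k0, k1, k2, k3⟩ := h'
  simp only [sub] at *
  refine Prod.ext ?_ (Prod.ext ?_ (Prod.ext ?_ ?_)) <;> simp only
  · have : 3 * a' = 3 * (a * p ^ 3 + b * p ^ 2 * s + c * p * s ^ 2 + d * s ^ 3) := by
      rw [k0]; linear_combination -(p ^ 3) * h0 - p ^ 2 * s * h1 - p * s ^ 2 * h2 - s ^ 3 * h3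
    linarith
  · have : 3 * b' = 3 * (3 * a * p ^ 2 * q + b * (p ^ 2 * t + 2 * p * q * s)
      + c * (2 * p * s * t + q * s ^ 2) + 3 * d * s ^ 2 * t) := by
      rw [k1]; linear_combination -(3 * p ^ 2 * q) * h0 - (p ^ 2 * t + 2 * p * q * s) * h1
        - (2 * p * s * t + q * s ^ 2) * h2 - 3 * s ^ 2 * t * h3
    linarith
  · have : 3 * c' = 3 * (3 * a * p * q ^ 2 + b * (2 * p * q * t + q ^ 2 * s)
      + c * (p * t ^ 2 + 2 * q * s * t) + 3 * d * s * t ^ 2) := by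
      rw [k2]; linear_combination -(3 * p * q ^ 2) * h0 - (2 * p * q * t + q ^ 2 * s) * h1
        - (p * t ^ 2 + 2 * q * s * t) * h2 - 3 * s * t ^ 2 * h3
    linarith
  · have : 3 * d' = 3 * (a * q ^ 3 + b * q ^ 2 * t + c * q * t ^ 2 + d * t ^ 3) := by
      rw [k3]; linear_combination -(q ^ 3) * h0 - q ^ 2 * t * h1 - q * t ^ 2 * h2 - t ^ 3 * h3
    linarith

/-- `f` has content `e`, Hessian content `m`, reduced Hessian discriminant `Δ` and type `s`. -/
def TP (e m Δ s : ℤ) (f : BCF) : Prop :=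
  ∃ F0 F1 F2 F3 A B C f', GLeq f f' ∧ Tri e f' (F0, 3 * F1, 3 * F2, F3) ∧
    Dat m Δ s F0 F1 F2 F3 A B C ∧ 4 * m ∣ s ^ 2 - Δ ∧ 0 ≤ s ∧ s < 2 * m

/-- base data -/
abbrev Base := ∀ Δ : ℤ, ℤ → BCF × KK Δ × Submodule ℤ (KK Δ) × ℤ

def Rel (e m : ℤ) (b : Base) (Δ s : ℤ) (f Ψ : BCF) (σ : ℚ) : Prop :=
  KD m s (b Δ s).1 (b Δ s).2.1 (b Δ s).2.2.1 (b Δ s).2.2.2 ∧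
  ∃ (f' Φ : BCF) (α : KK Δ) (L : Submodule ℤ (KK Δ)) (A : ℤ) (x y : KK Δ),
    GLeq f f' ∧ Tri e f' Φ ∧ KD m s Φ α L A ∧ L * bar (b Δ s).2.2.1 = Submodule.span ℤ {x, y} ∧
    FormOf (comp m α (b Δ s).2.1) x y Ψ ∧
    nm (comp m α (b Δ s).2.1) * (2 * im (cj x * y)) ^ 3 = σ

theorem Rel.inj {e m : ℤ} (hm : m ≠ 0) {b : Base} {Δ s : ℤ} {f g Ψ : BCF} {σ : ℚ} (hσ : σ ≠ 0)
    (hH : H0 Ψ ≠ 0) (hf : Rel e m b Δ s f Ψ σ) (hg : Rel e m b Δ s g Ψ σ) : GLeq f g := by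
  obtain ⟨hb, f', Φ, α, L, A, x, y, h1, h2, h3, h4, h5, h6⟩ := hf
  obtain ⟨-, g', Φ', α', L', A', x', y', k1, k2, k3, k4, k5, k6⟩ := hg
  have := KD.inj hm hb h3 k3 hσ h4 k4 h5 k5 h6 k6 hH
  exact GLeq_trans h1 (GLeq_trans (h2.gleq k2 this) (GLeq_symm k1))

theorem Rel.move {e m : ℤ} {b : Base} {Δ s : ℤ} {f Ψ g : BCF} {σ : ℚ} (hσ : σ = 1 ∨ σ = -1)
    (hf : Rel e m b Δ s f Ψ σ) (hg : GLeq Ψ g) : ∃ σ', (σ' = 1 ∨ σ' = -1) ∧ Rel e m b Δ s f g σ' := by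
  obtain ⟨hb, f', Φ, α, L, A, x, y, h1, h2, h3, h4, h5, h6⟩ := hf
  obtain ⟨x', y', k4, k5, k6⟩ := comp_move hg h4 h5 (by rw [h6]; exact hσ)
  exact ⟨_, k6, hb, f', Φ, α, L, A, x', y', h1, h2, h3, k4, k5, rfl⟩

theorem Rel.disc {e m : ℤ} {b : Base} {Δ s : ℤ} {f Ψ : BCF} {σ : ℚ} (hσ : σ = 1 ∨ σ = -1)
    (hf : Rel e m b Δ s f Ψ σ) : BCF.disc Ψ = -27 * Δ := by
  obtain ⟨hb, f', Φ, α, L, A, x, y, h1, h2, h3, h4, h5, h6⟩ := hf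
  have := form_disc h5
  rw [h6] at this
  have h2 : σ ^ 2 = 1 := by rcases hσ with h | h <;> rw [h] <;> norm_num
  rw [h2, mul_one] at this
  exact_mod_cast this

theorem exists_base (m : ℤ) : ∃ b : Base, ∀ Δ s, (∃ Φ α L A, KD (Δ := Δ) m s Φ α L A) →
    KD m s (b Δ s).1 (b Δ s).2.1 (b Δ s).2.2.1 (b Δ s).2.2.2 := by
  have : ∀ Δ s : ℤ, ∃ q : BCF × KK Δ × Submodule ℤ (KK Δ) × ℤ,
      (∃ Φ α L A, KD (Δ := Δ) m s Φ α L A) → KD m s q.1 q.2.1 q.2.2.1 q.2.2.2 := by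
    intro Δ s
    by_cases h : ∃ Φ α L A, KD (Δ := Δ) m s Φ α L A
    · obtain ⟨Φ, α, L, A, h'⟩ := h
      exact ⟨(Φ, α, L, A), fun _ => h'⟩
    · exact ⟨(0, 0, 0, 0), fun h' => absurd h' h⟩
  choose b hb using this
  exact ⟨b, hb⟩

theorem exists_rel {e m : ℤ} {b : Base} (hb : ∀ Δ s, (∃ Φ α L A, KD (Δ := Δ) m s Φ α L A) →
    KD m s (b Δ s).1 (b Δ s).2.1 (b Δ s).2.2.1 (b Δ s).2.2.2) {Δ s : ℤ} {f : BCF}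
    (h : TP e m Δ s f) : ∃ Ψ σ, (σ = 1 ∨ σ = -1) ∧ Rel e m b Δ s f Ψ σ := by
  obtain ⟨F0, F1, F2, F3, A, B, C, f', hg, ht, hd, -⟩ := h
  obtain ⟨α, L, hk⟩ := KD_of_dat hd
  have hb' := hb Δ s ⟨_, _, _, _, hk⟩
  obtain ⟨x, y, Ψ, h1, h2, h3⟩ := KD.exists_comp hd.par.2 hd.hm.ne' hb' hk
  exact ⟨Ψ, _, h3, hb', f', _, α, L, A, x, y, hg, ht, hk, h1, h2, rfl⟩

/-- square roots of `Δ` mod `4 * m` -/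
def sroots (m Δ : ℤ) : Finset ℤ := (Finset.Ico 0 (2 * m)).filter (fun s => 4 * m ∣ s ^ 2 - Δ)

theorem fiber_bound (e m : ℤ) (hm : 0 < m) (ρ : ℕ) (hρ : ∀ Δ, (sroots m Δ).card ≤ ρ) (Z : ℝ)
    (hZ : 0 < Z) :
    NB (fun f => ∃ Δ s, TP e m Δ s f ∧ Δ ≠ 0 ∧ |(Δ : ℝ)| < Z) ((2 * ρ : ℕ) * (224 * (27 * Z))) := by
  obtain ⟨b, hb⟩ := exists_base m
  have : ∀ f : BCF, ∃ (Ψ : BCF) (Δ s : ℤ), (∃ Δ s, TP e m Δ s f ∧ Δ ≠ 0 ∧ |(Δ : ℝ)| < Z) →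
      (∃ σ, (σ = 1 ∨ σ = -1) ∧ Rel e m b Δ s f Ψ σ) ∧ Δ ≠ 0 ∧ |(Δ : ℝ)| < Z ∧ s ∈ sroots m Δ := by
    intro f
    by_cases h : ∃ Δ s, TP e m Δ s f ∧ Δ ≠ 0 ∧ |(Δ : ℝ)| < Z
    · obtain ⟨Δ, s, h1, h2, h3⟩ := h
      obtain ⟨Ψ, σ, hσ, hr⟩ := exists_rel hb h1
      refine ⟨Ψ, Δ, s, fun _ => ⟨⟨σ, hσ, hr⟩, h2, h3, ?_⟩⟩
      obtain ⟨_, _, _, _, _, _, _, _, _, _, _, h4, h5, h6⟩ := h1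
      simp [sroots, h4, h5, h6]
    · exact ⟨0, 0, 0, fun h' => absurd h' h⟩
  choose φ D s hφ using this
  refine NB_map (Q := fun f => disc f ≠ 0 ∧ |(disc f : ℝ)| < 27 * Z) (2 * ρ) φ ?_ ?_ ?_
    (davenport _ (by positivity))
  · rintro f g h ⟨h1, h2⟩
    rw [disc_GLeq h]; exact ⟨h1, h2⟩
  · intro f hf
    obtain ⟨⟨σ, hσ, hr⟩, h2, h3, -⟩ := hφ f hf
    rw [hr.disc hσ]
    refine ⟨by simpa using h2, ?_⟩
    push_cast
    rw [abs_mul]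
    norm_num
    linarith
  · intro S g hS hsep
    rcases S.eq_empty_or_nonempty with rfl | ⟨f0, hf0⟩
    · simp
    obtain ⟨hP0, hg0⟩ := hS f0 hf0
    obtain ⟨⟨σ0, hσ0, hr0⟩, hD0, -, -⟩ := hφ f0 hP0
    have hdg : disc g = -27 * D f0 := by rw [disc_GLeq hg0, hr0.disc hσ0]
    have hg : disc g ≠ 0 := by rw [hdg]; simpa using hD0
    obtain ⟨g', hgg, hH⟩ := exists_H0 hg
    have hD : ∀ f ∈ S, D f = D f0 := by
      intro f hf
      obtain ⟨hP, hg1⟩ := hS f hf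
      obtain ⟨⟨σ, hσ, hr⟩, -⟩ := hφ f hP
      have : disc g = -27 * D f := by rw [disc_GLeq hg1, hr.disc hσ]
      linarith
    have hσ : ∀ f : BCF, ∃ σ : ℚ, f ∈ S → (σ = 1 ∨ σ = -1) ∧ Rel e m b (D f0) (s f) f g' σ := by
      intro f
      by_cases hf : f ∈ S
      · obtain ⟨hP, hg1⟩ := hS f hf
        obtain ⟨⟨σ, hσ, hr⟩, -⟩ := hφ f hP
        obtain ⟨σ', h1, h2⟩ := hr.move hσ (GLeq_trans hg1 hgg)
        rw [hD f hf] at h2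
        exact ⟨σ', fun _ => ⟨h1, h2⟩⟩
      · exact ⟨0, fun h => absurd h hf⟩
    choose σ hσ using hσ
    have hcard : S.card ≤ ((sroots m (D f0)) ×ˢ ({1, -1} : Finset ℚ)).card := by
      apply Finset.card_le_card_of_injOn (fun f => (s f, σ f))
      · intro f hf
        obtain ⟨hP, hg1⟩ := hS f hf
        have h4 := (hφ f hP).2.2.2
        rw [hD f hf] at h4
        have := (hσ f hf).1
        simp [h4, this]
      · intro f hf f' hf' hff
        simp only [Prod.mk.injEq] at hff
        by_contra hne
        apply hsep f hf f' hf' hne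
        have r1 := (hσ f hf).2
        have r2 := (hσ f' hf').2
        rw [← hff.1, ← hff.2] at r2
        refine Rel.inj hm.ne' ?_ hH r1 r2
        rcases (hσ f hf).1 with h | h <;> rw [h] <;> norm_num
    rw [Finset.card_product] at hcard
    calc S.card ≤ _ := hcard
      _ ≤ ρ * 2 := Nat.mul_le_mul (hρ _) (by
        refine (Finset.card_insert_le _ _).trans ?_
        simp)
      _ = 2 * ρ := by ring

end BCF

namespace BCF
open KK

theorem bez2 (x y : ℤ) : ∃ e a b u v : ℤ, 0 ≤ e ∧ x = e * a ∧ y = e * b ∧ u * x + v * y = e := by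
  obtain ⟨a, ha⟩ := Int.gcd_dvd_left x y
  obtain ⟨b, hb⟩ := Int.gcd_dvd_right x y
  refine ⟨Int.gcd x y, a, b, Int.gcdA x y, Int.gcdB x y, by positivity, ha, hb, ?_⟩
  rw [Int.gcd_eq_gcd_ab]; ring

theorem bez3 (x y z : ℤ) (hx : x ≠ 0) : ∃ e a b c u v w : ℤ, 0 < e ∧ x = e * a ∧ y = e * b ∧
    z = e * c ∧ u * a + v * b + w * c = 1 := by
  obtain ⟨e1, a, b, u, v, h0, hx1, hy, h1⟩ := bez2 x y
  obtain ⟨e, k, c, u', v', h0', hk, hc, h2⟩ := bez2 e1 z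
  have he : e ≠ 0 := by
    rintro rfl
    apply hx; rw [hx1, hk]; ring
  refine ⟨e, k * a, k * b, c, u' * u, u' * v, v', lt_of_le_of_ne h0' (Ne.symm he), ?_, ?_, hc, ?_⟩
  · rw [hx1, hk]; ring
  · rw [hy, hk]; ring
  · apply mul_left_cancel₀ he
    have e1 : e * (k * a) = x := by rw [hx1, hk]; ring
    have e2 : e * (k * b) = y := by rw [hy, hk]; ring
    linear_combination u' * u * e1 + u' * v * e2 - v' * hc + u' * h1 + h2

theorem bez4 (x y z t : ℤ) (hx : ¬ (x = 0 ∧ y = 0 ∧ z = 0 ∧ t = 0)) :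
    ∃ e a b c d u v w q : ℤ, 0 < e ∧ x = e * a ∧ y = e * b ∧
    z = e * c ∧ t = e * d ∧ u * a + v * b + w * c + q * d = 1 := by
  obtain ⟨e1, a, b, u, v, h0, hx1, hy, h1⟩ := bez2 x y
  obtain ⟨e2, c, d, w, q, h2, hz, ht, h3⟩ := bez2 z t
  obtain ⟨e, k, l, u', v', h0', hk, hc, h4⟩ := bez2 e1 e2
  have he : e ≠ 0 := by
    rintro rfl
    apply hx; rw [hx1, hy, hz, ht, hk, hc]; simp
  refine ⟨e, k * a, k * b, l * c, l * d, u' * u, u' * v, v' * w, v' * q,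
    lt_of_le_of_ne h0' (Ne.symm he), ?_, ?_, ?_, ?_, ?_⟩
  · rw [hx1, hk]; ring
  · rw [hy, hk]; ring
  · rw [hz, hc]; ring
  · rw [ht, hc]; ring
  · apply mul_left_cancel₀ he
    have e1 : e * (k * a) = x := by rw [hx1, hk]; ring
    have e2 : e * (k * b) = y := by rw [hy, hk]; ring
    have e3 : e * (l * c) = z := by rw [hz, hc]; ring
    have e4 : e * (l * d) = t := by rw [ht, hc]; ring
    linear_combination u' * u * e1 + u' * v * e2 + v' * w * e3 + v' * q * e4 + u' * h1 + v' * h3 + h4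

theorem exists_TP {f : BCF} (hf : disc f ≠ 0) : ∃ e m Δ s : ℤ, 0 < e ∧ 0 < m ∧ Δ ≠ 0 ∧
    TP e m Δ s f ∧ -3 * disc f = e ^ 4 * m ^ 2 * Δ ∧ ∀ r : ℤ, HD r f → r ∣ e ^ 2 * m := by
  obtain ⟨f', hg, hH⟩ := exists_H0 hf
  have hdf := disc_GLeq hg
  have hHD : ∀ r : ℤ, HD r f → HD r f' := fun r h => (HD_GLeq r hg).1 h
  have hdis := H_disc f'
  rw [← hdf] at hf ⊢
  clear hdf
  obtain ⟨a, b, c, d⟩ := f'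
  obtain ⟨e, F0, F1, F2, F3, x0, x1, x2, x3, he, hE0, hE1, hE2, hE3, hx⟩ := bez4 (3 * a) b c (3 * d)
    (by
      rintro ⟨h1, h2, h3, h4⟩
      apply hH; simp only [H0]; rw [h2, h3]; ring)
  have k0 : H0 (a, b, c, d) = e ^ 2 * (F1 ^ 2 - F0 * F2) := by
    simp only [H0]; rw [hE0, hE1, hE2]; ring
  have k1 : H1 (a, b, c, d) = e ^ 2 * (F1 * F2 - F0 * F3) := by
    simp only [H1]
    rw [show 9 * a * d = (3 * a) * (3 * d) by ring, hE0, hE1, hE2, hE3]; ring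
  have k2 : H2 (a, b, c, d) = e ^ 2 * (F2 ^ 2 - F1 * F3) := by
    simp only [H2]
    rw [show 3 * b * d = b * (3 * d) by ring, hE1, hE2, hE3]; ring
  obtain ⟨m, A, B, C, y1, y2, y3, hm, h0, h1, h2, hy⟩ :=
    bez3 (F1 ^ 2 - F0 * F2) (F1 * F2 - F0 * F3) (F2 ^ 2 - F1 * F3) (by
      intro h; apply hH; rw [k0, h]; ring)
  have hA : A ≠ 0 := by
    rintro rfl
    apply hH; rw [k0, h0]; ring
  have syz1 : A * F2 - B * F1 + C * F0 = 0 := by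
    apply mul_left_cancel₀ hm.ne'
    linear_combination -F2 * h0 + F1 * h1 - F0 * h2
  have syz2 : A * F3 - B * F2 + C * F1 = 0 := by
    apply mul_left_cancel₀ hm.ne'
    linear_combination -F3 * h0 + F2 * h1 - F1 * h2
  set Δ := B ^ 2 - 4 * A * C with hΔ
  have hdd : -3 * disc (a, b, c, d) = e ^ 4 * m ^ 2 * Δ := by
    rw [← hdis, k0, k1, k2, h0, h1, h2]; ring
  have p01 : F0 * (2 * A * F2 - B * F1) - F1 * (2 * F1 * A - F0 * B) = 2 * m * (-A ^ 2) := by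
    linear_combination (-2 * A) * h0
  have p02 : F0 * (2 * A * F3 - B * F2) - F2 * (2 * F1 * A - F0 * B) = 2 * m * (-A * B) := by
    linear_combination (-2 * A) * h1
  have p03 : F0 * (B * F3 - 2 * C * F2) - F3 * (2 * F1 * A - F0 * B)
      = 2 * m * (-(B ^ 2 - A * C)) := by
    linear_combination (-2 * B) * h1 + 2 * C * h0 - 2 * F1 * syz2
  have p12 : F1 * (2 * A * F3 - B * F2) - F2 * (2 * A * F2 - B * F1) = 2 * m * (-A * C) := by
    linear_combination (-2 * A) * h2
  have p13 : F1 * (B * F3 - 2 * C * F2) - F3 * (2 * A * F2 - B * F1) = 2 * m * (-B * C) := by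
    linear_combination (-2 * B) * h2 - 2 * F2 * syz2
  have p23 : F2 * (B * F3 - 2 * C * F2) - F3 * (2 * A * F3 - B * F2) = 2 * m * (-C ^ 2) := by
    linear_combination (-2 * C) * h2 - 2 * F3 * syz2
  have q00 : (2 * F1 * A - F0 * B) ^ 2 - Δ * F0 ^ 2 = 4 * m * A ^ 3 := by
    rw [hΔ]; linear_combination 4 * A ^ 2 * h0 + 4 * A * F0 * syz1
  have q11 : (2 * A * F2 - B * F1) ^ 2 - Δ * F1 ^ 2 = 4 * m * (A ^ 2 * C) := by
    rw [hΔ]; linear_combination 4 * A * C * h0 + 4 * A * F2 * syz1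
  have q22 : (2 * A * F3 - B * F2) ^ 2 - Δ * F2 ^ 2 = 4 * m * (A * C ^ 2) := by
    rw [hΔ]; linear_combination 4 * A * C * h2 + 4 * A * F3 * syz2
  have q33 : (B * F3 - 2 * C * F2) ^ 2 - Δ * F3 ^ 2 = 4 * m * (C ^ 3) := by
    rw [hΔ]; linear_combination 4 * C ^ 2 * h2 + 4 * C * F3 * syz2
  have q01 : (2 * F1 * A - F0 * B) * (2 * A * F2 - B * F1) - Δ * F0 * F1 = 2 * m * (A ^ 2 * B) := by
    rw [hΔ]; linear_combination 2 * A * B * h0 + 4 * A * F1 * syz1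
  have q02 : (2 * F1 * A - F0 * B) * (2 * A * F3 - B * F2) - Δ * F0 * F2
      = 2 * m * (A * B ^ 2 - 2 * A ^ 2 * C) := by
    rw [hΔ]; linear_combination 2 * A * B * h1 - 4 * A * C * h0 + 4 * A * F1 * syz2
  have q03 : (2 * F1 * A - F0 * B) * (B * F3 - 2 * C * F2) - Δ * F0 * F3
      = 2 * m * (B * (B ^ 2 - A * C) - 2 * A * B * C) := by
    rw [hΔ]; linear_combination (2 * B ^ 2 - 4 * A * C) * h1 - 2 * B * C * h0 + 2 * B * F1 * syz2
  have q12 : (2 * A * F2 - B * F1) * (2 * A * F3 - B * F2) - Δ * F1 * F2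
      = 2 * m * (A * B * C) := by
    rw [hΔ]; linear_combination 2 * A * B * h2 + 4 * A * F2 * syz2
  have q13 : (2 * A * F2 - B * F1) * (B * F3 - 2 * C * F2) - Δ * F1 * F3
      = 2 * m * (B ^ 2 * C - 2 * A * C ^ 2) := by
    rw [hΔ]; linear_combination (2 * B ^ 2 - 4 * A * C) * h2 + 2 * B * F2 * syz2
  have q23 : (2 * A * F3 - B * F2) * (B * F3 - 2 * C * F2) - Δ * F2 * F3
      = 2 * m * (B * C ^ 2) := by
    rw [hΔ]; linear_combination 2 * B * C * h2 + 2 * B * F3 * syz2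
  set G0 := 2 * F1 * A - F0 * B with hG0
  set G1 := 2 * A * F2 - B * F1 with hG1
  set G2 := 2 * A * F3 - B * F2 with hG2
  set G3 := B * F3 - 2 * C * F2 with hG3
  set s0 := x0 * G0 + x1 * G1 + x2 * G2 + x3 * G3 with hs0
  obtain ⟨t, ht⟩ : ∃ t, s0 = 2 * m * t + s0 % (2 * m) :=
    ⟨s0 / (2 * m), by have := Int.emod_add_mul_ediv s0 (2 * m); linarith⟩
  have hs1 := Int.emod_nonneg s0 (show 2 * m ≠ 0 by positivity)
  have hs2 := Int.emod_lt_of_pos s0 (show 0 < 2 * m by positivity)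
  set s := s0 % (2 * m) with hs
  have hss : 4 * m ∣ s ^ 2 - Δ := by
    refine ⟨x0 ^ 2 * A ^ 3 + x1 ^ 2 * (A ^ 2 * C) + x2 ^ 2 * (A * C ^ 2) + x3 ^ 2 * C ^ 3
      + x0 * x1 * (A ^ 2 * B) + x0 * x2 * (A * B ^ 2 - 2 * A ^ 2 * C)
      + x0 * x3 * (B * (B ^ 2 - A * C) - 2 * A * B * C) + x1 * x2 * (A * B * C)
      + x1 * x3 * (B ^ 2 * C - 2 * A * C ^ 2) + x2 * x3 * (B * C ^ 2) - s * t - m * t ^ 2, ?_⟩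
    have e1 : s0 ^ 2 - Δ * (x0 * F0 + x1 * F1 + x2 * F2 + x3 * F3) ^ 2 =
      4 * m * (x0 ^ 2 * A ^ 3 + x1 ^ 2 * (A ^ 2 * C) + x2 ^ 2 * (A * C ^ 2) + x3 ^ 2 * C ^ 3
      + x0 * x1 * (A ^ 2 * B) + x0 * x2 * (A * B ^ 2 - 2 * A ^ 2 * C)
      + x0 * x3 * (B * (B ^ 2 - A * C) - 2 * A * B * C) + x1 * x2 * (A * B * C)
      + x1 * x3 * (B ^ 2 * C - 2 * A * C ^ 2) + x2 * x3 * (B * C ^ 2)) := by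
      rw [hs0]
      linear_combination x0 ^ 2 * q00 + x1 ^ 2 * q11 + x2 ^ 2 * q22 + x3 ^ 2 * q33
        + 2 * x0 * x1 * q01 + 2 * x0 * x2 * q02 + 2 * x0 * x3 * q03 + 2 * x1 * x2 * q12
        + 2 * x1 * x3 * q13 + 2 * x2 * x3 * q23
    rw [hx, ht] at e1
    linear_combination e1
  refine ⟨e, m, Δ, s, he, hm, ?_, ⟨F0, F1, F2, F3, A, B, C, (a, b, c, d), hg, ?_, ?_, hss, hs1, hs2⟩,
    hdd, ?_⟩
  · intro h
    rw [h] at hdd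
    apply hf; linarith
  · refine ⟨hE0, ?_, ?_, hE3⟩ <;> simp only
    · rw [hE1]; ring
    · rw [hE2]; ring
  · refine ⟨hm, h0, h1, h2, hA, rfl, ⟨y1, y2, y3, hy⟩, ?_, ?_, ?_, ?_⟩
    · refine ⟨x1 * A ^ 2 + x2 * (A * B) + x3 * (B ^ 2 - A * C) + t * F0, ?_⟩
      rw [← hG0]
      linear_combination (-G0) * hx - x1 * p01 - x2 * p02 - x3 * p03 + F0 * (ht - hs0)
    · refine ⟨-x0 * A ^ 2 + x2 * (A * C) + x3 * (B * C) + t * F1, ?_⟩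
      rw [← hG1]
      linear_combination (-G1) * hx + x0 * p01 - x2 * p12 - x3 * p13 + F1 * (ht - hs0)
    · refine ⟨-x0 * (A * B) - x1 * (A * C) + x3 * C ^ 2 + t * F2, ?_⟩
      rw [← hG2]
      linear_combination (-G2) * hx + x0 * p02 + x1 * p12 - x3 * p23 + F2 * (ht - hs0)
    · refine ⟨-x0 * (B ^ 2 - A * C) - x1 * (B * C) - x2 * C ^ 2 + t * F3, ?_⟩
      rw [← hG3]
      linear_combination (-G3) * hx + x0 * p03 + x1 * p13 + x2 * p23 + F3 * (ht - hs0)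
  · intro r hr
    obtain ⟨⟨z0, r0⟩, ⟨z1, r1⟩, ⟨z2, r2⟩⟩ := hHD r hr
    rw [k0, h0] at r0
    rw [k1, h1] at r1
    rw [k2, h2] at r2
    refine ⟨y1 * z0 + y2 * z1 + y3 * z2, ?_⟩
    linear_combination (-(e ^ 2 * m)) * hy + y1 * r0 + y2 * r1 + y3 * r2

end BCF

namespace BCF
open KK

theorem NB_split {ι : Type*} (I : Finset ι) {P : BCF → Prop} (p : ι → BCF → Prop) (B : ι → ℝ)
    (h : ∀ f, P f → ∃ i ∈ I, p i f) (hB : ∀ i ∈ I, NB (p i) (B i)) : NB P (∑ i ∈ I, B i) := by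
  intro S hS hsep
  have h1 : S ⊆ I.biUnion (fun i => S.filter (p i)) := by
    intro f hf
    obtain ⟨i, hi, hp⟩ := h f (hS f hf)
    simp only [Finset.mem_biUnion, Finset.mem_filter]
    exact ⟨i, hi, hf, hp⟩
  have h2 : S.card ≤ ∑ i ∈ I, (S.filter (p i)).card :=
    (Finset.card_le_card h1).trans Finset.card_biUnion_le
  calc (S.card : ℝ) ≤ ((∑ i ∈ I, (S.filter (p i)).card : ℕ) : ℝ) := by exact_mod_cast h2
    _ = ∑ i ∈ I, ((S.filter (p i)).card : ℝ) := by push_cast; rfl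
    _ ≤ ∑ i ∈ I, B i := by
      apply Finset.sum_le_sum
      intro i hi
      apply hB i hi
      · intro f hf; exact (Finset.mem_filter.1 hf).2
      · exact hsep.mono (Finset.filter_subset _ _)

/-- Bound for the number of types. -/
def rho (m : ℕ) : ℕ := ∑ g ∈ m.divisors, Nat.gcd g (m / g)

theorem count_t (m : ℕ) (hm : 0 < m) (c : ℤ) :
    ((Finset.range m).filter (fun t : ℕ => (m : ℤ) ∣ t * (t + c))).card ≤ rho m := by
  have h1 : (Finset.range m).filter (fun t : ℕ => (m : ℤ) ∣ t * (t + c)) ⊆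
      m.divisors.biUnion (fun g => (Finset.range m).filter
        (fun t : ℕ => g ∣ t ∧ ((m / g : ℕ) : ℤ) ∣ t + c)) := by
    intro t ht
    rw [Finset.mem_filter, Finset.mem_range] at ht
    simp only [Finset.mem_biUnion, Finset.mem_filter, Finset.mem_range, Nat.mem_divisors]
    refine ⟨Nat.gcd t m, ⟨Nat.gcd_dvd_right _ _, hm.ne'⟩, ht.1, Nat.gcd_dvd_left _ _, ?_⟩
    obtain ⟨u, hu⟩ := Nat.gcd_dvd_left t m
    obtain ⟨v, hv⟩ := Nat.gcd_dvd_right t m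
    have hg : 0 < Nat.gcd t m := Nat.gcd_pos_of_pos_right _ hm
    have hco : Nat.Coprime v u := by
      have := Nat.coprime_div_gcd_div_gcd hg
      rw [Nat.div_eq_of_eq_mul_right hg hu, Nat.div_eq_of_eq_mul_right hg hv] at this
      exact this.symm
    rw [Nat.div_eq_of_eq_mul_right hg hv]
    set g := Nat.gcd t m
    have h2 : (v : ℤ) ∣ u * (t + c) := by
      have h3 := ht.2
      have e1 : (m : ℤ) = g * v := by exact_mod_cast hv
      have e2 : (t : ℤ) * (t + c) = g * (u * (t + c)) := by
        have : (t : ℤ) = g * u := by exact_mod_cast hu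
        calc (t : ℤ) * (t + c) = (g * u) * (t + c) := by rw [← this]
          _ = _ := by ring
      rw [e1, e2] at h3
      exact Int.dvd_of_mul_dvd_mul_left (by exact_mod_cast hg.ne') h3
    exact IsCoprime.dvd_of_dvd_mul_left (Nat.isCoprime_iff_coprime.2 hco) h2
  refine (Finset.card_le_card h1).trans (Finset.card_biUnion_le.trans ?_)
  unfold rho
  apply Finset.sum_le_sum
  intro g hg
  obtain ⟨h, hh⟩ := (Nat.mem_divisors.1 hg).1
  have hg0 : 0 < g := Nat.pos_of_mem_divisors hg
  rw [Nat.div_eq_of_eq_mul_right hg0 hh]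
  have hL : 0 < Nat.lcm g h := by
    apply Nat.lcm_pos hg0
    rcases Nat.eq_zero_or_pos h with rfl | h'
    · simp at hh; omega
    · exact h'
  have hGL : Nat.gcd g h * Nat.lcm g h = m := by rw [Nat.gcd_mul_lcm, hh]
  conv_rhs => rw [← Finset.card_range (Nat.gcd g h)]
  apply Finset.card_le_card_of_injOn (fun t => t / Nat.lcm g h)
  · intro t ht
    simp only [Finset.coe_filter, Finset.mem_range, Set.mem_ofPred_eq] at ht
    simp only [Finset.coe_range, Set.mem_Iio]
    rw [Nat.div_lt_iff_lt_mul hL, hGL]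
    exact ht.1
  · intro t ht t' ht' htt
    simp only [Finset.coe_filter, Finset.mem_range, Set.mem_ofPred_eq] at ht ht'
    simp only at htt
    have a1 : t ≡ t' [MOD g] := by
      rw [Nat.modEq_iff_dvd]
      exact dvd_sub (by exact_mod_cast ht'.2.1) (by exact_mod_cast ht.2.1)
    have a2 : t ≡ t' [MOD h] := by
      rw [Nat.modEq_iff_dvd]
      have := dvd_sub ht'.2.2 ht.2.2
      rwa [add_sub_add_right_eq_sub] at this
    have a3 : t ≡ t' [MOD Nat.lcm g h] := by
      rw [Nat.modEq_iff_dvd] at *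
      have := Int.coe_lcm_dvd a1 a2
      simpa using this
    rw [← Nat.div_add_mod t (Nat.lcm g h), ← Nat.div_add_mod t' (Nat.lcm g h), htt, a3]

theorem sroots_card (m : ℕ) (hm : 0 < m) (Δ : ℤ) : (sroots m Δ).card ≤ rho m := by
  rcases (sroots (m : ℤ) Δ).eq_empty_or_nonempty with h | ⟨s0, hs0⟩
  · rw [h]; simp
  · have hm' : (0 : ℤ) < m := by exact_mod_cast hm
    have key : ∀ s ∈ sroots (m : ℤ) Δ, 0 ≤ s ∧ s < 2 * m ∧ ∃ t : ℤ, s = s0 + 2 * t ∧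
        (m : ℤ) ∣ t * (t + s0) := by
      intro s hs
      unfold sroots at hs hs0
      rw [Finset.mem_filter, Finset.mem_Ico] at hs hs0
      have hd : 4 * (m : ℤ) ∣ s ^ 2 - s0 ^ 2 := by
        have := dvd_sub hs.2 hs0.2
        rwa [sub_sub_sub_cancel_right] at this
      have h2 : (2 : ℤ) ∣ s - s0 := by
        have h4 : (2 : ℤ) ∣ s ^ 2 - s0 ^ 2 := dvd_trans ⟨2 * m, by ring⟩ hd
        have h5 : Even (s ^ 2 - s0 ^ 2) := even_iff_two_dvd.2 h4
        rw [Int.even_sub, Int.even_pow' two_ne_zero, Int.even_pow' two_ne_zero, ← Int.even_sub] at h5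
        exact even_iff_two_dvd.1 h5
      obtain ⟨t, ht⟩ := h2
      refine ⟨hs.1.1, hs.1.2, t, by linarith, ?_⟩
      have hst : s = s0 + 2 * t := by linarith
      rw [hst, show (s0 + 2 * t) ^ 2 - s0 ^ 2 = 4 * (t * (t + s0)) by ring] at hd
      exact Int.dvd_of_mul_dvd_mul_left (by norm_num) hd
    refine le_trans ?_ (count_t m hm s0)
    apply Finset.card_le_card_of_injOn (fun s => (((s - s0) / 2) % (m : ℤ)).toNat)
    · intro s hs
      obtain ⟨_, _, t, rfl, hd⟩ := key s hs
      have e1 : (s0 + 2 * t - s0) / 2 = t := by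
        rw [show s0 + 2 * t - s0 = 2 * t by ring]; exact Int.mul_ediv_cancel_left _ (by norm_num)
      have n1 := Int.emod_nonneg t hm'.ne'
      have n2 := Int.emod_lt_of_pos t hm'
      simp only [Finset.coe_filter, Finset.mem_range, Set.mem_ofPred_eq, e1]
      refine ⟨by omega, ?_⟩
      rw [Int.toNat_of_nonneg n1]
      apply Int.dvd_of_emod_eq_zero
      rw [Int.mul_emod, Int.emod_emod_of_dvd _ (dvd_refl _), Int.emod_add_emod, ← Int.mul_emod]
      exact Int.emod_eq_zero_of_dvd hd
    · intro s hs s' hs' hh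
      obtain ⟨a1, a2, t, rfl, _⟩ := key s hs
      obtain ⟨b1, b2, t', rfl, _⟩ := key s' hs'
      have e1 : ∀ t, (s0 + 2 * t - s0) / 2 = t := fun t => by
        rw [show s0 + 2 * t - s0 = 2 * t by ring]; exact Int.mul_ediv_cancel_left _ (by norm_num)
      simp only [e1] at hh
      have n1 := Int.emod_nonneg t hm'.ne'
      have n2 := Int.emod_nonneg t' hm'.ne'
      have h3 : t % (m : ℤ) = t' % m := by omega
      have h4 := Int.emod_emod_of_dvd
      obtain ⟨k, hk⟩ := Int.ModEq.dvd h3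
      have k1 : k < 1 := by nlinarith
      have k2 : -1 < k := by nlinarith
      have : k = 0 := by omega
      subst this
      have : t' = t := by linarith
      rw [this]

end BCF

namespace BCF
open KK

abbrev Quad := ℕ × ℕ × ℕ × ℕ

def Quad.pr (x : Quad) : ℕ := x.1 * x.2.1 * x.2.2.1 * x.2.2.2
def Quad.wt (x : Quad) : ℝ :=
  1 / ((x.1 : ℝ) ^ 4 * (x.2.1 : ℝ) ^ 3 * (x.2.2.1 : ℝ) ^ 2 * (x.2.2.2 : ℝ) ^ 2)

theorem Quad.wt_nonneg (x : Quad) : 0 ≤ x.wt := by unfold Quad.wt; positivity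

theorem quad_piece (p n : ℕ) (hp : 0 < p) (Q : Finset Quad) (δ : Quad → Quad) (c B : ℝ) (hc : 0 ≤ c)
    (hδ : Function.Injective δ) (hw : ∀ x, (δ x).wt = c * x.wt) (hpr : ∀ x, (δ x).pr = p * x.pr)
    (hB : ∀ Q' : Finset Quad, (∀ x ∈ Q', 0 < x.pr ∧ n ∣ x.pr) → ∑ x ∈ Q', x.wt ≤ B)
    (hQ : ∀ x ∈ Q, 0 < x.pr ∧ p * n ∣ x.pr ∧ ∃ y, x = δ y) : ∑ x ∈ Q, x.wt ≤ c * B := by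
  have h1 : Q = (Q.preimage δ hδ.injOn).image δ := by
    ext x
    simp only [Finset.mem_image, Finset.mem_preimage]
    constructor
    · intro hx
      obtain ⟨_, _, y, rfl⟩ := hQ x hx
      exact ⟨y, hx, rfl⟩
    · rintro ⟨y, hy, rfl⟩; exact hy
  rw [h1, Finset.sum_image (fun x _ y _ h => hδ h)]
  simp only [hw]
  rw [← Finset.mul_sum]
  apply mul_le_mul_of_nonneg_left _ hc
  apply hB
  intro x hx
  rw [Finset.mem_preimage] at hx
  obtain ⟨a, b, _⟩ := hQ _ hx
  rw [hpr] at a b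
  exact ⟨Nat.pos_of_mul_pos_left a, Nat.dvd_of_mul_dvd_mul_left hp b⟩

theorem sum_pow_le (N k : ℕ) (hk : 2 ≤ k) : ∑ x ∈ Finset.Icc 1 N, 1 / (x : ℝ) ^ k ≤ 2 := by
  have h := sum_inv_sq N
  have e : ∑ x ∈ Finset.Icc 1 N, 1 / (x : ℝ) ^ k = ∑ x ∈ Finset.range N, 1 / ((x : ℝ) + 1) ^ k := by
    clear h
    induction N with
    | zero => simp
    | succ N ih => rw [Finset.sum_Icc_succ_top (by omega), Finset.sum_range_succ, ih]; push_cast; rfl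
  rw [e]
  refine le_trans (Finset.sum_le_sum (fun x _ => ?_)) (h.trans ?_)
  · apply one_div_le_one_div_of_le (by positivity)
    exact pow_le_pow_right₀ (by linarith [(Nat.cast_nonneg x : (0:ℝ) ≤ x)]) hk
  · have : (0 : ℝ) ≤ 1 / N := by positivity
    linarith

theorem sum_prod_fac {α β : Type*} (I : Finset α) (J : Finset β) (f : α → ℝ) (g : β → ℝ) :
    ∑ x ∈ I ×ˢ J, f x.1 * g x.2 = (∑ x ∈ I, f x) * ∑ x ∈ J, g x := by
  rw [Finset.sum_mul_sum, Finset.sum_product]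

theorem quad_base (Q : Finset Quad) (hQ : ∀ x ∈ Q, 0 < x.pr) : ∑ x ∈ Q, x.wt ≤ 16 := by
  obtain ⟨N, hN⟩ : ∃ N : ℕ, ∀ x ∈ Q, x.1 ≤ N ∧ x.2.1 ≤ N ∧ x.2.2.1 ≤ N ∧ x.2.2.2 ≤ N := by
    refine ⟨∑ x ∈ Q, (x.1 + x.2.1 + x.2.2.1 + x.2.2.2), fun x hx => ?_⟩
    have := Finset.single_le_sum (f := fun x : Quad => x.1 + x.2.1 + x.2.2.1 + x.2.2.2)
      (fun _ _ => Nat.zero_le _) hx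
    omega
  set I := Finset.Icc 1 N
  have hsub : Q ⊆ I ×ˢ I ×ˢ I ×ˢ I := by
    rintro ⟨a, b, c, d⟩ hx
    have h1 := hN _ hx
    have h2 := hQ _ hx
    simp only [Quad.pr] at h1 h2
    simp only [Finset.mem_product, I, Finset.mem_Icc]
    have ha : a ≠ 0 := by rintro rfl; simp at h2
    have hb : b ≠ 0 := by rintro rfl; simp at h2
    have hc : c ≠ 0 := by rintro rfl; simp at h2
    have hd : d ≠ 0 := by rintro rfl; simp at h2
    omega
  refine (Finset.sum_le_sum_of_subset_of_nonneg hsub (fun x _ _ => x.wt_nonneg)).trans ?_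
  have e : ∑ x ∈ I ×ˢ I ×ˢ I ×ˢ I, Quad.wt x = (∑ x ∈ I, 1 / (x : ℝ) ^ 4) *
      ((∑ x ∈ I, 1 / (x : ℝ) ^ 3) * ((∑ x ∈ I, 1 / (x : ℝ) ^ 2) * (∑ x ∈ I, 1 / (x : ℝ) ^ 2))) := by
    rw [← sum_prod_fac I I, ← sum_prod_fac I (I ×ˢ I), ← sum_prod_fac I (I ×ˢ I ×ˢ I)]
    apply Finset.sum_congr rfl
    intro x _
    simp only [Quad.wt, one_div]
    ring
  rw [e]
  have h4 := sum_pow_le N 4 (by norm_num)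
  have h3 := sum_pow_le N 3 (by norm_num)
  have h2 := sum_pow_le N 2 (by norm_num)
  have n4 : 0 ≤ ∑ x ∈ I, 1 / (x : ℝ) ^ 4 := Finset.sum_nonneg (fun _ _ => by positivity)
  have n3 : 0 ≤ ∑ x ∈ I, 1 / (x : ℝ) ^ 3 := Finset.sum_nonneg (fun _ _ => by positivity)
  have n2 : 0 ≤ ∑ x ∈ I, 1 / (x : ℝ) ^ 2 := Finset.sum_nonneg (fun _ _ => by positivity)
  calc _ ≤ (2 : ℝ) * (2 * (2 * 2)) := by gcongr
    _ = 16 := by norm_num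

theorem quad_sum (r : ℕ) : Squarefree r → ∀ Q : Finset Quad, (∀ x ∈ Q, 0 < x.pr ∧ r ∣ x.pr) →
    ∑ x ∈ Q, x.wt ≤ 16 * 3 ^ r.primeFactors.card / (r : ℝ) ^ 2 := by
  induction r using induction_on_primes with
  | zero => intro h; exact absurd h not_squarefree_zero
  | one =>
    intro _ Q hQ
    have := quad_base Q (fun x hx => (hQ x hx).1)
    simpa using this
  | prime_mul p n hp ih =>
    intro hsq Q hQ
    have hpn : ¬ p ∣ n := by
      intro h
      obtain ⟨m, rfl⟩ := h
      have := hsq p ⟨m, by ring⟩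
      exact hp.one_lt.ne' (Nat.isUnit_iff.1 this)
    have hn0 : n ≠ 0 := by rintro rfl; simp at hpn
    have hcard : (p * n).primeFactors.card = n.primeFactors.card + 1 := by
      rw [Nat.primeFactors_mul hp.ne_zero hn0, hp.primeFactors]
      rw [Finset.singleton_union, Finset.card_insert_of_notMem]
      intro h; exact hpn (Nat.dvd_of_mem_primeFactors h)
    have hB := ih (hsq.squarefree_of_dvd (Dvd.intro_left _ rfl))
    set B : ℝ := 16 * 3 ^ n.primeFactors.card / (n : ℝ) ^ 2 with hBd
    have hB0 : 0 ≤ B := by positivity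
    have hp0 : (0 : ℝ) < p := by exact_mod_cast hp.pos
    have hp2 : (2 : ℝ) ≤ p := by exact_mod_cast hp.two_le
    have c0 : ∑ x ∈ Q.filter (fun x : Quad => p ∣ x.1), x.wt ≤ 1 / (p : ℝ) ^ 4 * B := by
      apply quad_piece p n hp.pos _ (fun x => (p * x.1, x.2)) _ _ (by positivity) _ _ _ hB
      · intro x hx
        rw [Finset.mem_filter] at hx
        obtain ⟨y, hy⟩ := hx.2
        exact ⟨(hQ x hx.1).1, (hQ x hx.1).2, (y, x.2), Prod.ext hy rfl⟩
      · rintro ⟨a, b, c, d⟩ ⟨a', b', c', d'⟩ h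
        simpa [hp.ne_zero] using h
      · intro x; simp only [Quad.wt]; push_cast; rw [one_div_mul_one_div]; congr 1; ring
      · intro x; simp only [Quad.pr]; ring
    have c1 : ∑ x ∈ Q.filter (fun x : Quad => p ∣ x.2.1), x.wt ≤ 1 / (p : ℝ) ^ 3 * B := by
      apply quad_piece p n hp.pos _ (fun x => (x.1, p * x.2.1, x.2.2)) _ _ (by positivity) _ _ _ hB
      · intro x hx
        rw [Finset.mem_filter] at hx
        obtain ⟨y, hy⟩ := hx.2
        exact ⟨(hQ x hx.1).1, (hQ x hx.1).2, (x.1, y, x.2.2), Prod.ext rfl (Prod.ext hy rfl)⟩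
      · rintro ⟨a, b, c, d⟩ ⟨a', b', c', d'⟩ h
        simpa [hp.ne_zero] using h
      · intro x; simp only [Quad.wt]; push_cast; rw [one_div_mul_one_div]; congr 1; ring
      · intro x; simp only [Quad.pr]; ring
    have c2 : ∑ x ∈ Q.filter (fun x : Quad => p ∣ x.2.2.1), x.wt ≤ 1 / (p : ℝ) ^ 2 * B := by
      apply quad_piece p n hp.pos _ (fun x => (x.1, x.2.1, p * x.2.2.1, x.2.2.2)) _ _ (by positivity)
        _ _ _ hB
      · intro x hx
        rw [Finset.mem_filter] at hx
        obtain ⟨y, hy⟩ := hx.2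
        exact ⟨(hQ x hx.1).1, (hQ x hx.1).2, (x.1, x.2.1, y, x.2.2.2),
          Prod.ext rfl (Prod.ext rfl (Prod.ext hy rfl))⟩
      · rintro ⟨a, b, c, d⟩ ⟨a', b', c', d'⟩ h
        simpa [hp.ne_zero] using h
      · intro x; simp only [Quad.wt]; push_cast; rw [one_div_mul_one_div]; congr 1; ring
      · intro x; simp only [Quad.pr]; ring
    have c3 : ∑ x ∈ Q.filter (fun x : Quad => p ∣ x.2.2.2), x.wt ≤ 1 / (p : ℝ) ^ 2 * B := by
      apply quad_piece p n hp.pos _ (fun x => (x.1, x.2.1, x.2.2.1, p * x.2.2.2)) _ _ (by positivity)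
        _ _ _ hB
      · intro x hx
        rw [Finset.mem_filter] at hx
        obtain ⟨y, hy⟩ := hx.2
        exact ⟨(hQ x hx.1).1, (hQ x hx.1).2, (x.1, x.2.1, x.2.2.1, y),
          Prod.ext rfl (Prod.ext rfl (Prod.ext rfl hy))⟩
      · rintro ⟨a, b, c, d⟩ ⟨a', b', c', d'⟩ h
        simpa [hp.ne_zero] using h
      · intro x; simp only [Quad.wt]; push_cast; rw [one_div_mul_one_div]; congr 1; ring
      · intro x; simp only [Quad.pr]; ring
    have hcov : ∑ x ∈ Q, x.wt ≤ ∑ x ∈ Q.filter (fun x : Quad => p ∣ x.1), x.wt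
        + ∑ x ∈ Q.filter (fun x : Quad => p ∣ x.2.1), x.wt
        + ∑ x ∈ Q.filter (fun x : Quad => p ∣ x.2.2.1), x.wt
        + ∑ x ∈ Q.filter (fun x : Quad => p ∣ x.2.2.2), x.wt := by
      simp only [Finset.sum_filter]
      rw [← Finset.sum_add_distrib, ← Finset.sum_add_distrib, ← Finset.sum_add_distrib]
      apply Finset.sum_le_sum
      intro x hx
      have hd : p ∣ x.pr := (Dvd.intro _ rfl : p ∣ p * n).trans (hQ x hx).2
      have hw := x.wt_nonneg
      have i0 : ∀ (P : Prop) [Decidable P], 0 ≤ (if P then x.wt else 0) := fun P _ => by split_ifs <;> simp [hw]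
      have j0 := i0 (p ∣ x.1)
      have j1 := i0 (p ∣ x.2.1)
      have j2 := i0 (p ∣ x.2.2.1)
      have j3 := i0 (p ∣ x.2.2.2)
      unfold Quad.pr at hd
      rw [hp.dvd_mul, hp.dvd_mul, hp.dvd_mul] at hd
      rcases hd with ((h | h) | h) | h
      · rw [if_pos h]; linarith
      · rw [if_pos h]; linarith
      · rw [if_pos h]; linarith
      · rw [if_pos h]; linarith
    have hfin : 16 * 3 ^ (p * n).primeFactors.card / ((p * n : ℕ) : ℝ) ^ 2 = 3 / (p : ℝ) ^ 2 * B := by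
      rw [hcard, hBd]; push_cast
      rw [pow_succ, div_mul_div_comm]; congr 1 <;> ring
    rw [hfin]
    have k4 : 1 / (p : ℝ) ^ 4 ≤ 1 / (p : ℝ) ^ 2 * (1 / 4) := by
      rw [one_div_mul_one_div]; apply one_div_le_one_div_of_le (by positivity)
      have : (4 : ℝ) ≤ p ^ 2 := by nlinarith
      nlinarith [sq_nonneg (p : ℝ)]
    have k3 : 1 / (p : ℝ) ^ 3 ≤ 1 / (p : ℝ) ^ 2 * (1 / 2) := by
      rw [one_div_mul_one_div]; apply one_div_le_one_div_of_le (by positivity); nlinarith [sq_nonneg (p : ℝ)]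
    have k2 : (0 : ℝ) < 1 / (p : ℝ) ^ 2 := by positivity
    calc _ ≤ 1 / (p : ℝ) ^ 4 * B + 1 / (p : ℝ) ^ 3 * B + 1 / (p : ℝ) ^ 2 * B + 1 / (p : ℝ) ^ 2 * B := by
          linarith
      _ = (1 / (p : ℝ) ^ 4 + 1 / (p : ℝ) ^ 3 + 1 / (p : ℝ) ^ 2 + 1 / (p : ℝ) ^ 2) * B := by ring
      _ ≤ 3 / (p : ℝ) ^ 2 * B := by
          apply mul_le_mul_of_nonneg_right _ hB0
          rw [show 3 / (p : ℝ) ^ 2 = 3 * (1 / (p : ℝ) ^ 2) by ring]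
          linarith

end BCF

namespace BCF
open KK

theorem rho_split {m g : ℕ} (hm : 0 < m) (hg : g ∣ m) :
    0 < Nat.gcd g (m / g) ∧ g = Nat.gcd g (m / g) * (g / Nat.gcd g (m / g)) ∧
    m = Nat.gcd g (m / g) * (g / Nat.gcd g (m / g)) *
      (Nat.gcd g (m / g) * ((m / g) / Nat.gcd g (m / g))) := by
  have hg0 : 0 < g := Nat.pos_of_dvd_of_pos hg hm
  have h1 : Nat.gcd g (m / g) * (g / Nat.gcd g (m / g)) = g :=
    Nat.mul_div_cancel' (Nat.gcd_dvd_left _ _)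
  have h2 : Nat.gcd g (m / g) * ((m / g) / Nat.gcd g (m / g)) = m / g :=
    Nat.mul_div_cancel' (Nat.gcd_dvd_right _ _)
  refine ⟨Nat.gcd_pos_of_pos_left _ hg0, h1.symm, ?_⟩
  rw [h1, h2, Nat.mul_div_cancel' hg]

/-- The quadruple attached to `(e, m, g)`. -/
def psi (d : (_ : ℕ × ℕ) × ℕ) : Quad :=
  (d.1.1, Nat.gcd d.2 (d.1.2 / d.2), d.2 / Nat.gcd d.2 (d.1.2 / d.2),
    (d.1.2 / d.2) / Nat.gcd d.2 (d.1.2 / d.2))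

theorem type_sum (r : ℕ) (hr : Squarefree r) (I : Finset (ℕ × ℕ))
    (hI : ∀ x ∈ I, 0 < x.1 ∧ 0 < x.2 ∧ r ∣ x.1 ^ 2 * x.2) :
    ∑ x ∈ I, (rho x.2 : ℝ) / ((x.1 : ℝ) ^ 4 * (x.2 : ℝ) ^ 2)
      ≤ 16 * 3 ^ r.primeFactors.card / (r : ℝ) ^ 2 := by
  have e1 : ∑ x ∈ I, (rho x.2 : ℝ) / ((x.1 : ℝ) ^ 4 * (x.2 : ℝ) ^ 2) =
      ∑ d ∈ I.sigma (fun x => x.2.divisors), (psi d).wt := by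
    rw [Finset.sum_sigma]
    apply Finset.sum_congr rfl
    intro x hx
    obtain ⟨h1, h2, h3⟩ := hI x hx
    unfold rho
    push_cast
    rw [Finset.sum_div]
    apply Finset.sum_congr rfl
    intro g hg
    obtain ⟨a1, a2, a3⟩ := rho_split h2 (Nat.mem_divisors.1 hg).1
    simp only [psi, Quad.wt]
    set E := Nat.gcd g (x.2 / g)
    set u := g / E
    set v := x.2 / g / E
    have hm : ((x.2 : ℕ) : ℝ) = E * u * (E * v) := by exact_mod_cast a3
    have hu : (u : ℝ) ≠ 0 := by
      rintro h
      rw [h] at hm; simp at hm; omega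
    have hv : (v : ℝ) ≠ 0 := by
      rintro h
      rw [h] at hm; simp at hm; omega
    have hE : (E : ℝ) ≠ 0 := by exact_mod_cast a1.ne'
    have he : (x.1 : ℝ) ≠ 0 := by exact_mod_cast h1.ne'
    rw [hm]
    field_simp
  rw [e1, ← Finset.sum_image (g := psi) (f := Quad.wt)]
  · apply quad_sum r hr
    intro y hy
    obtain ⟨⟨x, g⟩, hd, rfl⟩ := Finset.mem_image.1 hy
    rw [Finset.mem_sigma] at hd
    obtain ⟨h1, h2, h3⟩ := hI x hd.1
    obtain ⟨a1, a2, a3⟩ := rho_split h2 (Nat.mem_divisors.1 hd.2).1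
    simp only at a1 a2 a3
    simp only [psi, Quad.pr]
    set E := Nat.gcd g (x.2 / g)
    set u := g / E
    set v := x.2 / g / E
    have hu : 0 < u := by
      rcases Nat.eq_zero_or_pos u with h | h
      · rw [h] at a3; simp at a3; omega
      · exact h
    have hv : 0 < v := by
      rcases Nat.eq_zero_or_pos v with h | h
      · rw [h] at a3; simp at a3; omega
      · exact h
    refine ⟨by positivity, ?_⟩
    have h4 : r ∣ (x.1 * E * u * v) ^ 2 := by
      rw [a3] at h3
      refine h3.trans ⟨u * v, by ring⟩
    exact (hr.dvd_pow_iff_dvd two_ne_zero).1 h4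
  · rintro ⟨⟨e, m⟩, g⟩ hd ⟨⟨e', m'⟩, g'⟩ hd' h
    rw [Finset.mem_coe, Finset.mem_sigma] at hd hd'
    obtain ⟨h1, h2, h3⟩ := hI _ hd.1
    obtain ⟨a1, a2, a3⟩ := rho_split h2 (Nat.mem_divisors.1 hd.2).1
    obtain ⟨h1', h2', h3'⟩ := hI _ hd'.1
    obtain ⟨b1, b2, b3⟩ := rho_split h2' (Nat.mem_divisors.1 hd'.2).1
    simp only [psi, Prod.mk.injEq] at h a1 a2 a3 b1 b2 b3
    obtain ⟨k0, k1, k2, k3⟩ := h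
    rw [k2, k3, k1] at a3
    rw [k2, k1] at a2
    rw [← b3] at a3
    rw [← b2] at a2
    subst a2 a3 k0
    rfl

theorem T_bound (r : ℕ) (hr : Squarefree r) (Y : ℝ) (hY : 0 < Y) :
    NB (SP r 1 Y) (580608 * 3 ^ r.primeFactors.card * Y / (r : ℝ) ^ 2) := by
  set N := ⌈3 * Y⌉₊ with hN
  set I := ((Finset.Icc 1 N) ×ˢ (Finset.Icc 1 N)).filter (fun x : ℕ × ℕ => r ∣ x.1 ^ 2 * x.2) with hI
  have hmem : ∀ x ∈ I, 0 < x.1 ∧ 0 < x.2 ∧ r ∣ x.1 ^ 2 * x.2 := by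
    intro x hx
    rw [hI, Finset.mem_filter, Finset.mem_product, Finset.mem_Icc, Finset.mem_Icc] at hx
    exact ⟨hx.1.1.1, hx.1.2.1, hx.2⟩
  have hs := NB_split I (P := SP r 1 Y) (fun x f => ∃ Δ s, TP (x.1 : ℤ) (x.2 : ℤ) Δ s f ∧ Δ ≠ 0 ∧
      |(Δ : ℝ)| < 3 * Y / ((x.1 : ℝ) ^ 4 * (x.2 : ℝ) ^ 2))
    (fun x => ((2 * rho x.2 : ℕ) : ℝ) * (224 * (27 * (3 * Y / ((x.1 : ℝ) ^ 4 * (x.2 : ℝ) ^ 2)))))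
    (by
      rintro f ⟨hd, hY', hH, _, _⟩
      obtain ⟨e, m, Δ, s, he, hm, hΔ, hTP, hdis, hdv⟩ := exists_TP hd
      lift e to ℕ using he.le
      lift m to ℕ using hm.le
      have he' : 0 < e := by exact_mod_cast he
      have hm' : 0 < m := by exact_mod_cast hm
      have hpos : (0 : ℝ) < (e : ℝ) ^ 4 * (m : ℝ) ^ 2 := by positivity
      have h1 : 3 * |(disc f : ℝ)| = ((e : ℝ) ^ 4 * (m : ℝ) ^ 2) * |(Δ : ℝ)| := by
        have : (-3 : ℝ) * disc f = (e : ℝ) ^ 4 * (m : ℝ) ^ 2 * Δ := by exact_mod_cast hdis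
        have h2 := congrArg abs this
        rw [abs_mul, abs_mul, abs_of_pos hpos] at h2
        rw [← h2]; norm_num
      have hΔ1 : (1 : ℝ) ≤ |(Δ : ℝ)| := by exact_mod_cast Int.one_le_abs hΔ
      have hlt : (e : ℝ) ^ 4 * (m : ℝ) ^ 2 < 3 * Y := by nlinarith
      have hnat : e ^ 4 * m ^ 2 ≤ N := by
        have : ((e ^ 4 * m ^ 2 : ℕ) : ℝ) ≤ N := by
          push_cast; exact hlt.le.trans (Nat.le_ceil _)
        exact_mod_cast this
      have heN : e ≤ N := by
        refine le_trans ?_ hnat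
        calc e ≤ e ^ 4 := Nat.le_self_pow (by norm_num) _
          _ ≤ e ^ 4 * m ^ 2 := Nat.le_mul_of_pos_right _ (by positivity)
      have hmN : m ≤ N := by
        refine le_trans ?_ hnat
        calc m ≤ m ^ 2 := Nat.le_self_pow (by norm_num) _
          _ ≤ e ^ 4 * m ^ 2 := Nat.le_mul_of_pos_left _ (by positivity)
      refine ⟨(e, m), ?_, Δ, s, hTP, hΔ, ?_⟩
      · rw [hI, Finset.mem_filter, Finset.mem_product, Finset.mem_Icc, Finset.mem_Icc]
        exact ⟨⟨⟨he', heN⟩, ⟨hm', hmN⟩⟩, by exact_mod_cast hdv r hH⟩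
      · rw [lt_div_iff₀ hpos]; nlinarith)
    (by
      intro x hx
      obtain ⟨h1, h2, h3⟩ := hmem x hx
      have h1' : (0 : ℝ) < x.1 := by exact_mod_cast h1
      have h2' : (0 : ℝ) < x.2 := by exact_mod_cast h2
      exact fiber_bound (x.1 : ℤ) (x.2 : ℤ) (by exact_mod_cast h2) (rho x.2) (sroots_card x.2 h2) _
        (by positivity))
  intro S hS hsep
  refine (hs S hS hsep).trans ?_
  have e2 : ∑ x ∈ I, ((2 * rho x.2 : ℕ) : ℝ) * (224 * (27 * (3 * Y / ((x.1 : ℝ) ^ 4 * (x.2 : ℝ) ^ 2))))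
      = 36288 * Y * ∑ x ∈ I, (rho x.2 : ℝ) / ((x.1 : ℝ) ^ 4 * (x.2 : ℝ) ^ 2) := by
    rw [Finset.mul_sum]
    apply Finset.sum_congr rfl
    intro x _
    push_cast; ring
  rw [e2]
  have h4 := mul_le_mul_of_nonneg_left (type_sum r hr I hmem) (show 0 ≤ 36288 * Y by positivity)
  refine h4.trans (le_of_eq ?_)
  ring

end BCF

namespace BCF
open KK

theorem coprime_bound (r : ℕ) (hr : Squarefree r) (h6 : Nat.Coprime r 6) (Y : ℝ) (hY : 0 < Y) :
    NB (fun f => disc f ≠ 0 ∧ |(disc f : ℝ)| < Y ∧ (r : ℤ) ^ 2 ∣ disc f)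
      (580608 * 6 ^ r.primeFactors.card * Y / (r : ℝ) ^ 2) := by
  have hr0 : r ≠ 0 := hr.ne_zero
  have hsplit : ∀ r1 ∈ r.divisors, r1 * (r / r1) = r ∧ Squarefree r1 ∧ Squarefree (r / r1) ∧
      Nat.Coprime r1 (r / r1) := by
    intro r1 h
    have h1 : r1 * (r / r1) = r := Nat.mul_div_cancel' (Nat.mem_divisors.1 h).1
    have h2 := hr
    rw [← h1, Nat.squarefree_mul_iff] at h2
    exact ⟨h1, h2.2.1, h2.2.2, h2.1⟩
  have hs := NB_split r.divisors
    (P := fun f => disc f ≠ 0 ∧ |(disc f : ℝ)| < Y ∧ (r : ℤ) ^ 2 ∣ disc f)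
    (fun r1 f => SP r1 (r / r1) Y f) (fun _ => 580608 * 3 ^ r.primeFactors.card * Y / (r : ℝ) ^ 2)
    (by
      rintro f ⟨hd, hY', hdv⟩
      set n : ℕ := Nat.gcd (H0 f).natAbs (Nat.gcd (H1 f).natAbs (H2 f).natAbs) with hn
      have hHD : ∀ k : ℕ, HD (k : ℤ) f ↔ k ∣ n := by
        intro k
        rw [hn, Nat.dvd_gcd_iff, Nat.dvd_gcd_iff]
        unfold HD
        rw [Int.natCast_dvd, Int.natCast_dvd, Int.natCast_dvd]
      have hmem : Nat.gcd r n ∈ r.divisors := Nat.mem_divisors.2 ⟨Nat.gcd_dvd_left _ _, hr0⟩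
      obtain ⟨a1, a2, a3, a4⟩ := hsplit _ hmem
      refine ⟨Nat.gcd r n, hmem, hd, hY', (hHD _).2 (Nat.gcd_dvd_right _ _), ?_, ?_⟩
      · refine dvd_trans (pow_dvd_pow_of_dvd ?_ 2) hdv
        exact_mod_cast Nat.div_dvd_of_dvd (Nat.gcd_dvd_left r n)
      · intro q hq hq1 hH
        have h1 : q ∣ Nat.gcd r n := Nat.dvd_gcd
          (hq1.trans (Nat.div_dvd_of_dvd (Nat.gcd_dvd_left r n))) ((hHD q).1 hH)
        have h2 := Nat.dvd_gcd h1 hq1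
        rw [a4] at h2
        exact hq.one_lt.ne' (Nat.dvd_one.1 h2))
    (by
      intro r1 hr1
      obtain ⟨a1, a2, a3, a4⟩ := hsplit r1 hr1
      set r2 := r / r1 with hr2
      have hr20 : r2 ≠ 0 := a3.ne_zero
      have hr10 : r1 ≠ 0 := a2.ne_zero
      have b2 : (0 : ℝ) < r2 := by exact_mod_cast Nat.pos_of_ne_zero hr20
      have b1 : (0 : ℝ) < r1 := by exact_mod_cast Nat.pos_of_ne_zero hr10
      have h := SP_all r1 r2 a3 (h6.coprime_dvd_left (Dvd.intro_left _ a1)) a4 Y _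
        (T_bound r1 a2 (Y / r2 ^ 2) (by positivity))
      have hc : r.primeFactors.card = r1.primeFactors.card + r2.primeFactors.card := by
        conv_lhs => rw [← a1]
        rw [a4.primeFactors_mul, Finset.card_union_of_disjoint a4.disjoint_primeFactors]
      have hrr : (r : ℝ) = r1 * r2 := by exact_mod_cast a1.symm
      have he : (3 : ℝ) ^ r2.primeFactors.card *
          (580608 * 3 ^ r1.primeFactors.card * (Y / (r2 : ℝ) ^ 2) / (r1 : ℝ) ^ 2) =
          580608 * 3 ^ r.primeFactors.card * Y / (r : ℝ) ^ 2 := by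
        rw [hc, hrr, pow_add]; field_simp
      rw [he] at h
      exact h)
  intro S hS hsep
  refine (hs S hS hsep).trans ?_
  rw [Finset.sum_const, nsmul_eq_mul]
  have hcard : (r.divisors.card : ℝ) ≤ 2 ^ r.primeFactors.card := by
    have : r.divisors.card ≤ 2 ^ r.primeFactors.card := by
      rw [Nat.card_divisors hr0]
      apply Finset.prod_le_pow_card
      intro p _
      have := hr.natFactorization_le_one p
      omega
    exact_mod_cast this
  have hnn : 0 ≤ 580608 * 3 ^ r.primeFactors.card * Y / (r : ℝ) ^ 2 := by positivity
  refine (mul_le_mul_of_nonneg_right hcard hnn).trans (le_of_eq ?_)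
  rw [show (6 : ℝ) = 2 * 3 by norm_num, mul_pow]
  ring

end BCF

open BCF in
/-- Lemma 3.3 (Belabas–Bhargava–Pomerance): the number of `GL₂(ℤ)`-classes of integral
binary cubic forms with `0 < |Disc| < Y` and `r² | Disc` is at most `M·6^{ω(r)}·Y/r²`. -/
theorem count_discriminants_divisible_by_square :
    ∃ M : ℝ, ∀ r : ℕ, Squarefree r → ∀ Y : ℝ, 0 < Y →
      ∀ S : Finset BCF,
        (∀ f ∈ S, disc f ≠ 0 ∧ (|disc f| : ℝ) < Y ∧ ((r : ℤ) ^ 2 ∣ disc f)) →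
        (∀ f ∈ S, ∀ g ∈ S, f ≠ g → ¬ GLeq f g) →
        (S.card : ℝ) ≤ M * 6 ^ r.primeFactors.card * Y / (r : ℝ) ^ 2 := by
  refine ⟨36 * 580608, fun r hr Y hY S hS hsep => ?_⟩
  set d := Nat.gcd r 6 with hd
  have h1 : d * (r / d) = r := Nat.mul_div_cancel' (Nat.gcd_dvd_left _ _)
  set r' := r / d with hr'
  have hsq := hr
  rw [← h1, Nat.squarefree_mul_iff] at hsq
  obtain ⟨c1, c2, c3⟩ := hsq
  have h6 : Nat.Coprime r' 6 := by
    have e1 : Nat.gcd r' 6 ∣ d :=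
      Nat.dvd_gcd ((Nat.gcd_dvd_left _ _).trans (Dvd.intro_left _ h1)) (Nat.gcd_dvd_right _ _)
    have e2 := Nat.dvd_gcd e1 (Nat.gcd_dvd_left r' 6)
    rw [c1] at e2
    exact Nat.dvd_one.1 e2
  have hd6 : d ≤ 6 := Nat.gcd_le_right _ (by norm_num)
  have hb := coprime_bound r' c3 h6 Y hY S (fun f hf => by
    obtain ⟨x1, x2, x3⟩ := hS f hf
    refine ⟨x1, x2, dvd_trans (pow_dvd_pow_of_dvd ?_ 2) x3⟩
    exact_mod_cast (Dvd.intro_left _ h1 : r' ∣ r)) hsep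
  refine hb.trans ?_
  have hw : r'.primeFactors.card ≤ r.primeFactors.card :=
    Finset.card_le_card (Nat.primeFactors_mono (Dvd.intro_left _ h1) hr.ne_zero)
  have hr0 : (0 : ℝ) < r := by exact_mod_cast Nat.pos_of_ne_zero hr.ne_zero
  have hr0' : (0 : ℝ) < r' := by exact_mod_cast Nat.pos_of_ne_zero c3.ne_zero
  have hle : (r : ℝ) ≤ 6 * r' := by
    have : r ≤ 6 * r' := by
      conv_lhs => rw [← h1]
      exact Nat.mul_le_mul_right _ hd6
    exact_mod_cast this
  have hp : (6 : ℝ) ^ r'.primeFactors.card ≤ 6 ^ r.primeFactors.card :=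
    pow_le_pow_right₀ (by norm_num) hw
  have hsqr : (r : ℝ) ^ 2 ≤ 36 * r' ^ 2 := by nlinarith
  rw [div_le_div_iff₀ (by positivity) (by positivity)]
  have hA : 0 ≤ 580608 * (6 : ℝ) ^ r.primeFactors.card * Y := by positivity
  calc 580608 * (6 : ℝ) ^ r'.primeFactors.card * Y * (r : ℝ) ^ 2
      ≤ 580608 * (6 : ℝ) ^ r.primeFactors.card * Y * (36 * r' ^ 2) := by gcongr
    _ = 36 * 580608 * 6 ^ r.primeFactors.card * Y * (r' : ℝ) ^ 2 := by ring
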